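/- There exist a constant c > 0 and N₀ such that #(B ∩ [1,N]) ≥ c·N for all N ≥ N₀; that is, the set of distinct curvatures of circles in the gasket has positive lower density in the natural numbers. -/

import Mathlib

/-- The four generators `S₁, S₂, S₃, S₄` of the Apollonian group. -/
def Sgen : Fin 4 → Matrix (Fin 4) (Fin 4) ℤ :=
  ![!![-1, 2, 2, 2; 0, 1, 0, 0; 0, 0, 1, 0; 0, 0, 0, 1],
    !![1, 0, 0, 0; 2, -1, 2, 2; 0, 0, 1, 0; 0, 0, 0, 1],
    !![1, 0, 0, 0; 0, 1, 0, 0; 2, 2, -1, 2; 0, 0, 0, 1],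
    !![1, 0, 0, 0; 0, 1, 0, 0; 0, 0, 1, 0; 2, 2, 2, -1]]

/-- Membership in the Apollonian group `Γ = ⟨S₁, S₂, S₃, S₄⟩`. -/
def ApollonianMem (γ : Matrix (Fin 4) (Fin 4) ℤ) : Prop :=
  ∃ l : List (Fin 4), γ = (l.map Sgen).prod

/-- The root quadruple `(−10, 18, 23, 27)` of the gasket. -/
def rootQuadruple : Fin 4 → ℤ := ![-10, 18, 23, 27]

/-- `B` is the set of curvatures of circles in the gasket. -/
def curvatures : Set ℤ :=
  {n : ℤ | ∃ (γ : Matrix (Fin 4) (Fin 4) ℤ) (j : Fin 4),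
    ApollonianMem γ ∧ (γ.mulVec rootQuadruple) j = n}

open Finset

def Orb (w : Fin 4 → ℤ) : Prop := ∃ l : List (Fin 4), w = ((l.map Sgen).prod).mulVec rootQuadruple

def Qd (a b c d : ℤ) : Prop := ∃ σ : Equiv.Perm (Fin 4), Orb (fun i => ![a, b, c, d] (σ i))

lemma Orb.step {w : Fin 4 → ℤ} (h : Orb w) (i : Fin 4) : Orb ((Sgen i).mulVec w) := by
  obtain ⟨l, rfl⟩ := h
  exact ⟨i :: l, by rw [List.map_cons, List.prod_cons, Matrix.mulVec_mulVec]⟩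

lemma Sgen_mulVec (i : Fin 4) (w : Fin 4 → ℤ) : (Sgen i).mulVec w = fun j => if j = i then 2 * ∑ k, w k - 3 * w i else w j := by
  funext j
  fin_cases i <;> fin_cases j <;> simp [Sgen, Matrix.mulVec, dotProduct, Fin.sum_univ_four] <;> ring

lemma Qd.refl {a b c d : ℤ} (h : Qd a b c d) : Qd a b c (2 * (a + b + c) - d) := by
  obtain ⟨σ, hσ⟩ := h
  refine ⟨σ, ?_⟩
  have := hσ.step (σ.symm 3)
  rw [Sgen_mulVec] at this
  convert this using 1
  funext j
  rw [Equiv.sum_comp σ (fun k => ![a, b, c, d] k), Fin.sum_univ_four]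
  by_cases hj : j = σ.symm 3
  · subst hj; simp; ring
  · rw [if_neg hj]
    have : σ j ≠ 3 := fun h => hj (by rw [← h]; simp)
    revert this; generalize σ j = k; fin_cases k <;> simp

lemma Qd.perm {a b c d : ℤ} (h : Qd a b c d) (τ : Equiv.Perm (Fin 4)) :
    Qd (![a, b, c, d] (τ 0)) (![a, b, c, d] (τ 1)) (![a, b, c, d] (τ 2)) (![a, b, c, d] (τ 3)) := by
  obtain ⟨σ, hσ⟩ := h
  refine ⟨τ.symm.trans (Equiv.refl _) |> fun t => σ.trans t, ?_⟩
  convert hσ using 1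
  funext j
  simp only [Equiv.trans_apply, Equiv.refl_apply]
  have : ∀ k, ![![a, b, c, d] (τ 0), ![a, b, c, d] (τ 1), ![a, b, c, d] (τ 2), ![a, b, c, d] (τ 3)] k = ![a, b, c, d] (τ k) := by
    intro k; fin_cases k <;> rfl
  rw [this]; simp

lemma Qd.s01 {a b c d : ℤ} (h : Qd a b c d) : Qd b a c d := h.perm (Equiv.swap 0 1)
lemma Qd.s12 {a b c d : ℤ} (h : Qd a b c d) : Qd a c b d := h.perm (Equiv.swap 1 2)
lemma Qd.s23 {a b c d : ℤ} (h : Qd a b c d) : Qd a b d c := h.perm (Equiv.swap 2 3)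

lemma Qd.mem {a b c d : ℤ} (h : Qd a b c d) : b ∈ curvatures := by
  obtain ⟨σ, l, hl⟩ := h
  refine ⟨(l.map Sgen).prod, σ.symm 1, ⟨l, rfl⟩, ?_⟩
  rw [← hl]; simp

lemma Qd_root : Qd (-10) 18 23 27 := ⟨Equiv.refl _, [], by simp [rootQuadruple]⟩

def qf (A B C : ℤ) (v : ℤ × ℤ) : ℤ := A * v.1 ^ 2 + B * v.1 * v.2 + C * v.2 ^ 2

def Sb (a A B C : ℤ) (v w : ℤ × ℤ) : Prop := Qd a (qf A B C v - a) (qf A B C w - a) (qf A B C (v + w) - a)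

lemma Sb.symm {a A B C : ℤ} {v w : ℤ × ℤ} (h : Sb a A B C v w) : Sb a A B C w v := by
  unfold Sb at *; rw [add_comm]; exact h.s12

lemma Sb.neg {a A B C : ℤ} {v w : ℤ × ℤ} (h : Sb a A B C v w) : Sb a A B C v (-w) := by
  unfold Sb at *
  convert h.refl using 1
  · simp [qf]
  · simp [qf]; ring

lemma Sb.add {a A B C : ℤ} {v w : ℤ × ℤ} (h : Sb a A B C v w) : Sb a A B C v (v + w) := by
  unfold Sb at *
  convert h.s23.refl using 1
  simp [qf]; ring

lemma Sb.sub {a A B C : ℤ} {v w : ℤ × ℤ} (h : Sb a A B C v w) : Sb a A B C v (w - v) := by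
  have := h.neg.add.neg
  rwa [show -(v + -w) = w - v by abel] at this

lemma Sb.shift {a A B C : ℤ} {v w : ℤ × ℤ} (h : Sb a A B C v w) (t : ℤ) : Sb a A B C v (w + t • v) := by
  induction t using Int.induction_on with
  | zero => simpa using h
  | succ i ih => 
    have := ih.add
    rwa [show v + (w + (i : ℤ) • v) = w + ((i : ℤ) + 1) • v by rw [add_smul, one_smul]; abel] at this
  | pred i ih =>
    have := ih.sub
    rwa [show w + (-(i : ℤ)) • v - v = w + (-(i : ℤ) - 1) • v by rw [sub_smul, one_smul]; abel] at this

def dt (v w : ℤ × ℤ) : ℤ := v.1 * w.2 - v.2 * w.1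

lemma Sb.euclid {a A B C : ℤ} (n : ℕ) : ∀ x y : ℕ, x + y ≤ n → Nat.Coprime x y → ∀ v w : ℤ × ℤ, Sb a A B C v w →
    (dt v w) ^ 2 = 1 → ∃ δ, (dt ((x : ℤ) • v + (y : ℤ) • w) δ) ^ 2 = 1 ∧ Sb a A B C ((x : ℤ) • v + (y : ℤ) • w) δ := by
  induction n with
  | zero =>
    intro x y hn hc
    obtain ⟨rfl, rfl⟩ : x = 0 ∧ y = 0 := by omega
    simp at hc
  | succ n ih =>
    intro x y hn hc v w h hd
    rcases Nat.eq_zero_or_pos x with rfl | hx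
    · have : y = 1 := by simpa using hc
      subst this
      refine ⟨v, ?_, by simpa using h.symm⟩
      rw [← hd]; simp [dt]; ring
    rcases Nat.eq_zero_or_pos y with rfl | hy
    · have : x = 1 := by simpa using hc
      subst this
      exact ⟨w, by rw [← hd]; simp [dt], by simpa using h⟩
    rcases le_total y x with hle | hle
    · obtain ⟨δ, h1, h2⟩ := ih (x - y) y (by omega) ((Nat.coprime_sub_self_left hle).2 hc) v (v + w) h.add
        (by rw [← hd]; simp [dt]; ring)
      have e : ((x - y : ℕ) : ℤ) • v + (y : ℤ) • (v + w) = (x : ℤ) • v + (y : ℤ) • w := by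
        rw [Nat.cast_sub hle, sub_smul, smul_add]; abel
      rw [e] at h1 h2
      exact ⟨δ, h1, h2⟩
    · obtain ⟨δ, h1, h2⟩ := ih x (y - x) (by omega) ((Nat.coprime_sub_self_right hle).2 hc) (v + w) w
        (by have := h.symm.add.symm; rwa [add_comm] at this)
        (by rw [← hd]; simp [dt]; ring)
      have e : (x : ℤ) • (v + w) + ((y - x : ℕ) : ℤ) • w = (x : ℤ) • v + (y : ℤ) • w := by
        rw [Nat.cast_sub hle, sub_smul, smul_add]; abel
      rw [e] at h1 h2
      exact ⟨δ, h1, h2⟩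

lemma Sb.all {a A B C : ℤ} (h : Sb a A B C (1, 0) (0, 1)) (e : ℤ × ℤ) (he : IsCoprime e.1 e.2) :
    ∃ δ, dt e δ = 1 ∧ Sb a A B C e δ := by
  have key : ∃ δ, (dt e δ) ^ 2 = 1 ∧ Sb a A B C e δ := by
    have h2 : ∀ s t : ℤ, (s = 1 ∨ s = -1) → (t = 1 ∨ t = -1) → Sb a A B C (s, 0) (0, t) := by
      intro s t hs ht
      have g1 : Sb a A B C (1, 0) (0, t) := by
        rcases ht with rfl | rfl
        · exact h
        · simpa using h.neg
      rcases hs with rfl | rfl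
      · exact g1
      · simpa using g1.symm.neg.symm
    obtain ⟨x, y⟩ := e
    have hc : Nat.Coprime x.natAbs y.natAbs := Int.isCoprime_iff_gcd_eq_one.1 he
    have hs : ∀ x : ℤ, ∃ s : ℤ, (s = 1 ∨ s = -1) ∧ (x.natAbs : ℤ) * s = x := by
      intro x
      rcases le_total 0 x with h0 | h0
      · exact ⟨1, Or.inl rfl, by omega⟩
      · exact ⟨-1, Or.inr rfl, by omega⟩
    obtain ⟨s, s1, s2⟩ := hs x
    obtain ⟨t, t1, t2⟩ := hs y
    obtain ⟨δ, d1, d2⟩ := Sb.euclid (x.natAbs + y.natAbs) x.natAbs y.natAbs le_rfl hc (s, 0) (0, t) (h2 s t s1 t1)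
      (by rcases s1 with rfl | rfl <;> rcases t1 with rfl | rfl <;> simp [dt])
    have e : (x.natAbs : ℤ) • ((s, 0) : ℤ × ℤ) + (y.natAbs : ℤ) • ((0, t) : ℤ × ℤ) = (x, y) := by
      ext
      · simpa using s2
      · simpa using t2
    rw [e] at d1 d2
    exact ⟨δ, d1, d2⟩
  obtain ⟨δ, h1, h2⟩ := key
  rcases mul_eq_zero.1 (show (dt e δ - 1) * (dt e δ + 1) = 0 by linear_combination h1) with h3 | h3
  · exact ⟨δ, by linarith, h2⟩
  · exact ⟨-δ, by simp [dt] at h3 ⊢; linarith, h2.neg⟩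

lemma packing (u v : ℤ) (he : IsCoprime u v) (A : ℤ) (hA : A = 8 * u ^ 2 - 4 * u * v + 13 * v ^ 2) (hA0 : 0 < A) :
    ∃ B : ℤ, 0 ≤ B ∧ B < A ∧ ∀ x y : ℤ, IsCoprime x y → ∃ z1 z2 : ℤ, z1 ^ 2 + z2 ^ 2 - (A + 10) ∈ curvatures ∧
      (2 * u - 3 * v) * z1 + 2 * (u + v) * z2 = A * x + B * y ∧
      (2 * u - 3 * v) * z2 - 2 * (u + v) * z1 = (A + 10) * y := by
  have h0 : Sb (-10) 8 (-4) 13 (1, 0) (0, 1) := by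
    unfold Sb; simp [qf]; exact Qd_root
  obtain ⟨δ0, hd0, hS0⟩ := h0.all (u, v) he
  set B0 := (2 * u - 3 * v) * (2 * δ0.1 - 3 * δ0.2) + 2 * (u + v) * (2 * (δ0.1 + δ0.2)) with hB0
  have hS := hS0.shift (-(B0 / A))
  have hd : dt (u, v) (δ0 + (-(B0 / A)) • (u, v)) = 1 := by rw [← hd0]; simp [dt]; ring
  have hB : (2 * u - 3 * v) * (2 * (δ0 + (-(B0 / A)) • (u, v)).1 - 3 * (δ0 + (-(B0 / A)) • (u, v)).2) +
      2 * (u + v) * (2 * ((δ0 + (-(B0 / A)) • (u, v)).1 + (δ0 + (-(B0 / A)) • (u, v)).2)) = B0 % A := by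
    rw [Int.emod_def]
    generalize B0 / A = t at *
    rw [hB0, hA]; simp; ring
  generalize δ0 + (-(B0 / A)) • (u, v) = δ at *
  refine ⟨B0 % A, Int.emod_nonneg _ hA0.ne', Int.emod_lt_of_pos _ hA0, fun x y hxy => ?_⟩
  obtain ⟨p, q⟩ := δ
  simp only [dt] at hd hB
  have hS2 : Sb (A + 10) A (4 * u * p * 4 - 4 * (u * q + v * p) + 26 * v * q) (A + 10 + (8 * p ^ 2 - 4 * p * q + 13 * q ^ 2 + 10)) (1, 0) (0, 1) := by
    unfold Sb at hS ⊢
    convert hS.s01 using 1 <;> simp [qf] <;> (try rw [hA]) <;> ring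
  obtain ⟨δ', _, hδ⟩ := hS2.all (x, y) hxy
  refine ⟨(2 * (x * u + y * p) - 3 * (x * v + y * q)) - y * (2 * (u + v)), 2 * ((x * u + y * p) + (x * v + y * q)) + y * (2 * u - 3 * v), ?_, ?_, ?_⟩
  · convert hδ.mem using 1
    simp only [qf]; rw [hA]
    linear_combination (20 * y ^ 2) * hd
  · rw [← hB, hA]; ring
  · rw [hA]; linear_combination (10 * y) * hd

/-- Kloosterman sum -/
noncomputable def kloo (p : ℕ) [Fact p.Prime] (a b : ZMod p) : ℂ :=
  ∑ x : (ZMod p)ˣ, ZMod.stdAddChar (a * (x : ZMod p) + b * ((x⁻¹ : (ZMod p)ˣ) : ZMod p))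

lemma kloo_twist (p : ℕ) [Fact p.Prime] (a b : ZMod p) (t : (ZMod p)ˣ) :
    kloo p (a * t) (b * (t⁻¹ : (ZMod p)ˣ)) = kloo p a b := by
  unfold kloo
  refine Fintype.sum_equiv (Equiv.mulLeft t) _ _ fun x => ?_
  congr 1
  simp only [Equiv.coe_mulLeft, Units.val_mul, mul_inv]
  ring

lemma sum_char_eq (p : ℕ) [Fact p.Prime] (b : ZMod p) :
    ∑ u : ZMod p, (ZMod.stdAddChar (u * b) : ℂ) = if b = 0 then (p : ℂ) else 0 := by
  have := AddChar.sum_mulShift (R := ZMod p) b (ZMod.isPrimitive_stdAddChar p)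
  simpa using this

lemma norm_char (p : ℕ) [Fact p.Prime] (b : ZMod p) : ‖(ZMod.stdAddChar b : ℂ)‖ = 1 :=
  AddChar.norm_apply _ _

lemma conj_char (p : ℕ) [Fact p.Prime] (b : ZMod p) :
    (starRingEnd ℂ) (ZMod.stdAddChar b : ℂ) = ZMod.stdAddChar (-b) := by
  rw [AddChar.map_neg_eq_conj]

/-- number of solutions in the fourth moment -/
lemma quad_count (p : ℕ) [Fact p.Prime] :
    ((univ : Finset ((ZMod p)ˣ × (ZMod p)ˣ × (ZMod p)ˣ × (ZMod p)ˣ)).filter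
      (fun w => (w.1 : ZMod p) + w.2.1 - w.2.2.1 - w.2.2.2 = 0 ∧
        ((w.1⁻¹ : (ZMod p)ˣ) : ZMod p) + ((w.2.1⁻¹ : (ZMod p)ˣ) : ZMod p)
          - ((w.2.2.1⁻¹ : (ZMod p)ˣ) : ZMod p) - ((w.2.2.2⁻¹ : (ZMod p)ˣ) : ZMod p) = 0)).card
      ≤ 3 * (p - 1) ^ 2 := by
  classical
  set U := (univ : Finset (ZMod p)ˣ)
  have hU : U.card = p - 1 := by rw [Finset.card_univ, ZMod.card_units]
  have hUU : (U ×ˢ U).card = (p - 1) ^ 2 := by rw [card_product, hU, sq]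
  let f1 : (ZMod p)ˣ × (ZMod p)ˣ → (ZMod p)ˣ × (ZMod p)ˣ × (ZMod p)ˣ × (ZMod p)ˣ :=
    fun w => (w.1, w.2, w.1, w.2)
  let f2 : (ZMod p)ˣ × (ZMod p)ˣ → (ZMod p)ˣ × (ZMod p)ˣ × (ZMod p)ˣ × (ZMod p)ˣ :=
    fun w => (w.1, w.2, w.2, w.1)
  let f3 : (ZMod p)ˣ × (ZMod p)ˣ → (ZMod p)ˣ × (ZMod p)ˣ × (ZMod p)ˣ × (ZMod p)ˣ :=
    fun w => (w.1, -w.1, w.2, -w.2)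
  refine (card_le_card (t := (U ×ˢ U).image f1 ∪ ((U ×ˢ U).image f2 ∪ (U ×ˢ U).image f3)) ?_).trans ?_
  · rintro ⟨x, y, z, w⟩ h
    simp only [mem_filter, mem_univ, true_and] at h
    obtain ⟨h1, h2⟩ := h
    have hx : (x : ZMod p) ≠ 0 := x.ne_zero
    have hy : (y : ZMod p) ≠ 0 := y.ne_zero
    have hz : (z : ZMod p) ≠ 0 := z.ne_zero
    have hw : (w : ZMod p) ≠ 0 := w.ne_zero
    simp only [Units.val_inv_eq_inv_val] at h2
    field_simp at h2
    have hwe : (w : ZMod p) = x + y - z := by linear_combination -h1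
    have h3 : ((x : ZMod p) + y) * ((z - x) * (z - y)) = 0 := by
      rw [hwe] at h2
      linear_combination (-1) * h2
    simp only [mem_union, mem_image, mem_product, Prod.exists]
    rcases mul_eq_zero.1 h3 with h | h
    · right; right
      refine ⟨x, z, ⟨mem_univ _, mem_univ _⟩, ?_⟩
      simp only [f3, Prod.mk.injEq, true_and]
      constructor
      · ext; push_cast; linear_combination -h
      · ext; push_cast; rw [hwe]; linear_combination -h
    rcases mul_eq_zero.1 h with h | h
    · left
      refine ⟨x, y, ⟨mem_univ _, mem_univ _⟩, ?_⟩
      simp only [f1, Prod.mk.injEq, true_and]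
      constructor
      · ext; linear_combination -h
      · ext; rw [hwe]; linear_combination h
    · right; left
      refine ⟨x, y, ⟨mem_univ _, mem_univ _⟩, ?_⟩
      simp only [f2, Prod.mk.injEq, true_and]
      constructor
      · ext; linear_combination -h
      · ext; rw [hwe]; linear_combination h
  · have c1 := card_image_le (s := U ×ˢ U) (f := f1)
    have c2 := card_image_le (s := U ×ˢ U) (f := f2)
    have c3 := card_image_le (s := U ×ˢ U) (f := f3)
    have := card_union_le ((U ×ˢ U).image f1) ((U ×ˢ U).image f2 ∪ (U ×ˢ U).image f3)
    have := card_union_le ((U ×ˢ U).image f2) ((U ×ˢ U).image f3)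
    omega

lemma norm_kloo_four (p : ℕ) [Fact p.Prime] (a b : ZMod p) :
    ((‖kloo p a b‖ ^ 4 : ℝ) : ℂ) =
      ∑ w : (ZMod p)ˣ × (ZMod p)ˣ × (ZMod p)ˣ × (ZMod p)ˣ,
        (ZMod.stdAddChar (a * (((w.1 : (ZMod p)ˣ) : ZMod p) + ((w.2.1 : (ZMod p)ˣ) : ZMod p) -
          ((w.2.2.1 : (ZMod p)ˣ) : ZMod p) - ((w.2.2.2 : (ZMod p)ˣ) : ZMod p))) : ℂ) *
        ZMod.stdAddChar (b * (((w.1⁻¹ : (ZMod p)ˣ) : ZMod p) + ((w.2.1⁻¹ : (ZMod p)ˣ) : ZMod p)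
          - ((w.2.2.1⁻¹ : (ZMod p)ˣ) : ZMod p) - ((w.2.2.2⁻¹ : (ZMod p)ˣ) : ZMod p))) := by
  have h : ((‖kloo p a b‖ ^ 4 : ℝ) : ℂ) = kloo p a b * (kloo p a b * ((starRingEnd ℂ) (kloo p a b)
      * (starRingEnd ℂ) (kloo p a b))) := by
    have := Complex.mul_conj' (kloo p a b)
    push_cast
    linear_combination (-(‖kloo p a b‖ ^ 2 : ℂ) - kloo p a b * (starRingEnd ℂ) (kloo p a b)) * this
  rw [h]
  simp only [kloo, map_sum, conj_char, Fintype.sum_prod_type, sum_mul_sum, ← AddChar.map_add_eq_mul]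
  simp only [Finset.mul_sum, ← AddChar.map_add_eq_mul]
  refine sum_congr rfl fun x _ => sum_congr rfl fun y _ => sum_congr rfl fun z _ =>
    sum_congr rfl fun w _ => ?_
  try rw [← AddChar.map_add_eq_mul]
  congr 1
  ring

lemma kloo_bound (p : ℕ) [Fact p.Prime] (a b : ZMod p) (hab : a ≠ 0 ∨ b ≠ 0) :
    ‖kloo p a b‖ ^ 4 ≤ 3 * (p : ℝ) ^ 3 := by
  classical
  have hp1 : 2 ≤ p := (Fact.out : p.Prime).two_le
  have total : ∑ u : ZMod p, ∑ v : ZMod p, ‖kloo p u v‖ ^ 4 ≤ (p : ℝ) ^ 2 * (3 * ((p : ℝ) - 1) ^ 2) := by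
    have : ((∑ u : ZMod p, ∑ v : ZMod p, ‖kloo p u v‖ ^ 4 : ℝ) : ℂ) =
      ∑ w : (ZMod p)ˣ × (ZMod p)ˣ × (ZMod p)ˣ × (ZMod p)ˣ,
        if ((w.1 : ZMod p) + w.2.1 - w.2.2.1 - w.2.2.2 = 0 ∧
        ((w.1⁻¹ : (ZMod p)ˣ) : ZMod p) + ((w.2.1⁻¹ : (ZMod p)ˣ) : ZMod p)
          - ((w.2.2.1⁻¹ : (ZMod p)ˣ) : ZMod p) - ((w.2.2.2⁻¹ : (ZMod p)ˣ) : ZMod p) = 0)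
        then ((p : ℂ) ^ 2) else 0 := by
      rw [Complex.ofReal_sum]
      simp only [Complex.ofReal_sum, norm_kloo_four]
      rw [sum_congr rfl fun u _ => sum_comm, sum_comm]
      refine sum_congr rfl fun w _ => ?_
      simp only [← mul_sum, ← sum_mul, sum_char_eq]
      split_ifs <;> first | ring1 | (exfalso; tauto)
    rw [sum_ite, sum_const_zero, add_zero, sum_const, nsmul_eq_mul] at this
    have key : ∀ n : ℕ, n ≤ 3 * (p - 1) ^ 2 →
        ((∑ u : ZMod p, ∑ v : ZMod p, ‖kloo p u v‖ ^ 4 : ℝ) : ℂ) = (n : ℂ) * (p : ℂ) ^ 2 →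
        ∑ u : ZMod p, ∑ v : ZMod p, ‖kloo p u v‖ ^ 4 ≤ (p : ℝ) ^ 2 * (3 * ((p : ℝ) - 1) ^ 2) := by
      intro n hn h
      have h2 : (∑ u : ZMod p, ∑ v : ZMod p, ‖kloo p u v‖ ^ 4 : ℝ) = (n : ℝ) * (p : ℝ) ^ 2 := by
        exact_mod_cast h
      rw [h2, mul_comm]
      gcongr
      calc _ ≤ ((3 * (p - 1) ^ 2 : ℕ) : ℝ) := by exact_mod_cast hn
        _ = _ := by push_cast [Nat.cast_sub (show 1 ≤ p by omega)]; ring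
    exact key _ (quad_count p) this
  have orb : ((p : ℝ) - 1) * ‖kloo p a b‖ ^ 4 ≤ ∑ u : ZMod p, ∑ v : ZMod p, ‖kloo p u v‖ ^ 4 := by
    let f : (ZMod p)ˣ → ZMod p × ZMod p := fun t => (a * t, b * (t⁻¹ : (ZMod p)ˣ))
    have hf : Function.Injective f := by
      intro s t h
      simp only [f, Prod.mk.injEq] at h
      rcases hab with h0 | h0
      · exact Units.ext (mul_left_cancel₀ h0 h.1)
      · exact inv_injective (Units.ext (mul_left_cancel₀ h0 h.2))
    rw [← Fintype.sum_prod_type']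
    calc _ = ∑ t : (ZMod p)ˣ, ‖kloo p (f t).1 (f t).2‖ ^ 4 := by
            simp only [f, kloo_twist, sum_const, nsmul_eq_mul]
            rw [Finset.card_univ, ZMod.card_units, Nat.cast_sub (by omega)]; simp
      _ = ∑ w ∈ univ.image f, ‖kloo p w.1 w.2‖ ^ 4 :=
            (sum_image (f := fun w : ZMod p × ZMod p => ‖kloo p w.1 w.2‖ ^ 4) fun _ _ _ _ h => hf h).symm
      _ ≤ _ := sum_le_sum_of_subset_of_nonneg (subset_univ _) fun _ _ _ => by positivity
  have hp : (2 : ℝ) ≤ p := by exact_mod_cast hp1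
  have h3 : ((p : ℝ) - 1) * ‖kloo p a b‖ ^ 4 ≤ (p - 1) * (3 * p ^ 2 * (p - 1)) := by
    calc _ ≤ _ := orb.trans total
      _ = _ := by ring
  have h4 := le_of_mul_le_mul_left h3 (by linarith)
  nlinarith [sq_nonneg (p : ℝ)]

noncomputable def gS (p n : ℕ) [Fact p.Prime] (u : ZMod p) : ℂ :=
  ∑ i ∈ range n, ZMod.stdAddChar (u * (i : ZMod p))

def dcount (p n : ℕ) [Fact p.Prime] (w : ZMod p) : ℕ :=
  ((range n ×ˢ range n).filter fun t => (t.1 : ZMod p) - (t.2 : ZMod p) = w).card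

lemma dcount_eq (p n : ℕ) [Fact p.Prime] (w : ZMod p) :
    (p : ℂ) * (dcount p n w : ℂ) =
      ∑ u : ZMod p, ((‖gS p n u‖ ^ 2 : ℝ) : ℂ) * ZMod.stdAddChar (-(u * w)) := by
  have h : ∀ u : ZMod p, ((‖gS p n u‖ ^ 2 : ℝ) : ℂ) * ZMod.stdAddChar (-(u * w)) =
      ∑ t ∈ range n ×ˢ range n, ZMod.stdAddChar (u * ((t.1 : ZMod p) - (t.2 : ZMod p) - w)) := by
    intro u
    push_cast
    rw [← Complex.mul_conj', gS, map_sum, sum_mul_sum, sum_product, sum_mul]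
    refine sum_congr rfl fun i _ => ?_
    rw [sum_mul]
    refine sum_congr rfl fun j _ => ?_
    rw [conj_char, ← AddChar.map_add_eq_mul, ← AddChar.map_add_eq_mul]
    congr 1; ring
  rw [sum_congr rfl fun u _ => h u, sum_comm]
  simp only [sum_char_eq, sub_eq_zero]
  rw [sum_ite, sum_const_zero, add_zero, sum_const, nsmul_eq_mul, mul_comm]
  rfl

lemma gS_parseval (p n : ℕ) [Fact p.Prime] (hn : n ≤ p) :
    ∑ u : ZMod p, ‖gS p n u‖ ^ 2 = p * n := by
  have h := dcount_eq p n 0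
  simp only [mul_zero, neg_zero, AddChar.map_zero_eq_one, mul_one] at h
  have h2 : dcount p n 0 = n := by
    unfold dcount
    have : ((range n ×ˢ range n).filter fun t => (t.1 : ZMod p) - (t.2 : ZMod p) = 0)
        = (range n).image fun i => (i, i) := by
      ext ⟨i, j⟩
      simp only [mem_filter, mem_product, mem_range, mem_image, Prod.mk.injEq, sub_eq_zero]
      constructor
      · rintro ⟨⟨h1, h2⟩, h3⟩
        rw [ZMod.natCast_eq_natCast_iff', Nat.mod_eq_of_lt (by omega), Nat.mod_eq_of_lt (by omega)] at h3
        exact ⟨i, h1, rfl, h3⟩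
      · rintro ⟨k, hk, rfl, rfl⟩; exact ⟨⟨hk, hk⟩, rfl⟩
    rw [this, card_image_of_injective _ fun a b h => (Prod.mk.inj h).1, card_range]
  rw [h2] at h
  exact_mod_cast h.symm

lemma dcount_ge (p H : ℕ) [Fact p.Prime] (t : ℕ) (ht : t < H) :
    H ≤ dcount p (2 * H) (t : ZMod p) := by
  unfold dcount
  calc H = ((range H).image fun j => (t + j, j)).card := by
        rw [card_image_of_injective _ fun a b h => (Prod.mk.inj h).2, card_range]
    _ ≤ _ := card_le_card fun x hx => by
      simp only [mem_image, mem_range] at hx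
      obtain ⟨j, hj, rfl⟩ := hx
      simp only [mem_filter, mem_product, mem_range]
      exact ⟨⟨by omega, by omega⟩, by push_cast; ring⟩

lemma hyp_box (p H : ℕ) [Fact p.Prime] (hH : 1 ≤ H) (hHp : 2 * H ≤ p) (α β κ : ZMod p) (hκ : κ ≠ 0)
    (Q : ℝ) (hQ : 0 ≤ Q) (hQ4 : 3 * (p : ℝ) ^ 3 ≤ Q ^ 4) :
    (((range H ×ˢ range H).filter fun t => ((t.1 : ZMod p) + α) * ((t.2 : ZMod p) + β) = κ).card : ℝ)
      ≤ 16 * (H : ℝ) ^ 2 / p + 4 * Q := by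
  classical
  set F := (range H ×ˢ range H).filter fun t => ((t.1 : ZMod p) + α) * ((t.2 : ZMod p) + β) = κ
  set n := 2 * H
  have hp0 : (0 : ℝ) < p := by exact_mod_cast (Fact.out : p.Prime).pos
  -- step 1
  have s1 : H ^ 2 * F.card ≤ ∑ x : (ZMod p)ˣ, dcount p n (x - α) *
      dcount p n (κ * ((x⁻¹ : (ZMod p)ˣ) : ZMod p) - β) := by
    have hu : ∀ t ∈ F, ((t.1 : ZMod p) + α) ≠ 0 := by
      intro t ht h0
      rw [mem_filter, h0, zero_mul] at ht
      exact hκ ht.2.symm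
    let f : ℕ × ℕ → (ZMod p)ˣ := fun t => if h : ((t.1 : ZMod p) + α) ≠ 0 then Units.mk0 _ h else 1
    have hf : ∀ t ∈ F, ((f t : (ZMod p)ˣ) : ZMod p) = t.1 + α := by
      intro t ht; simp only [f, dif_pos (hu t ht), Units.val_mk0]
    have hf2 : ∀ t ∈ F, κ * (((f t)⁻¹ : (ZMod p)ˣ) : ZMod p) = t.2 + β := by
      intro t ht
      rw [Units.val_inv_eq_inv_val, hf t ht, ← (mem_filter.1 ht).2]
      field_simp [hu t ht]
    have hb : ∀ t ∈ F, t.1 < H ∧ t.2 < H := fun t ht => by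
      have := (mem_filter.1 ht).1; simpa using this
    have hinj : Set.InjOn f F := by
      intro t ht t' ht' h
      have h1 := hf t ht; have h2 := hf2 t ht
      rw [h, hf t' ht'] at h1; rw [h, hf2 t' ht'] at h2
      have h1 := add_right_cancel h1; have h2 := add_right_cancel h2
      have := hb t ht; have := hb t' ht'
      rw [ZMod.natCast_eq_natCast_iff', Nat.mod_eq_of_lt (by omega), Nat.mod_eq_of_lt (by omega)] at h1 h2
      exact Prod.ext h1.symm h2.symm
    calc H ^ 2 * F.card = ∑ t ∈ F, H * H := by rw [sum_const, smul_eq_mul]; ring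
      _ ≤ ∑ t ∈ F, dcount p n (f t - α) * dcount p n (κ * (((f t)⁻¹ : (ZMod p)ˣ) : ZMod p) - β) := by
          refine sum_le_sum fun t ht => ?_
          rw [hf t ht, hf2 t ht, add_sub_cancel_right, add_sub_cancel_right]
          exact Nat.mul_le_mul (dcount_ge p H _ (hb t ht).1) (dcount_ge p H _ (hb t ht).2)
      _ = ∑ x ∈ F.image f, _ := (sum_image (f := fun x : (ZMod p)ˣ => dcount p n (x - α) *
            dcount p n (κ * ((x⁻¹ : (ZMod p)ˣ) : ZMod p) - β)) hinj).symm
      _ ≤ _ := sum_le_sum_of_subset (subset_univ _)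
  -- step 2
  have s2 : ((p : ℂ) ^ 2) * ((∑ x : (ZMod p)ˣ, dcount p n (x - α) *
      dcount p n (κ * ((x⁻¹ : (ZMod p)ˣ) : ZMod p) - β) : ℕ) : ℂ) =
      ∑ u : ZMod p, ∑ v : ZMod p, ((‖gS p n u‖ ^ 2 * ‖gS p n v‖ ^ 2 : ℝ) : ℂ) *
        ZMod.stdAddChar (u * α + v * β) * kloo p (-u) (-(v * κ)) := by
    rw [Nat.cast_sum, mul_sum]
    simp only [Nat.cast_mul]
    have : ∀ x : (ZMod p)ˣ, (p : ℂ) ^ 2 * ((dcount p n (x - α) : ℂ) *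
        (dcount p n (κ * ((x⁻¹ : (ZMod p)ˣ) : ZMod p) - β) : ℂ)) =
        ∑ u : ZMod p, ∑ v : ZMod p, ((‖gS p n u‖ ^ 2 * ‖gS p n v‖ ^ 2 : ℝ) : ℂ) *
        ZMod.stdAddChar (u * α + v * β) * ZMod.stdAddChar (-u * (x : ZMod p) + -(v * κ) * ((x⁻¹ : (ZMod p)ˣ) : ZMod p)) := by
      intro x
      have e1 := dcount_eq p n (x - α)
      have e2 := dcount_eq p n (κ * ((x⁻¹ : (ZMod p)ˣ) : ZMod p) - β)
      calc _ = ((p : ℂ) * (dcount p n (x - α) : ℂ)) *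
        ((p : ℂ) * (dcount p n (κ * ((x⁻¹ : (ZMod p)ˣ) : ZMod p) - β) : ℂ)) := by ring
        _ = _ := by
          rw [e1, e2, sum_mul_sum]
          refine sum_congr rfl fun u _ => sum_congr rfl fun v _ => ?_
          have : u * α + v * β + (-u * (x : ZMod p) + -(v * κ) * ((x⁻¹ : (ZMod p)ˣ) : ZMod p)) =
            -(u * ((x : ZMod p) - α)) + -(v * (κ * ((x⁻¹ : (ZMod p)ˣ) : ZMod p) - β)) := by ring
          rw [mul_assoc ((_ : ℝ) : ℂ) (ZMod.stdAddChar (u * α + v * β)), ← AddChar.map_add_eq_mul, this,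
            AddChar.map_add_eq_mul]
          push_cast; ring
    rw [sum_congr rfl fun x _ => this x, sum_comm]
    refine sum_congr rfl fun u _ => ?_
    rw [sum_comm]
    refine sum_congr rfl fun v _ => ?_
    rw [← mul_sum]; rfl
  have hS0 : ‖gS p n 0‖ = n := by
    simp [gS]
  have hkQ : ∀ a b : ZMod p, (a ≠ 0 ∨ b ≠ 0) → ‖kloo p a b‖ ≤ Q := fun a b h =>
    le_of_pow_le_pow_left₀ (by norm_num) hQ ((kloo_bound p a b h).trans hQ4)
  have hk0 : ‖kloo p 0 0‖ ≤ p := by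
    unfold kloo
    refine (norm_sum_le _ _).trans ?_
    simp only [norm_char, sum_const, nsmul_eq_mul, mul_one]
    rw [Finset.card_univ, ZMod.card_units]
    exact_mod_cast Nat.sub_le _ _
  -- step 3
  have s3 : ∀ u v : ZMod p, ‖((‖gS p n u‖ ^ 2 * ‖gS p n v‖ ^ 2 : ℝ) : ℂ) *
        ZMod.stdAddChar (u * α + v * β) * kloo p (-u) (-(v * κ))‖ ≤
        ‖gS p n u‖ ^ 2 * ‖gS p n v‖ ^ 2 * Q + (if u = 0 ∧ v = 0 then (n : ℝ) ^ 4 * p else 0) := by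
    intro u v
    rw [norm_mul, norm_mul, norm_char, mul_one, Complex.norm_real, Real.norm_of_nonneg (by positivity)]
    split_ifs with h
    · obtain ⟨rfl, rfl⟩ := h
      simp only [neg_zero, zero_mul, hS0]
      have : (n : ℝ) ^ 2 * n ^ 2 * ‖kloo p 0 0‖ ≤ n ^ 2 * n ^ 2 * p := by gcongr
      have : 0 ≤ (n : ℝ) ^ 2 * n ^ 2 * Q := by positivity
      nlinarith
    · rw [add_zero]
      refine mul_le_mul_of_nonneg_left (hkQ _ _ ?_) (by positivity)
      by_contra! h2
      apply h
      refine ⟨neg_eq_zero.1 h2.1, ?_⟩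
      have := neg_eq_zero.1 h2.2
      exact (mul_eq_zero.1 this).resolve_right hκ
  have s4 : (p : ℝ) ^ 2 * (∑ x : (ZMod p)ˣ, dcount p n (x - α) *
      dcount p n (κ * ((x⁻¹ : (ZMod p)ˣ) : ZMod p) - β) : ℕ) ≤ (p * n) ^ 2 * Q + (n : ℝ) ^ 4 * p := by
    have e := congrArg norm s2
    rw [norm_mul, norm_pow, Complex.norm_natCast, Complex.norm_natCast] at e
    rw [e]
    refine (norm_sum_le _ _).trans ((sum_le_sum fun u _ => (norm_sum_le _ _).trans
      (sum_le_sum fun v _ => s3 u v)).trans ?_)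
    simp only [sum_add_distrib, ← sum_mul, ← mul_sum, gS_parseval p n hHp]
    simp only [ite_and]
    simp
    nlinarith
  have hH0 : (0 : ℝ) < H := by exact_mod_cast hH
  have s5 : (p : ℝ) ^ 2 * ((H : ℝ) ^ 2 * F.card) ≤ (p * n) ^ 2 * Q + (n : ℝ) ^ 4 * p := by
    refine le_trans ?_ s4
    have : ((H ^ 2 * F.card : ℕ) : ℝ) ≤ _ := Nat.cast_le.2 s1
    push_cast at this ⊢
    gcongr
  have hn : (n : ℝ) = 2 * H := by simp [n]
  rw [hn] at s5
  have : (F.card : ℝ) * ((p : ℝ) ^ 2 * H ^ 2) ≤ (16 * (H : ℝ) ^ 2 / p + 4 * Q) * ((p : ℝ) ^ 2 * H ^ 2) := by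
    have : (16 * (H : ℝ) ^ 2 / p + 4 * Q) * ((p : ℝ) ^ 2 * H ^ 2) = 16 * H ^ 4 * p + 4 * Q * p ^ 2 * H ^ 2 := by
      field_simp
    rw [this]; nlinarith
  exact le_of_mul_le_mul_right this (by positivity)

lemma tau_bound (m : ℕ) (hm : 1 ≤ m) : ∃ C : ℕ, 1 ≤ C ∧ ∀ n : ℕ, 1 ≤ n → n.divisors.card ^ m ≤ C * n := by
  have hB : ∀ k : ℕ, (k + 1) ^ m ≤ m ^ m * 2 ^ k := by
    intro k
    have h1 : k + 1 ≤ m * 2 ^ (k / m) := by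
      have : k / m < 2 ^ (k / m) := Nat.lt_two_pow_self
      have h2 := Nat.div_add_mod k m
      have h3 := Nat.mod_lt k (show 0 < m by omega)
      calc k + 1 ≤ m * (k / m + 1) := by rw [mul_add]; omega
        _ ≤ _ := Nat.mul_le_mul_left _ this
    calc (k + 1) ^ m ≤ (m * 2 ^ (k / m)) ^ m := Nat.pow_le_pow_left h1 m
      _ = m ^ m * 2 ^ (k / m * m) := by rw [mul_pow, ← pow_mul]
      _ ≤ _ := Nat.mul_le_mul_left _ (Nat.pow_le_pow_right (by norm_num) (Nat.div_mul_le_self k m))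
  have hmm : 1 ≤ m ^ m := Nat.one_le_pow _ _ (by omega)
  refine ⟨(m ^ m) ^ (2 ^ m), Nat.one_le_pow _ _ (by omega), fun n hn => ?_⟩
  rw [Nat.card_divisors (by omega), ← prod_pow]
  calc ∏ x ∈ n.primeFactors, (n.factorization x + 1) ^ m
      ≤ ∏ x ∈ n.primeFactors, ((if x < 2 ^ m then m ^ m else 1) * x ^ n.factorization x) := by
        refine prod_le_prod' fun p hp => ?_
        have hp2 := (Nat.prime_of_mem_primeFactors hp).two_le
        split_ifs with h
        · exact (hB _).trans (Nat.mul_le_mul_left _ (Nat.pow_le_pow_left hp2 _))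
        · rw [one_mul]
          calc _ ≤ (2 ^ n.factorization p) ^ m := Nat.pow_le_pow_left (Nat.lt_two_pow_self) m
            _ = (2 ^ m) ^ n.factorization p := by rw [← pow_mul, ← pow_mul, mul_comm]
            _ ≤ _ := Nat.pow_le_pow_left (by omega) _
    _ = (∏ x ∈ n.primeFactors, (if x < 2 ^ m then m ^ m else 1)) * n := by
        rw [prod_mul_distrib]; congr 1
        exact Nat.prod_factorization_pow_eq_self (by omega)
    _ ≤ _ := by
        refine Nat.mul_le_mul_right _ ?_
        rw [prod_ite, prod_const_one, mul_one, prod_const]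
        refine Nat.pow_le_pow_right hmm ?_
        calc _ ≤ (range (2 ^ m)).card := card_le_card fun x hx => by simpa using (mem_filter.1 hx).2
          _ = _ := card_range _

lemma card_class (S : Finset ℤ) (b : ℤ) (H m : ℕ) (hm : 0 < m) (hb : ∀ x ∈ S, b ≤ x ∧ x < b + H)
    (hc : ∀ x ∈ S, ∀ y ∈ S, (m : ℤ) ∣ x - y) : S.card ≤ (H - 1) / m + 1 := by
  rcases S.eq_empty_or_nonempty with rfl | ⟨x0, hx0⟩
  · simp
  calc S.card = (S.image fun x => ((x - b) / m).toNat).card := by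
        refine (card_image_of_injOn ?_).symm
        intro x hx y hy h
        simp only at h
        have m0 : (0 : ℤ) < m := by exact_mod_cast hm
        have h1 : 0 ≤ (x - b) / m := Int.ediv_nonneg (by linarith [hb x hx]) m0.le
        have h2 : 0 ≤ (y - b) / m := Int.ediv_nonneg (by linarith [hb y hy]) m0.le
        have h3 : (x - b) / m = (y - b) / m := by omega
        have h4 : (x - b) % m = (y - b) % m := Int.ModEq.symm ((Int.modEq_iff_dvd).2 (by
          have := hc x hx y hy; rwa [sub_sub_sub_cancel_right]))
        have e1 := Int.mul_ediv_add_emod (x - b) m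
        have e2 := Int.mul_ediv_add_emod (y - b) m
        rw [h3, h4] at e1
        linarith
    _ ≤ (range ((H - 1) / m + 1)).card := card_le_card fun k hk => by
        obtain ⟨x, hx, rfl⟩ := mem_image.1 hk
        have := hb x hx
        rw [mem_range]
        have h1 : (x - b) / m ≤ ((H - 1 : ℕ) : ℤ) / m := Int.ediv_le_ediv (by exact_mod_cast hm) (by omega)
        have h2 : (((H - 1) / m : ℕ) : ℤ) = ((H - 1 : ℕ) : ℤ) / m := by push_cast; rfl
        rw [← h2] at h1
        exact Nat.lt_succ_of_le (Int.toNat_le.2 h1)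
    _ = _ := card_range _

lemma card_class' (S : Finset ℤ) (b : ℤ) (H m : ℕ) (hm : 0 < m) (hb : ∀ x ∈ S, b ≤ x ∧ x < b + H)
    (hc : ∀ x ∈ S, ∀ y ∈ S, (m : ℤ) ∣ x - y) : (S.card : ℝ) ≤ H / m + 1 := by
  have := card_class S b H m hm hb hc
  calc (S.card : ℝ) ≤ (((H - 1) / m + 1 : ℕ) : ℝ) := by exact_mod_cast this
    _ ≤ ((H - 1 : ℕ) : ℝ) / m + 1 := by push_cast; gcongr; exact Nat.cast_div_le
    _ ≤ _ := by gcongr; omega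

/-- roots of a quadratic modulo squarefree k in an interval -/
lemma root_count (k : ℕ) (hk : Squarefree k) (α β t : ℤ) (m : ℕ) (hm : 0 < m)
    (hα : ∀ x : ℤ, (k : ℤ) ∣ α * x → (k : ℤ) ∣ m * x) (S : Finset ℤ) (b : ℤ) (H : ℕ)
    (hb : ∀ x ∈ S, b ≤ x ∧ x < b + H) (hS : ∀ x ∈ S, (k : ℤ) ∣ α * x ^ 2 + β * x + t) :
    (S.card : ℝ) ≤ k.divisors.card * (m * H / k + 1) := by
  classical
  have hk0 : k ≠ 0 := hk.ne_zero
  rcases S.eq_empty_or_nonempty with rfl | ⟨x0, hx0⟩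
  · simp; positivity
  have key : ∀ D ∈ k.divisors, ((S.filter fun x => Int.gcd (x - x0) k = D).card : ℝ) ≤ m * H / k + 1 := by
    intro D hD
    set S' := S.filter fun x => Int.gcd (x - x0) k = D
    have hinj : Function.Injective fun x : ℤ => (m : ℤ) * x := fun x y h =>
      mul_left_cancel₀ (by exact_mod_cast hm.ne') h
    have := card_class' (S'.image fun x => (m : ℤ) * x) (m * b) (m * H) k (Nat.pos_of_ne_zero hk0) ?_ ?_
    · rw [card_image_of_injective _ hinj] at this
      push_cast at this; exact this
    · intro x hx
      obtain ⟨y, hy, rfl⟩ := mem_image.1 hx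
      have := hb y (mem_filter.1 hy).1
      have m0 : (0 : ℤ) < m := by exact_mod_cast hm
      push_cast
      constructor <;> nlinarith
    · intro x' hx' y' hy'
      obtain ⟨x, hx, rfl⟩ := mem_image.1 hx'
      obtain ⟨y, hy, rfl⟩ := mem_image.1 hy'
      rw [← mul_sub]
      refine hα _ ?_
      obtain ⟨hxS, hxD⟩ := mem_filter.1 hx
      obtain ⟨hyS, hyD⟩ := mem_filter.1 hy
      obtain ⟨E, hE⟩ := (Nat.mem_divisors.1 hD).1
      have hcop : Nat.Coprime D E := by
        rw [hE] at hk; exact (Nat.squarefree_mul_iff.1 hk).1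
      have hD0 : D ≠ 0 := by rintro rfl; simp at hE; omega
      have aux : ∀ z ∈ S, Int.gcd (z - x0) k = D → (D : ℤ) ∣ z - x0 ∧ (E : ℤ) ∣ α * (z + x0) + β := by
        intro z hz hzD
        refine ⟨by rw [← hzD]; exact Int.gcd_dvd_left .., ?_⟩
        have h1 : (k : ℤ) ∣ (z - x0) * (α * (z + x0) + β) := by
          have := dvd_sub (hS z hz) (hS x0 hx0)
          exact this.trans (dvd_of_eq (by ring))
        obtain ⟨w, hw⟩ : (D : ℤ) ∣ z - x0 := by rw [← hzD]; exact Int.gcd_dvd_left ..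
        have h2 : IsCoprime w (E : ℤ) := by
          have h3 : Int.gcd ((D : ℤ) * w) ((D : ℤ) * E) = D := by
            rw [← hw]; rw [hE] at hzD; push_cast at hzD; exact hzD
          rw [Int.gcd_mul_left] at h3
          simp only [Int.natAbs_natCast] at h3
          have : Int.gcd w E = 1 := by
            have := Nat.pos_of_ne_zero hD0
            exact Nat.eq_of_mul_eq_mul_left this (by rw [h3, mul_one])
          exact Int.isCoprime_iff_gcd_eq_one.2 this
        rw [hw, hE] at h1
        push_cast at h1
        rw [mul_assoc] at h1
        have h4 := (mul_dvd_mul_iff_left (show (D : ℤ) ≠ 0 by exact_mod_cast hD0)).1 h1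
        exact h2.symm.dvd_of_dvd_mul_left h4
      have ax := aux x hxS hxD
      have ay := aux y hyS hyD
      have h1 : (D : ℤ) ∣ α * (x - y) := by
        have := dvd_sub ax.1 ay.1
        rw [sub_sub_sub_cancel_right] at this
        exact this.mul_left _
      have h2 : (E : ℤ) ∣ α * (x - y) := by
        have := dvd_sub ax.2 ay.2
        exact this.trans (dvd_of_eq (by ring))
      rw [hE]; push_cast
      exact (Nat.isCoprime_iff_coprime.2 hcop).mul_dvd h1 h2
  have hmap : ∀ x ∈ S, Int.gcd (x - x0) k ∈ k.divisors := fun x _ =>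
    Nat.mem_divisors.2 ⟨by exact_mod_cast Int.gcd_dvd_right (x - x0) (k : ℤ), hk0⟩
  rw [card_eq_sum_card_fiberwise hmap]
  push_cast
  calc _ ≤ ∑ D ∈ k.divisors, ((m : ℝ) * H / k + 1) := sum_le_sum key
    _ = _ := by rw [sum_const, nsmul_eq_mul]

/-- residue classes with XY = c -/
lemma xy_count (M : ℕ) (hM : 0 < M) (c : ℤ) (F : Finset (ℤ × ℤ))
    (hF : ∀ w ∈ F, (0 ≤ w.1 ∧ w.1 < M) ∧ (0 ≤ w.2 ∧ w.2 < M) ∧ (M : ℤ) ∣ w.1 * w.2 - c) :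
    F.card ≤ M * (Int.gcd c M).divisors.card := by
  classical
  have hG0 : Int.gcd c M ≠ 0 := by
    rw [Ne, Int.gcd_eq_zero_iff]; rintro ⟨-, h⟩; omega
  have hmap : ∀ w ∈ F, Int.gcd w.1 M ∈ (Int.gcd c M).divisors := by
    intro w hw
    obtain ⟨_, _, h⟩ := hF w hw
    refine Nat.mem_divisors.2 ⟨?_, hG0⟩
    refine Int.dvd_gcd ?_ (Int.gcd_dvd_right ..)
    have h1 : ((Int.gcd w.1 M : ℕ) : ℤ) ∣ w.1 * w.2 - c := (Int.gcd_dvd_right ..).trans h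
    exact (dvd_sub_right ((Int.gcd_dvd_left ..).mul_right _)).1 h1
  rw [card_eq_sum_card_fiberwise hmap]
  rw [mul_comm, ← smul_eq_mul, ← sum_const]
  refine sum_le_sum fun g hg => ?_
  have hgM : g ∣ M := (Nat.mem_divisors.1 hg).1.trans (by exact_mod_cast Int.gcd_dvd_right c (M : ℤ))
  obtain ⟨e, he⟩ := hgM
  have hg0 : 0 < g := Nat.pos_of_ne_zero (by rintro rfl; simp at he; omega)
  have he0 : 0 < e := Nat.pos_of_ne_zero (by rintro rfl; simp at he; omega)
  set F' := F.filter fun w => Int.gcd w.1 M = g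
  -- fibre over x
  have h1 : (F'.image Prod.fst).card ≤ e := by
    have := card_class (F'.image Prod.fst) 0 M g hg0 ?_ ?_
    · refine this.trans ?_
      have : (M - 1) / g < e := (Nat.div_lt_iff_lt_mul hg0).2 (by rw [mul_comm, ← he]; omega)
      omega
    · intro x hx
      obtain ⟨w, hw, rfl⟩ := mem_image.1 hx
      simpa using (hF w (mem_filter.1 hw).1).1
    · intro x hx y hy
      obtain ⟨w, hw, rfl⟩ := mem_image.1 hx
      obtain ⟨w', hw', rfl⟩ := mem_image.1 hy
      have a1 : (g : ℤ) ∣ w.1 := by rw [← (mem_filter.1 hw).2]; exact Int.gcd_dvd_left ..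
      have a2 : (g : ℤ) ∣ w'.1 := by rw [← (mem_filter.1 hw').2]; exact Int.gcd_dvd_left ..
      exact dvd_sub a1 a2
  have h2 : ∀ x ∈ F'.image Prod.fst, (F'.filter fun w => w.1 = x).card ≤ g := by
    intro x hx
    obtain ⟨w0, hw0, rfl⟩ := mem_image.1 hx
    set F2 := F'.filter fun w => w.1 = w0.1
    have hinj : Set.InjOn Prod.snd (F2 : Set (ℤ × ℤ)) := by
      intro a ha b hb h
      exact Prod.ext ((mem_filter.1 ha).2.trans (mem_filter.1 hb).2.symm) h
    rw [← card_image_of_injOn hinj]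
    have := card_class (F2.image Prod.snd) 0 M e he0 ?_ ?_
    · refine this.trans ?_
      have : (M - 1) / e < g := (Nat.div_lt_iff_lt_mul he0).2 (by rw [← he]; omega)
      omega
    · intro x hx
      obtain ⟨w, hw, rfl⟩ := mem_image.1 hx
      simpa using (hF w (mem_filter.1 (mem_filter.1 hw).1).1).2.1
    · intro x hx y hy
      obtain ⟨w, hw, rfl⟩ := mem_image.1 hx
      obtain ⟨w', hw', rfl⟩ := mem_image.1 hy
      have b1 := (mem_filter.1 hw).2
      have b2 := (mem_filter.1 hw').2
      have a1 := (hF w (mem_filter.1 (mem_filter.1 hw).1).1).2.2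
      have a2 := (hF w' (mem_filter.1 (mem_filter.1 hw').1).1).2.2
      have a3 := dvd_sub a1 a2
      rw [b1, b2, sub_sub_sub_cancel_right, ← mul_sub] at a3
      have hgd := (mem_filter.1 hw0).2
      obtain ⟨v, hv⟩ : (g : ℤ) ∣ w0.1 := by rw [← hgd]; exact Int.gcd_dvd_left ..
      have hcop : IsCoprime v (e : ℤ) := by
        rw [hv, he] at hgd; push_cast at hgd
        rw [Int.gcd_mul_left] at hgd
        simp only [Int.natAbs_natCast] at hgd
        exact Int.isCoprime_iff_gcd_eq_one.2 (Nat.eq_of_mul_eq_mul_left hg0 (by rw [hgd, mul_one]))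
      rw [hv, he] at a3; push_cast at a3; rw [mul_assoc] at a3
      exact hcop.symm.dvd_of_dvd_mul_left
        ((mul_dvd_mul_iff_left (show (g : ℤ) ≠ 0 by exact_mod_cast hg0.ne')).1 a3)
  calc F'.card = ∑ x ∈ F'.image Prod.fst, (F'.filter fun w => w.1 = x).card :=
        card_eq_sum_card_fiberwise fun w hw => mem_image_of_mem _ hw
    _ ≤ ∑ x ∈ F'.image Prod.fst, g := sum_le_sum h2
    _ = (F'.image Prod.fst).card * g := by rw [sum_const, smul_eq_mul]
    _ ≤ e * g := Nat.mul_le_mul_right _ h1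
    _ = M := by rw [he, mul_comm]

def Exc (W q : ℕ) : Prop := ∀ l : ℕ, l.Prime → W ≤ l → l ∣ q → l ^ 2 ∣ q

lemma mult_count (X d : ℕ) : ((Ioc 0 X).filter fun q => d ∣ q).card = X / d := Nat.Ioc_filter_dvd_card_eq_div X d

lemma sum_inv_le_log (X : ℕ) : ∑ d ∈ Ioc 0 X, (1 : ℝ) / d ≤ 1 + Real.log X := by
  have := harmonic_le_one_add_log X
  refine le_trans (le_of_eq ?_) this
  rw [harmonic_eq_sum_Icc]; push_cast
  exact sum_congr (by ext; simp; omega) fun x _ => by rw [one_div]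

lemma sum_tau_le (X : ℕ) : ∑ q ∈ Ioc 0 X, (q.divisors.card : ℝ) ≤ X * (1 + Real.log X) := by
  have h : ∀ q ∈ Ioc 0 X, (q.divisors.card : ℝ) = ∑ d ∈ Ioc 0 X, if d ∣ q then (1 : ℝ) else 0 := by
    intro q hq
    rw [mem_Ioc] at hq
    rw [← sum_filter, sum_const, nsmul_one]
    congr 2
    ext d
    simp only [Nat.mem_divisors, mem_filter, mem_Ioc]
    constructor
    · rintro ⟨h1, h2⟩
      have := Nat.le_of_dvd hq.1 h1
      have := Nat.pos_of_dvd_of_pos h1 hq.1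
      exact ⟨by omega, h1⟩
    · rintro ⟨h1, h2⟩; exact ⟨h2, by omega⟩
  rw [sum_congr rfl h, sum_comm]
  calc _ ≤ ∑ d ∈ Ioc 0 X, (X : ℝ) * (1 / d) := by
        refine sum_le_sum fun d _ => ?_
        rw [← sum_filter, sum_const, nsmul_one, mult_count, mul_one_div]
        exact Nat.cast_div_le
    _ ≤ _ := by rw [← mul_sum]; exact mul_le_mul_of_nonneg_left (sum_inv_le_log X) (by positivity)

open Classical in
lemma exc_count (W k X Z : ℕ) (hW : 2 ≤ W) (h1 : W ≤ 2 ^ k) (h2 : W ^ (k + 2) ≤ Z) :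
    (((Ioc 0 X).filter fun q => Z < q ∧ Exc W q).card : ℝ) ≤ X * (3 + Real.log X) / W := by
  have hW0 : (0 : ℝ) < W := by positivity
  have sub : ((Ioc 0 X).filter fun q => Z < q ∧ Exc W q) ⊆
      ((Ioc 0 X).filter fun q => W ≤ q.divisors.card) ∪
      (Ioc (W - 1) X).biUnion fun m => (Ioc 0 X).filter fun q => m ^ 2 ∣ q := by
    intro q hq
    obtain ⟨hq1, hZ, hE⟩ := mem_filter.1 hq
    rw [mem_Ioc] at hq1
    obtain ⟨s, m, hsm, hs⟩ := Nat.sq_mul_squarefree q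
    have hm0 : 0 < m := Nat.pos_of_ne_zero (by rintro rfl; simp at hsm; omega)
    have hs0 : 0 < s := Nat.pos_of_ne_zero hs.ne_zero
    rw [mem_union]
    by_cases hmW : W ≤ m
    · right
      have : m ≤ q := by rw [← hsm]; nlinarith
      exact mem_biUnion.2 ⟨m, mem_Ioc.2 ⟨by omega, by omega⟩,
        mem_filter.2 ⟨mem_Ioc.2 hq1, Dvd.intro _ hsm⟩⟩
    · left
      refine mem_filter.2 ⟨mem_Ioc.2 hq1, ?_⟩
      push Not at hmW
      have hpr : ∀ l ∈ s.primeFactors, l ≤ W := by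
        intro l hl
        by_contra hlW
        have hlp := Nat.prime_of_mem_primeFactors hl
        have hls := Nat.dvd_of_mem_primeFactors hl
        have := hE l hlp (by omega) (by rw [← hsm]; exact hls.mul_left _)
        rw [← hsm] at this
        by_cases hlm : l ∣ m
        · have := Nat.le_of_dvd hm0 hlm; omega
        · have hc : Nat.Coprime (l ^ 2) (m ^ 2) := Nat.Coprime.pow 2 2 ((Nat.Prime.coprime_iff_not_dvd hlp).2 hlm)
          have h3 := hc.dvd_of_dvd_mul_left this
          rw [sq] at h3
          have := hs l h3
          exact hlp.one_lt.ne' (Nat.isUnit_iff.1 this)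
      have hsW : s ≤ W ^ s.primeFactors.card := by
        conv_lhs => rw [← Nat.prod_primeFactors_of_squarefree hs]
        exact prod_le_pow_card _ _ _ hpr
      have hk : k ≤ s.primeFactors.card := by
        by_contra hlt
        push Not at hlt
        have a1 : s ≤ W ^ k := hsW.trans (Nat.pow_le_pow_right (by omega) hlt.le)
        have a2 : m ^ 2 ≤ W ^ 2 := Nat.pow_le_pow_left hmW.le 2
        have : q ≤ Z := by
          rw [← hsm]
          calc m ^ 2 * s ≤ W ^ 2 * W ^ k := Nat.mul_le_mul a2 a1
            _ = W ^ (k + 2) := by ring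
            _ ≤ Z := h2
        omega
      have hk2 : k ≤ q.primeFactors.card := hk.trans (card_le_card
        (Nat.primeFactors_mono (Dvd.intro_left _ hsm) (by omega)))
      rw [Nat.card_divisors (by omega)]
      calc W ≤ 2 ^ k := h1
        _ ≤ 2 ^ q.primeFactors.card := Nat.pow_le_pow_right (by norm_num) hk2
        _ = ∏ x ∈ q.primeFactors, 2 := by rw [prod_const]
        _ ≤ _ := prod_le_prod' fun p hp => by
          have := Nat.Prime.factorization_pos_of_dvd (Nat.prime_of_mem_primeFactors hp) (by omega)
            (Nat.dvd_of_mem_primeFactors hp)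
          omega
  have c1 : (((Ioc 0 X).filter fun q => W ≤ q.divisors.card).card : ℝ) ≤ X * (1 + Real.log X) / W := by
    rw [le_div_iff₀ hW0]
    refine le_trans ?_ (sum_tau_le X)
    calc _ = ∑ q ∈ (Ioc 0 X).filter (fun q => W ≤ q.divisors.card), (W : ℝ) := by
          rw [sum_const, nsmul_eq_mul]
      _ ≤ ∑ q ∈ (Ioc 0 X).filter (fun q => W ≤ q.divisors.card), (q.divisors.card : ℝ) :=
          sum_le_sum fun q hq => by exact_mod_cast (mem_filter.1 hq).2
      _ ≤ _ := sum_le_sum_of_subset_of_nonneg (filter_subset _ _) fun _ _ _ => by positivity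
  have c2 : (((Ioc (W - 1) X).biUnion fun m => (Ioc 0 X).filter fun q => m ^ 2 ∣ q).card : ℝ) ≤ X * 2 / W := by
    have := card_biUnion_le (s := Ioc (W - 1) X) (t := fun m => (Ioc 0 X).filter fun q => m ^ 2 ∣ q)
    calc _ ≤ ((∑ m ∈ Ioc (W - 1) X, ((Ioc 0 X).filter fun q => m ^ 2 ∣ q).card : ℕ) : ℝ) := by exact_mod_cast this
      _ ≤ ∑ m ∈ Ioc (W - 1) X, (X : ℝ) * ((m : ℝ) ^ 2)⁻¹ := by
          push_cast
          refine sum_le_sum fun m _ => ?_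
          rw [mult_count, ← div_eq_mul_inv]
          exact_mod_cast Nat.cast_div_le (α := ℝ)
      _ ≤ X * (2 / W) := by
          rw [← mul_sum]
          refine mul_le_mul_of_nonneg_left ?_ (by positivity)
          by_cases hWX : W - 1 ≤ X
          · refine (sum_Ioc_inv_sq_le_sub (by omega) hWX).trans ?_
            have : (0 : ℝ) ≤ (X : ℝ)⁻¹ := by positivity
            have h3 : ((W - 1 : ℕ) : ℝ) = W - 1 := by push_cast [Nat.cast_sub (show 1 ≤ W by omega)]; ring
            have h4 : (2 : ℝ) ≤ W := by exact_mod_cast hW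
            have : ((W - 1 : ℕ) : ℝ)⁻¹ ≤ 2 / W := by
              rw [h3, inv_eq_one_div, div_le_div_iff₀ (by linarith) hW0]; linarith
            linarith
          · rw [Ioc_eq_empty (by omega), sum_empty]; positivity
      _ = _ := by ring
  calc _ ≤ ((((Ioc 0 X).filter fun q => W ≤ q.divisors.card) ∪
      (Ioc (W - 1) X).biUnion fun m => (Ioc 0 X).filter fun q => m ^ 2 ∣ q).card : ℝ) := by
        exact_mod_cast card_le_card sub
    _ ≤ X * (1 + Real.log X) / W + X * 2 / W :=
      le_trans (by exact_mod_cast card_union_le _ _) (add_le_add c1 c2)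
    _ = _ := by ring

lemma gcd_split (k : ℕ) (hk : k ≠ 0) (u v : ℤ) (h : (k : ℤ) ∣ u * v) :
    ∃ E : ℕ, k = Int.gcd u k * E ∧ (E : ℤ) ∣ v := by
  obtain ⟨E, hE⟩ : Int.gcd u k ∣ k := by exact_mod_cast Int.gcd_dvd_right u (k : ℤ)
  refine ⟨E, hE, ?_⟩
  set D := Int.gcd u k with hD
  have hD0 : D ≠ 0 := by intro h0; rw [h0] at hE; simp at hE; omega
  obtain ⟨w, hw⟩ : (D : ℤ) ∣ u := Int.gcd_dvd_left ..
  have h2 : IsCoprime w (E : ℤ) := by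
    have h3 : Int.gcd ((D : ℤ) * w) ((D : ℤ) * E) = D := by
      rw [← hw, ← Nat.cast_mul, ← hE]
    rw [Int.gcd_mul_left] at h3
    simp only [Int.natAbs_natCast] at h3
    exact Int.isCoprime_iff_gcd_eq_one.2
      (Nat.eq_of_mul_eq_mul_left (Nat.pos_of_ne_zero hD0) (by rw [h3, mul_one]))
  rw [hw, hE] at h
  push_cast at h
  rw [mul_assoc] at h
  exact h2.symm.dvd_of_dvd_mul_left ((mul_dvd_mul_iff_left (show (D : ℤ) ≠ 0 by exact_mod_cast hD0)).1 h)

def Adm (a : ℕ) (c d : ℤ) : Prop :=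
  Squarefree a ∧ c ^ 2 + d ^ 2 + 10 = a ∧ IsCoprime d (a : ℤ) ∧ IsCoprime (10 : ℤ) (a : ℤ)

/-- off-diagonal congruence data for the pair (z,z'), p,q,r,s sums and differences -/
def OffD (a a2 : ℕ) (c d c2 d2 p q r s : ℤ) : Prop :=
  p * q + r * s = (a : ℤ) - a2 ∧ (a : ℤ) ∣ c * (r + s) - d * (p + q) ∧ (a2 : ℤ) ∣ c2 * (s - r) - d2 * (q - p)

lemma inv_mod {d : ℤ} {a : ℕ} (h : IsCoprime d (a : ℤ)) : ∃ e : ℤ, (a : ℤ) ∣ d * e - 1 := by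
  obtain ⟨u, v, huv⟩ := h
  exact ⟨u, -v, by linear_combination huv⟩

lemma crt_int {a b : ℤ} (h : IsCoprime a b) (x y : ℤ) : ∃ z, a ∣ z - x ∧ b ∣ z - y := by
  obtain ⟨u, v, huv⟩ := h
  exact ⟨x * (v * b) + y * (u * a), ⟨u * (y - x), by linear_combination x * huv⟩,
    ⟨v * (x - y), by linear_combination y * huv⟩⟩

lemma crt_data {a a2 g b : ℕ} {c d c2 d2 : ℤ} (h1 : Adm a c d) (h2 : Adm a2 c2 d2) (ha2 : a2 = g * b)
    (hab : Nat.Coprime a b) : ∃ μ ν κ : ℤ, ∀ p q r s : ℤ, OffD a a2 c d c2 d2 p q r s →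
      ((a : ℤ) * b * q) ∣ (r + μ * q) * (s + ν * q) - ((a : ℤ) - a2 + κ * q ^ 2) := by
  obtain ⟨e, he⟩ := inv_mod h1.2.2.1
  obtain ⟨e2, he2⟩ := inv_mod h2.2.2.1
  have hc : IsCoprime (a : ℤ) (b : ℤ) := Nat.isCoprime_iff_coprime.2 hab
  obtain ⟨μ, m1, m2⟩ := crt_int hc (c * e) (-(c2 * e2))
  obtain ⟨ν, n1, n2⟩ := crt_int hc (c * e) (c2 * e2)
  obtain ⟨k, k1, k2⟩ := crt_int hc 1 (-1)
  refine ⟨μ, ν, k + μ * ν, fun p q r s ⟨h, i1, i2⟩ => ?_⟩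
  have j1 : (a : ℤ) ∣ p - (μ * s + ν * r - k * q) := by
    have t1 := i1.mul_left e
    have t2 := he.mul_right (p + q)
    have : p - (μ * s + ν * r - k * q) = -((μ - c * e) * s) - (ν - c * e) * r + (k - 1) * q
      - e * (c * (r + s) - d * (p + q)) - (d * e - 1) * (p + q) := by ring
    rw [this]
    exact dvd_sub (dvd_sub (dvd_add (dvd_sub (m1.mul_right s).neg_right (n1.mul_right r)) (k1.mul_right q)) t1) t2
  have hb : (b : ℤ) ∣ a2 := by rw [ha2]; push_cast; exact Dvd.intro_left _ rfl
  have j2 : (b : ℤ) ∣ p - (μ * s + ν * r - k * q) := by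
    have t1 := (hb.trans i2).mul_left e2
    have t2 := (hb.trans he2).mul_right (q - p)
    have : p - (μ * s + ν * r - k * q) = -((μ - -(c2 * e2)) * s) - (ν - c2 * e2) * r + (k - -1) * q
      + e2 * (c2 * (s - r) - d2 * (q - p)) + (d2 * e2 - 1) * (q - p) := by ring
    rw [this]
    exact dvd_add (dvd_add (dvd_add (dvd_sub (m2.mul_right s).neg_right (n2.mul_right r)) (k2.mul_right q)) t1) t2
  have j3 := mul_dvd_mul (hc.mul_dvd j1 j2) (dvd_refl q)
  refine (j3.neg_right).trans (dvd_of_eq ?_)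
  rw [← h]; ring

/-- the classes modulo g1 -/
lemma class_g {a a2 g1 : ℕ} {c d c2 d2 q : ℤ} (h1 : Adm a c d) (h2 : Adm a2 c2 d2) (hg : g1 ∣ a)
    (hg2 : g1 ∣ a2) (hq : IsCoprime q (g1 : ℤ)) : ∃ f : ℤ × ℤ → ℕ, (∀ w, f w ∈ g1.divisors) ∧
    ∀ p r s p' r' s', OffD a a2 c d c2 d2 p q r s → OffD a a2 c d c2 d2 p' q r' s' → f (r, s) = f (r', s') →
    (g1 : ℤ) ∣ r - r' ∧ (g1 : ℤ) ∣ s - s' := by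
  obtain ⟨e, he⟩ := inv_mod h1.2.2.1
  obtain ⟨e2, he2⟩ := inv_mod h2.2.2.1
  have hgz : (g1 : ℤ) ∣ a := Int.natCast_dvd_natCast.2 hg
  have hgz2 : (g1 : ℤ) ∣ a2 := Int.natCast_dvd_natCast.2 hg2
  have hg0 : g1 ≠ 0 := by rintro rfl; exact h1.1.ne_zero (Nat.eq_zero_of_zero_dvd hg)
  have c10 : IsCoprime (10 : ℤ) (g1 : ℤ) := h1.2.2.2.of_isCoprime_of_dvd_right hgz
  have c2' : IsCoprime (2 : ℤ) (g1 : ℤ) := c10.of_isCoprime_of_dvd_left ⟨5, by norm_num⟩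
  have he := hgz.trans he
  have he2 := hgz2.trans he2
  refine ⟨fun w => Int.gcd (e * (w.1 + w.2) - e2 * (w.2 - w.1)) g1, fun w => Nat.mem_divisors.2
    ⟨by exact_mod_cast Int.gcd_dvd_right (e * (w.1 + w.2) - e2 * (w.2 - w.1)) (g1 : ℤ), hg0⟩, ?_⟩
  have main : ∀ p r s, OffD a a2 c d c2 d2 p q r s → ∃ x y : ℤ, x = e * (r + s) ∧ y = e2 * (s - r) ∧
      (g1 : ℤ) ∣ (r + s) - d * x ∧ (g1 : ℤ) ∣ (s - r) - d2 * y ∧ (g1 : ℤ) ∣ 2 * q - (c * x + c2 * y) ∧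
      (g1 : ℤ) ∣ (x - y) * (x + y) := by
    intro p r s ⟨o1, o2, o3⟩
    have o2 := hgz.trans o2
    have o3 := hgz2.trans o3
    refine ⟨_, _, rfl, rfl, ?_, ?_, ?_, ?_⟩
    · exact ((he.mul_left (r + s)).neg_right).trans (dvd_of_eq (by ring))
    · exact ((he2.mul_left (s - r)).neg_right).trans (dvd_of_eq (by ring))
    · have := dvd_sub (dvd_sub (o2.mul_left (-e)) (he.mul_right (p + q)))
        (dvd_add (o3.mul_left e2) (he2.mul_right (q - p)))
      exact this.trans (dvd_of_eq (by ring))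
    · set x := e * (r + s)
      set y := e2 * (s - r)
      have a1 : (g1 : ℤ) ∣ (r + s) - d * x :=
        ((he.mul_left (r + s)).neg_right).trans (dvd_of_eq (by simp only [x]; ring))
      have a2' : (g1 : ℤ) ∣ (s - r) - d2 * y :=
        ((he2.mul_left (s - r)).neg_right).trans (dvd_of_eq (by simp only [y]; ring))
      have a3 : (g1 : ℤ) ∣ (p + q) - c * x :=
        (dvd_sub (o2.mul_left (-e)) (he.mul_right (p + q))).trans (dvd_of_eq (by simp only [x]; ring))
      have a4 : (g1 : ℤ) ∣ (q - p) - c2 * y :=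
        (dvd_sub (o3.mul_left (-e2)) (he2.mul_right (q - p))).trans (dvd_of_eq (by simp only [y]; ring))
      have hA : (g1 : ℤ) ∣ c ^ 2 + d ^ 2 + 10 := by rw [h1.2.1]; exact hgz
      have hA2 : (g1 : ℤ) ∣ c2 ^ 2 + d2 ^ 2 + 10 := by rw [h2.2.1]; exact hgz2
      have hh : (g1 : ℤ) ∣ 4 * (p * q + r * s) := by rw [o1]; exact (dvd_sub hgz hgz2).mul_left _
      have h10 : (g1 : ℤ) ∣ 10 * ((x - y) * (x + y)) := by
        have t1 := a1.mul_right ((r + s) + d * x)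
        have t2 := a3.mul_right ((p + q) + c * x)
        have t3 := a2'.mul_right ((s - r) + d2 * y)
        have t4 := a4.mul_right ((q - p) + c2 * y)
        have t5 := hA.mul_right (x ^ 2)
        have t6 := hA2.mul_right (y ^ 2)
        have := dvd_sub (dvd_add (dvd_add t1 t2) t5) (dvd_add (dvd_add (dvd_add t3 t4) t6) hh)
        exact this.trans (dvd_of_eq (by ring))
      exact c10.symm.dvd_of_dvd_mul_left h10
  intro p r s p' r' s' ho ho' hf
  obtain ⟨x, y, hx, hy, b1, b2, b3, b4⟩ := main p r s ho
  obtain ⟨x', y', hx', hy', b1', b2', b3', b4'⟩ := main p' r' s' ho'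
  simp only [← hx, ← hy, ← hx', ← hy'] at hf
  obtain ⟨E, hE, hE2⟩ := gcd_split g1 hg0 _ _ b4
  obtain ⟨E', hE', hE2'⟩ := gcd_split g1 hg0 _ _ b4'
  set D := Int.gcd (x - y) g1 with hD
  rw [← hf] at hE'
  have hD0 : D ≠ 0 := by intro h0; rw [h0] at hE; simp at hE; omega
  have hEE : E = E' := Nat.eq_of_mul_eq_mul_left (Nat.pos_of_ne_zero hD0) (hE.symm.trans hE')
  subst hEE
  have hDx : (D : ℤ) ∣ x - y := Int.gcd_dvd_left ..
  have hDx' : (D : ℤ) ∣ x' - y' := by rw [hf]; exact Int.gcd_dvd_left ..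
  have hDg : (D : ℤ) ∣ g1 := by rw [hE]; push_cast; exact Dvd.intro _ rfl
  have hEg : (E : ℤ) ∣ g1 := by rw [hE]; push_cast; exact Dvd.intro_left _ rfl
  have c2q : IsCoprime (2 * q) (g1 : ℤ) := c2'.mul_left hq
  have gen : ∀ (M : ℤ) (k : ℤ), M ∣ (g1 : ℤ) → M ∣ 2 * q - k * x → M ∣ 2 * q - k * x' → M ∣ x - x' := by
    intro M k hM u1 u2
    have v1 : IsCoprime (2 * q) M := c2q.of_isCoprime_of_dvd_right hM
    have v2 : IsCoprime (k * x) M := by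
      obtain ⟨w, hw⟩ := u1
      have : k * x = 2 * q + M * (-w) := by linear_combination -hw
      rw [this]; exact v1.add_mul_left_left _
    have v3 : M ∣ k * (x - x') := (dvd_sub u2 u1).trans (dvd_of_eq (by ring))
    exact v2.of_mul_left_left.symm.dvd_of_dvd_mul_left v3
  have k1 : (D : ℤ) ∣ x - x' := gen D (c + c2) hDg
    (((hDg.trans b3).sub (hDx.mul_left c2)).trans (dvd_of_eq (by ring)))
    (((hDg.trans b3').sub (hDx'.mul_left c2)).trans (dvd_of_eq (by ring)))
  have k2 : (E : ℤ) ∣ x - x' := gen E (c - c2) hEg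
    (((hEg.trans b3).add (hE2.mul_left c2)).trans (dvd_of_eq (by ring)))
    (((hEg.trans b3').add (hE2'.mul_left c2)).trans (dvd_of_eq (by ring)))
  have hcop : IsCoprime (D : ℤ) (E : ℤ) := by
    have : Squarefree g1 := h1.1.squarefree_of_dvd hg
    rw [hE] at this
    exact Nat.isCoprime_iff_coprime.2 (Nat.squarefree_mul_iff.1 this).1
  have kk1 : (D : ℤ) ∣ y - y' := ((k1.sub hDx).add hDx').trans (dvd_of_eq (by ring))
  have kk2 : (E : ℤ) ∣ y - y' := ((hE2.sub hE2').sub k2).trans (dvd_of_eq (by ring))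
  have hgE : (g1 : ℤ) = D * E := by rw [← Nat.cast_mul, ← hE]
  have l1 : (g1 : ℤ) ∣ x - x' := by rw [hgE]; exact hcop.mul_dvd k1 k2
  have l2 : (g1 : ℤ) ∣ y - y' := by rw [hgE]; exact hcop.mul_dvd kk1 kk2
  have m1 : (g1 : ℤ) ∣ (r + s) - (r' + s') :=
    ((b1.sub b1').add (l1.mul_left d)).trans (dvd_of_eq (by ring))
  have m2 : (g1 : ℤ) ∣ (s - r) - (s' - r') :=
    ((b2.sub b2').add (l2.mul_left d2)).trans (dvd_of_eq (by ring))
  exact ⟨c2'.symm.dvd_of_dvd_mul_left ((m1.sub m2).trans (dvd_of_eq (by ring))),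
    c2'.symm.dvd_of_dvd_mul_left ((m1.add m2).trans (dvd_of_eq (by ring)))⟩

lemma fiber_box (l q' L : ℕ) (hl : l.Prime) (hL : 8 ≤ L) (hq' : 0 < q') (hcop : Nat.Coprime (q' * L) l)
    (h : ℤ) (hh : ¬ (l : ℤ) ∣ h) (hl8 : 3 * L ^ 8 ≤ l) (F : Finset (ℤ × ℤ))
    (hF : ∀ w ∈ F, (-(l * q' : ℤ) ≤ w.1 ∧ w.1 < l * q') ∧ (-(l * q' : ℤ) ≤ w.2 ∧ w.2 < l * q') ∧
      (l : ℤ) ∣ w.1 * w.2 - h)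
    (hc : ∀ w ∈ F, ∀ w' ∈ F, ((q' * L : ℕ) : ℤ) ∣ w.1 - w'.1 ∧ ((q' * L : ℕ) : ℤ) ∣ w.2 - w'.2) :
    (F.card : ℝ) ≤ 148 * l / L ^ 2 := by
  classical
  have : Fact l.Prime := ⟨hl⟩
  rcases F.eq_empty_or_nonempty with rfl | ⟨w0, hw0⟩
  · simp; positivity
  set m : ℕ := q' * L with hm
  have hm0 : 0 < m := by positivity
  have mz : (0 : ℤ) < m := by exact_mod_cast hm0
  set q : ℤ := l * q' with hq
  set H : ℕ := 2 * l / L + 1 with hH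
  set R : ℤ := (w0.1 + q) % m - q with hR
  set S : ℤ := (w0.2 + q) % m - q with hS
  have hmm : (m : ZMod l) ≠ 0 := by
    intro h0
    rw [ZMod.natCast_eq_zero_iff] at h0
    exact (Nat.Prime.coprime_iff_not_dvd hl).1 hcop.symm h0
  have hkey : ∀ x x0 : ℤ, -q ≤ x → x < q → (m : ℤ) ∣ x - x0 →
      x = m * ((((x + q) / m).toNat : ℕ) : ℤ) + ((x0 + q) % m - q) ∧ ((x + q) / m).toNat < H := by
    intro x x0 h1 h2 h3
    have e1 : (x + q) % m = (x0 + q) % m := Int.ModEq.symm ((Int.modEq_iff_dvd).2 (by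
          rwa [add_sub_add_right_eq_sub]))
    have e2 := Int.mul_ediv_add_emod (x + q) m
    have e3 : 0 ≤ (x + q) / m := Int.ediv_nonneg (by linarith) mz.le
    rw [Int.toNat_of_nonneg e3, ← e1]
    refine ⟨by linarith, ?_⟩
    have e4 : (x + q) / m ≤ ((2 * l / L : ℕ) : ℤ) := by
      have : ((2 * l / L : ℕ) : ℤ) = (2 * q) / m := by
        rw [hq, hm]; push_cast
        rw [show (2 * ((l : ℤ) * q')) = q' * (2 * l) by ring]
        rw [Int.mul_ediv_mul_of_pos _ _ (by exact_mod_cast hq')]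
      rw [this]
      exact Int.ediv_le_ediv mz (by linarith)
    exact Nat.lt_succ_of_le (Int.toNat_le.2 e4)
  have hl3 : 3 * 8 ^ 8 ≤ l := (Nat.mul_le_mul_left 3 (Nat.pow_le_pow_left hL 8)).trans hl8
  have hHl : 2 * H ≤ l := by
    have h7 : 2 * l / L ≤ 2 * l / 8 := Nat.div_le_div_left hL (by norm_num)
    rw [hH]
    generalize 2 * l / L = x at h7
    omega
  have l0 : (0 : ℝ) < l := by exact_mod_cast hl.pos
  have L0 : (0 : ℝ) < L := by positivity
  have hbox := hyp_box l H (by rw [hH]; exact Nat.le_add_left 1 _) hHl ((R : ZMod l) * (m : ZMod l)⁻¹) ((S : ZMod l) * (m : ZMod l)⁻¹)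
    ((h : ZMod l) * ((m : ZMod l)⁻¹) ^ 2)
    (by
      refine mul_ne_zero ?_ (pow_ne_zero _ (inv_ne_zero hmm))
      rwa [Ne, ZMod.intCast_zmod_eq_zero_iff_dvd]) (l / L ^ 2) (by positivity)
    (by
      have h8 : (3 * (L : ℝ) ^ 8) ≤ l := by exact_mod_cast hl8
      rw [div_pow, le_div_iff₀ (by positivity)]
      calc 3 * (l : ℝ) ^ 3 * ((L : ℝ) ^ 2) ^ 4 = (3 * (L : ℝ) ^ 8) * (l : ℝ) ^ 3 := by ring
        _ ≤ (l : ℝ) * (l : ℝ) ^ 3 := mul_le_mul_of_nonneg_right h8 (by positivity)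
        _ = _ := by ring)
  let f : ℤ × ℤ → ℕ × ℕ := fun w => (((w.1 + q) / m).toNat, ((w.2 + q) / m).toNat)
  have hcard : F.card ≤ ((range H ×ˢ range H).filter fun t => ((t.1 : ZMod l) + (R : ZMod l) * (m : ZMod l)⁻¹) *
      ((t.2 : ZMod l) + (S : ZMod l) * (m : ZMod l)⁻¹) = (h : ZMod l) * ((m : ZMod l)⁻¹) ^ 2).card := by
    refine card_le_card_of_injOn f ?_ ?_
    · intro w hw
      obtain ⟨⟨a1, a2⟩, ⟨b1, b2⟩, hd⟩ := hF w hw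
      obtain ⟨x1, x2⟩ := hkey w.1 w0.1 a1 a2 (hc w hw w0 hw0).1
      obtain ⟨y1, y2⟩ := hkey w.2 w0.2 b1 b2 (hc w hw w0 hw0).2
      simp only [coe_filter, mem_product, mem_range, Set.mem_ofPred_eq, f]
      refine ⟨⟨x2, y2⟩, ?_⟩
      have : ((w.1 * w.2 - h : ℤ) : ZMod l) = 0 := (ZMod.intCast_zmod_eq_zero_iff_dvd _ _).2 hd
      rw [x1, y1, ← hR, ← hS] at this
      push_cast at this
      field_simp
      linear_combination this
    · intro w hw w' hw' he
      obtain ⟨⟨a1, a2⟩, ⟨b1, b2⟩, hd⟩ := hF w hw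
      obtain ⟨⟨a1', a2'⟩, ⟨b1', b2'⟩, hd'⟩ := hF w' hw'
      obtain ⟨x1, x2⟩ := hkey w.1 w0.1 a1 a2 (hc w hw w0 hw0).1
      obtain ⟨y1, y2⟩ := hkey w.2 w0.2 b1 b2 (hc w hw w0 hw0).2
      obtain ⟨x1', x2'⟩ := hkey w'.1 w0.1 a1' a2' (hc w' hw' w0 hw0).1
      obtain ⟨y1', y2'⟩ := hkey w'.2 w0.2 b1' b2' (hc w' hw' w0 hw0).2
      simp only [f, Prod.mk.injEq] at he
      exact Prod.ext (by rw [x1, x1', he.1]) (by rw [y1, y1', he.2])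
  have hHr : (H : ℝ) ≤ 3 * l / L := by
    have h1 : ((2 * l / L : ℕ) : ℝ) ≤ 2 * l / L := by
      have := Nat.cast_div_le (α := ℝ) (m := 2 * l) (n := L); push_cast at this; exact this
    have h2 : (1 : ℝ) ≤ l / L := by
      rw [le_div_iff₀ L0, one_mul]
      have : L ≤ l := by
        calc L ≤ 3 * L ^ 8 := by nlinarith [Nat.le_self_pow (show 8 ≠ 0 by norm_num) L]
          _ ≤ l := hl8
      exact_mod_cast this
    have : (3 * l / L : ℝ) = 2 * l / L + l / L := by ring
    rw [hH, this]; push_cast; linarith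
  calc (F.card : ℝ) ≤ _ := by exact_mod_cast hcard
    _ ≤ _ := hbox
    _ ≤ 16 * (3 * l / L) ^ 2 / l + 4 * (l / L ^ 2) := by gcongr
    _ = _ := by field_simp; ring

lemma tau_mul (m n : ℕ) : (m * n).divisors.card ≤ m.divisors.card * n.divisors.card := by
  rw [Nat.divisors_mul]; exact card_mul_le

lemma tau_mono {m n : ℕ} (h : m ∣ n) (hn : n ≠ 0) : m.divisors.card ≤ n.divisors.card :=
  card_le_card (Nat.divisors_subset_of_dvd hn h)

lemma tau_gcd_mul (c : ℤ) (m n : ℕ) (hm : m ≠ 0) (hn : n ≠ 0) : (Int.gcd c (m * n : ℕ)).divisors.card ≤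
    (Int.gcd c m).divisors.card * (Int.gcd c n).divisors.card := by
  refine (tau_mono ?_ ?_).trans (tau_mul _ _)
  · simp only [Int.gcd, Int.natAbs_natCast]; exact Nat.gcd_mul_right_dvd_mul_gcd _ _ _
  · simp [Int.gcd_eq_zero_iff, hm, hn]

lemma fq_alg (q' L g1 t t' s l G : ℝ) (h1 : g1 ≠ 0) (h2 : G ≠ 0) (h3 : L ≠ 0) :
    q' * L / g1 * (t ^ 2 * t') * s * (148 * l / L ^ 2) =
    148 * (l * q') / (L * (G * g1)) * (G * s * t ^ 2 * t') := by
  field_simp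

/-- count for a fixed good q -/
lemma fixed_q {a a2 g a' b : ℕ} {c d c2 d2 : ℤ} (h1 : Adm a c d) (h2 : Adm a2 c2 d2) (ha : a = g * a')
    (ha2 : a2 = g * b) (hab : Nat.Coprime a' b) (ha8 : 8 ≤ a) : ∃ κ : ℤ, ∀ l q : ℕ, l.Prime → 0 < q → l ∣ q → ¬ l ^ 2 ∣ q →
    3 * (a * a2) ^ 8 ≤ l → a ≠ a2 → ∀ F : Finset (ℤ × ℤ),
    (∀ w ∈ F, (-(q : ℤ) ≤ w.1 ∧ w.1 < q) ∧ (-(q : ℤ) ≤ w.2 ∧ w.2 < q) ∧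
      ∃ p, OffD a a2 c d c2 d2 p q w.1 w.2) →
    (F.card : ℝ) ≤ 148 * q / (a * a2) * (g.gcd q * g.divisors.card *
      (Int.gcd ((a : ℤ) - a2) q).divisors.card ^ 2 *
      (Int.gcd ((a : ℤ) - a2 + κ * q ^ 2) (a' * b : ℕ)).divisors.card) := by
  classical
  have hsq1 := h1.1; have hsq2 := h2.1
  rw [ha] at hsq1; rw [ha2] at hsq2
  have cga : Nat.Coprime g a' := (Nat.squarefree_mul_iff.1 hsq1).1
  have cgb : Nat.Coprime g b := (Nat.squarefree_mul_iff.1 hsq2).1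
  have hgs : Squarefree g := (Nat.squarefree_mul_iff.1 hsq1).2.1
  have hg0 : g ≠ 0 := hgs.ne_zero
  have ha0 : a' ≠ 0 := (Nat.squarefree_mul_iff.1 hsq1).2.2.ne_zero
  have hb0 : b ≠ 0 := (Nat.squarefree_mul_iff.1 hsq2).2.2.ne_zero
  have cab : Nat.Coprime a b := by rw [ha]; exact Nat.Coprime.mul_left cgb hab
  obtain ⟨μ, ν, κ, hκ⟩ := crt_data h1 h2 ha2 cab
  refine ⟨κ, fun l q hl hq hlq hlq2 hl8 hne F hF => ?_⟩
  obtain ⟨q', hq'⟩ := hlq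
  have hq'0 : 0 < q' := Nat.pos_of_ne_zero (by rintro rfl; simp at hq'; omega)
  obtain ⟨g1, hg1⟩ := Nat.gcd_dvd_left g q
  set G := g.gcd q with hG
  have hG0 : 0 < G := Nat.gcd_pos_of_pos_right _ hq
  have hg10 : 0 < g1 := Nat.pos_of_ne_zero (by rintro rfl; simp at hg1; omega)
  have cGg : Nat.Coprime G g1 := by rw [hg1] at hgs; exact (Nat.squarefree_mul_iff.1 hgs).1
  have cgq : Nat.Coprime q g1 := by
    have h3 : Nat.gcd q g1 ∣ G := Nat.dvd_gcd ((Nat.gcd_dvd_right _ _).trans (by rw [hg1]; exact Dvd.intro_left _ rfl))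
      (Nat.gcd_dvd_left _ _)
    exact Nat.eq_one_of_dvd_coprimes cGg h3 (Nat.gcd_dvd_right _ _)
  obtain ⟨f, hf1, hf2⟩ := class_g (q := (q : ℤ)) h1 h2 (g1 := g1)
    (by rw [ha, hg1]; exact Dvd.intro_left (G * a') (by ring)) (by rw [ha2, hg1]; exact Dvd.intro_left (G * b) (by ring))
    (Nat.isCoprime_iff_coprime.2 cgq)
  set L := a * b with hLdef
  set M := q' * (G * (a' * b)) with hM
  have hM0 : 0 < M := by positivity
  have hML : M * g1 = q' * L := by rw [hM, hLdef, ha, hg1]; ring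
  have hLle : L ≤ a * a2 := by
    rw [hLdef, ha2]; exact Nat.mul_le_mul_left _ (Nat.le_mul_of_pos_left _ (Nat.pos_of_ne_zero hg0))
  have hL8 : 8 ≤ L := ha8.trans (Nat.le_mul_of_pos_right _ (Nat.pos_of_ne_zero hb0))
  have hapos : 0 < a := by omega
  have ha2pos : 0 < a2 := Nat.pos_of_ne_zero h2.1.ne_zero
  have hlbig : a * a2 < l := by
    have : a * a2 ≤ (a * a2) ^ 8 := Nat.le_self_pow (by norm_num) _
    have : 0 < a * a2 := by positivity
    omega
  have clq : Nat.Coprime (q' * L) l := by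
    rw [Nat.coprime_comm, Nat.Prime.coprime_iff_not_dvd hl]
    intro hd
    rcases (Nat.Prime.dvd_mul hl).1 hd with h3 | h3
    · exact hlq2 (by rw [hq', sq]; exact Nat.mul_dvd_mul_left _ h3)
    · have := Nat.le_of_dvd (by omega) h3; omega
  have hlh : ¬ (l : ℤ) ∣ (a : ℤ) - a2 := by
    intro hd
    have h3 := Int.le_of_dvd (abs_pos.2 (sub_ne_zero.2 (by exact_mod_cast hne))) ((dvd_abs _ _).2 hd)
    have : a ≤ a * a2 := Nat.le_mul_of_pos_right _ ha2pos
    have : a2 ≤ a * a2 := Nat.le_mul_of_pos_left _ hapos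
    rcases abs_cases ((a : ℤ) - a2) with ⟨h4, _⟩ | ⟨h4, _⟩ <;> omega
  set cq := (a : ℤ) - a2 + κ * q ^ 2 with hcq
  let φ : ℤ × ℤ → (ℤ × ℤ) × ℕ := fun w => (((w.1 + μ * q) % M, (w.2 + ν * q) % M), f w)
  set I1 := (F.image φ).image Prod.fst with hI1
  have c1 : I1.card ≤ M * (Int.gcd cq M).divisors.card := by
    refine xy_count M hM0 cq I1 ?_
    intro x hx
    obtain ⟨y, hy, rfl⟩ := mem_image.1 hx
    obtain ⟨w, hw, rfl⟩ := mem_image.1 hy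
    have Mz : (0 : ℤ) < M := by exact_mod_cast hM0
    refine ⟨⟨Int.emod_nonneg _ Mz.ne', Int.emod_lt_of_pos _ Mz⟩, ⟨Int.emod_nonneg _ Mz.ne', Int.emod_lt_of_pos _ Mz⟩, ?_⟩
    obtain ⟨p, hp⟩ := (hF w hw).2.2
    have h3 := hκ p q w.1 w.2 hp
    have h4 : (M : ℤ) ∣ (w.1 + μ * q) * (w.2 + ν * q) - cq := by
      refine Dvd.dvd.trans ?_ h3
      have : M ∣ a * b * q := ⟨g1 * l, by rw [hM, ha, hq', hg1]; ring⟩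
      exact_mod_cast Int.natCast_dvd_natCast.2 this
    have h5 : (w.1 + μ * q) % M * ((w.2 + ν * q) % M) ≡ (w.1 + μ * q) * (w.2 + ν * q) [ZMOD M] :=
      (Int.mod_modEq _ _).mul (Int.mod_modEq _ _)
    have h6 := (Int.modEq_iff_dvd.1 h5)
    exact (h4.sub h6).trans (dvd_of_eq (by simp only [φ]; ring))
  have c2 : (F.image φ).card ≤ I1.card * g1.divisors.card := by
    rw [← card_product]
    refine card_le_card fun x hx => mem_product.2 ⟨mem_image_of_mem _ hx, ?_⟩
    obtain ⟨w, hw, rfl⟩ := mem_image.1 hx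
    exact hf1 w
  have c3 : ∀ x ∈ F.image φ, ((F.filter fun w => φ w = x).card : ℝ) ≤ 148 * l / L ^ 2 := by
    intro x _
    refine fiber_box l q' L hl hL8 hq'0 clq ((a : ℤ) - a2) hlh
      (le_trans (Nat.mul_le_mul_left _ (Nat.pow_le_pow_left hLle 8)) hl8) _ ?_ ?_
    · intro w hw
      obtain ⟨u1, u2, p, hp⟩ := hF w (mem_filter.1 hw).1
      rw [hq'] at u1 u2; push_cast at u1 u2
      refine ⟨u1, u2, ?_⟩
      rw [← hp.1, hq']; push_cast
      exact ⟨-(p * q'), by ring⟩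
    · intro w hw w' hw'
      obtain ⟨_, _, p, hp⟩ := hF w (mem_filter.1 hw).1
      obtain ⟨_, _, p', hp'⟩ := hF w' (mem_filter.1 hw').1
      have he : φ w = φ w' := (mem_filter.1 hw).2.trans (mem_filter.1 hw').2.symm
      simp only [φ, Prod.mk.injEq] at he
      obtain ⟨⟨e1, e2⟩, e3⟩ := he
      obtain ⟨t1, t2⟩ := hf2 p w.1 w.2 p' w'.1 w'.2 hp hp' e3
      have s1 : (M : ℤ) ∣ w.1 - w'.1 := (Int.modEq_iff_dvd.1 (Int.ModEq.symm e1)).trans (dvd_of_eq (by ring))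
      have s2 : (M : ℤ) ∣ w.2 - w'.2 := (Int.modEq_iff_dvd.1 (Int.ModEq.symm e2)).trans (dvd_of_eq (by ring))
      have cM : IsCoprime (M : ℤ) (g1 : ℤ) := by
        rw [Nat.isCoprime_iff_coprime]
        have i1 : Nat.Coprime q' g1 := Nat.Coprime.of_dvd_left (Dvd.intro_left _ hq'.symm) cgq
        have hgg : g1 ∣ g := by rw [hg1]; exact Dvd.intro_left _ rfl
        exact i1.mul_left (cGg.mul_left (((Nat.Coprime.of_dvd_left hgg cga).symm).mul_left
          (Nat.Coprime.of_dvd_left hgg cgb).symm))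
      rw [← hML]; push_cast
      exact ⟨cM.mul_dvd s1 t1, cM.mul_dvd s2 t2⟩
  have c4 : (F.card : ℝ) ≤ (F.image φ).card * (148 * l / L ^ 2) := by
    rw [card_eq_sum_card_image φ F]
    push_cast
    calc _ ≤ ∑ x ∈ F.image φ, (148 * l / L ^ 2 : ℝ) := sum_le_sum c3
      _ = _ := by rw [sum_const, nsmul_eq_mul]
  have hqz : (q : ℤ) ∣ cq - ((a : ℤ) - a2) := ⟨κ * q, by rw [hcq]; ring⟩
  have gtr : ∀ k : ℕ, k ∣ q → Int.gcd cq k ∣ Int.gcd ((a : ℤ) - a2) q := by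
    intro k hk
    refine Int.dvd_gcd ?_ ((Int.gcd_dvd_right ..).trans (Int.natCast_dvd_natCast.2 hk))
    have u1 : ((Int.gcd cq k : ℕ) : ℤ) ∣ cq := Int.gcd_dvd_left ..
    have u2 : ((Int.gcd cq k : ℕ) : ℤ) ∣ cq - ((a : ℤ) - a2) :=
      ((Int.gcd_dvd_right ..).trans (Int.natCast_dvd_natCast.2 hk)).trans hqz
    exact (u1.sub u2).trans (dvd_of_eq (by ring))
  have hgq0 : Int.gcd ((a : ℤ) - a2) q ≠ 0 := by
    rw [Ne, Int.gcd_eq_zero_iff]; rintro ⟨_, h3⟩; omega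
  set t := (Int.gcd ((a : ℤ) - a2) q).divisors.card with ht
  set t' := (Int.gcd cq (a' * b : ℕ)).divisors.card with ht'
  have c5 : (Int.gcd cq M).divisors.card ≤ t ^ 2 * t' := by
    have v1 := tau_gcd_mul cq q' (G * (a' * b)) (by omega) (by positivity)
    have v2 := tau_gcd_mul cq G (a' * b) (by omega) (by positivity)
    have v3 := tau_mono (gtr q' (Dvd.intro_left _ hq'.symm)) hgq0
    have v4 := tau_mono (gtr G (Nat.gcd_dvd_right _ _)) hgq0
    calc _ ≤ _ := v1
      _ ≤ t * (t * t') := Nat.mul_le_mul v3 (v2.trans (Nat.mul_le_mul_right _ v4))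
      _ = _ := by ring
  have c6 : g1.divisors.card ≤ g.divisors.card := tau_mono (by rw [hg1]; exact Dvd.intro_left _ rfl) hg0
  have c7 : ((F.image φ).card : ℝ) ≤ M * (t ^ 2 * t') * g.divisors.card := by
    have : (F.image φ).card ≤ M * (t ^ 2 * t') * g.divisors.card :=
      c2.trans (Nat.mul_le_mul (c1.trans (Nat.mul_le_mul_left _ c5)) c6)
    exact_mod_cast this
  calc (F.card : ℝ) ≤ _ := c4
    _ ≤ (M * (t ^ 2 * t') * g.divisors.card) * (148 * l / L ^ 2) := by gcongr
    _ = _ := by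
      have e1 : (M : ℝ) * g1 = q' * L := by exact_mod_cast hML
      have e2 : (q : ℝ) = l * q' := by exact_mod_cast hq'
      have e3 : (g : ℝ) = G * g1 := by exact_mod_cast hg1
      have e4 : (a : ℝ) * a2 = L * g := by rw [hLdef, ha2]; push_cast; ring
      have g1r : (g1 : ℝ) ≠ 0 := by exact_mod_cast hg10.ne'
      have Gr : (G : ℝ) ≠ 0 := by exact_mod_cast hG0.ne'
      have Lr : (L : ℝ) ≠ 0 := by have : L ≠ 0 := by omega
                                  exact_mod_cast this
      have e5 : (M : ℝ) = q' * L / g1 := by rw [← e1]; field_simp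
      rw [e4, e5, e3, e2]
      clear_value L M G t t'
      exact fq_alg _ _ _ _ _ _ _ _ g1r Gr Lr

noncomputable def Jf (n : ℕ) : ℝ := ∑ j ∈ n.divisors, (j.divisors.card : ℝ) / j
noncomputable def Yf (n : ℕ) : ℝ := ∑ j ∈ n.divisors, (j.divisors.card : ℝ) ^ 2 / j

lemma Jf_nonneg (n : ℕ) : 0 ≤ Jf n := sum_nonneg fun _ _ => by positivity
lemma Yf_nonneg (n : ℕ) : 0 ≤ Yf n := sum_nonneg fun _ _ => by positivity

lemma Jf_mono {m n : ℕ} (h : m ∣ n) (hn : n ≠ 0) : Jf m ≤ Jf n :=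
  sum_le_sum_of_subset_of_nonneg (Nat.divisors_subset_of_dvd hn h) fun _ _ _ => by positivity

open scoped Pointwise in
lemma Jf_mul (m n : ℕ) : Jf (m * n) ≤ Jf m * Jf n := by
  classical
  unfold Jf
  rw [Nat.divisors_mul, sum_mul_sum, ← sum_product']
  have : m.divisors * n.divisors = (m.divisors ×ˢ n.divisors).image fun p => p.1 * p.2 := by
    ext x; simp [Finset.mem_mul]; grind
  rw [this]
  refine (sum_image_le_of_nonneg (fun i _ => by positivity)).trans (sum_le_sum fun p _ => ?_)
  have : ((p.1 * p.2).divisors.card : ℝ) ≤ p.1.divisors.card * p.2.divisors.card := by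
    exact_mod_cast tau_mul p.1 p.2
  rw [div_mul_div_comm]; push_cast; gcongr

lemma gY_alg (t i G q s r : ℝ) (hd : t ≤ s * r) (hi : i = G * q) (hG : 0 < G) (hq : 0 < q) (ht : 0 ≤ t) :
    G * t ^ 2 / i ≤ s ^ 2 * (r ^ 2 / q) := by
  rw [hi]
  calc _ ≤ G * (s * r) ^ 2 / (G * q) := by gcongr
    _ = _ := by field_simp

lemma gcd_Y (g n : ℕ) (hg : g ≠ 0) : ∑ i ∈ n.divisors, (g.gcd i : ℝ) * (i.divisors.card : ℝ) ^ 2 / i ≤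
    (g.divisors.card : ℝ) ^ 3 * Yf n := by
  classical
  have h1 : ∑ i ∈ n.divisors, (g.gcd i : ℝ) * (i.divisors.card : ℝ) ^ 2 / i ≤
      ∑ p ∈ g.divisors ×ˢ n.divisors, (p.1.divisors.card : ℝ) ^ 2 * ((p.2.divisors.card : ℝ) ^ 2 / p.2) := by
    have e : ∀ i ∈ n.divisors, i = g.gcd i * (i / g.gcd i) := fun i _ => (Nat.mul_div_cancel' (Nat.gcd_dvd_right _ _)).symm
    have inj : Set.InjOn (fun i => (g.gcd i, i / g.gcd i)) (n.divisors : Set ℕ) := by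
      intro i hi j hj hij
      simp only [Prod.mk.injEq] at hij
      calc i = g.gcd i * (i / g.gcd i) := e i hi
        _ = g.gcd j * (j / g.gcd j) := by rw [hij.2, hij.1]
        _ = j := (e j hj).symm
    calc _ ≤ ∑ i ∈ n.divisors, (fun p : ℕ × ℕ => (p.1.divisors.card : ℝ) ^ 2 * ((p.2.divisors.card : ℝ) ^ 2 / p.2)) (g.gcd i, i / g.gcd i) := by
          refine sum_le_sum fun i hi => ?_
          have i0 : 0 < i := Nat.pos_of_mem_divisors hi
          have g0 : 0 < g.gcd i := Nat.gcd_pos_of_pos_right _ i0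
          have hd : (i.divisors.card : ℝ) ≤ (g.gcd i).divisors.card * (i / g.gcd i).divisors.card := by
            have := tau_mul (g.gcd i) (i / g.gcd i)
            rw [← e i hi] at this; exact_mod_cast this
          have hi' : (i : ℝ) = (g.gcd i : ℝ) * ((i / g.gcd i : ℕ) : ℝ) := by exact_mod_cast e i hi
          have q0 : 0 < i / g.gcd i := Nat.div_pos (Nat.le_of_dvd i0 (Nat.gcd_dvd_right _ _)) g0
          have g0' : (0 : ℝ) < g.gcd i := by exact_mod_cast g0
          have q0' : (0 : ℝ) < (i / g.gcd i : ℕ) := by exact_mod_cast q0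
          dsimp only
          exact gY_alg _ _ _ _ _ _ hd hi' g0' q0' (Nat.cast_nonneg _)
      _ = ∑ p ∈ n.divisors.image (fun i => (g.gcd i, i / g.gcd i)),
          (fun p : ℕ × ℕ => (p.1.divisors.card : ℝ) ^ 2 * ((p.2.divisors.card : ℝ) ^ 2 / p.2)) p := (sum_image (f := (fun p : ℕ × ℕ => (p.1.divisors.card : ℝ) ^ 2 * ((p.2.divisors.card : ℝ) ^ 2 / p.2))) inj).symm
      _ ≤ _ := by
          refine sum_le_sum_of_subset_of_nonneg ?_ (fun _ _ _ => by positivity)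
          intro p hp
          obtain ⟨i, hi, rfl⟩ := mem_image.1 hp
          have hn := Nat.ne_zero_of_mem_divisors hi
          exact mem_product.2 ⟨Nat.mem_divisors.2 ⟨Nat.gcd_dvd_left _ _, hg⟩,
            Nat.mem_divisors.2 ⟨(Nat.div_dvd_of_dvd (Nat.gcd_dvd_right _ _)).trans (Nat.dvd_of_mem_divisors hi), hn⟩⟩
  refine h1.trans ?_
  rw [sum_product]; dsimp only; rw [← sum_mul_sum]
  refine mul_le_mul_of_nonneg_right ?_ (Yf_nonneg n)
  calc ∑ i ∈ g.divisors, (i.divisors.card : ℝ) ^ 2 ≤ ∑ i ∈ g.divisors, (g.divisors.card : ℝ) ^ 2 := by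
        refine sum_le_sum fun i hi => ?_
        have := tau_mono (Nat.dvd_of_mem_divisors hi) hg
        gcongr
    _ = _ := by rw [sum_const, nsmul_eq_mul]; ring

lemma tau_gcd_card (c : ℤ) (n : ℕ) (hn : n ≠ 0) :
    (Int.gcd c n).divisors.card = (n.divisors.filter fun j : ℕ => (j : ℤ) ∣ c).card := by
  congr 1; ext j
  simp only [Nat.mem_divisors, mem_filter]
  constructor
  · rintro ⟨h1, _⟩
    have := Int.natCast_dvd_natCast.2 h1
    exact ⟨⟨by exact_mod_cast this.trans (Int.gcd_dvd_right ..), hn⟩, this.trans (Int.gcd_dvd_left ..)⟩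
  · rintro ⟨⟨h1, _⟩, h2⟩
    refine ⟨Int.dvd_gcd h2 (by exact_mod_cast h1), ?_⟩
    rw [Ne, Int.gcd_eq_zero_iff]; rintro ⟨_, h⟩; exact hn (by exact_mod_cast h)

lemma q_count (X i j : ℕ) (hi : 0 < i) (hj : Squarefree j) (h κ : ℤ) (hc : IsCoprime h (j : ℤ)) (hX : i * j ≤ X) :
    (((Ioc 0 X).filter fun q => i ∣ q ∧ (j : ℤ) ∣ h + κ * q ^ 2).card : ℝ) ≤ 2 * X / i * (j.divisors.card / j) := by
  classical
  set Q := (Ioc 0 X).filter fun q => i ∣ q ∧ (j : ℤ) ∣ h + κ * q ^ 2 with hQ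
  have j0 : 0 < j := Nat.pos_of_ne_zero hj.ne_zero
  rcases Q.eq_empty_or_nonempty with h0 | ⟨q0, hq0⟩
  · rw [h0]; simp; positivity
  have hα : ∀ x : ℤ, (j : ℤ) ∣ (κ * i ^ 2) * x → (j : ℤ) ∣ (1 : ℕ) * x := by
    intro x hx
    obtain ⟨_, ⟨t, rfl⟩, hq2⟩ := mem_filter.1 hq0
    push_cast at hq2
    have h1 : (j : ℤ) ∣ h * x := by
      have := (hq2.mul_right x).sub (hx.mul_right (t ^ 2))
      exact this.trans (dvd_of_eq (by ring))
    simpa using hc.symm.dvd_of_dvd_mul_left h1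
  let S : Finset ℤ := Q.image fun q => ((q / i : ℕ) : ℤ)
  have hS := root_count j hj (κ * i ^ 2) 0 h 1 one_pos hα S 1 (X / i) (by
      intro x hx
      obtain ⟨q, hq, rfl⟩ := mem_image.1 hx
      obtain ⟨h1, h2, _⟩ := mem_filter.1 hq
      have h3 := mem_Ioc.1 h1
      have : 1 ≤ q / i := Nat.div_pos (Nat.le_of_dvd h3.1 h2) hi
      have : q / i ≤ X / i := Nat.div_le_div_right h3.2
      omega) (by
      intro x hx
      obtain ⟨q, hq, rfl⟩ := mem_image.1 hx
      obtain ⟨_, ⟨t, rfl⟩, h2⟩ := mem_filter.1 hq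
      rw [Nat.mul_div_cancel_left _ hi]
      push_cast at h2
      exact h2.trans (dvd_of_eq (by ring)))
  have hcard : S.card = Q.card := card_image_of_injOn (by
    intro x hx y hy hxy
    obtain ⟨_, ⟨t, rfl⟩, _⟩ := mem_filter.1 hx
    obtain ⟨_, ⟨t', rfl⟩, _⟩ := mem_filter.1 hy
    simp only [Nat.mul_div_cancel_left _ hi] at hxy
    rw [Nat.cast_inj.1 hxy])
  rw [hcard] at hS
  have i0' : (0 : ℝ) < i := by exact_mod_cast hi
  have j0' : (0 : ℝ) < j := by exact_mod_cast j0
  have hXi : ((X / i : ℕ) : ℝ) ≤ X / i := Nat.cast_div_le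
  have h1 : (1 : ℝ) ≤ X / i / j := by
    rw [div_div, le_div_iff₀ (by positivity), one_mul]; exact_mod_cast hX
  calc (Q.card : ℝ) ≤ _ := hS
    _ ≤ j.divisors.card * ((X / i : ℝ) / j + X / i / j) := by push_cast; rw [one_mul]; gcongr
    _ = _ := by ring

lemma w_sum (g a' b n X : ℕ) (h κ : ℤ) (hn : n = h.natAbs) (hg : g ≠ 0) (hgh : g ∣ n) (h0 : n ≠ 0)
    (hsq : Squarefree (a' * b)) (hc : IsCoprime h ((a' * b : ℕ) : ℤ)) (hX : n * (a' * b) ≤ X) :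
    ∑ q ∈ Ioc 0 X, ((g.gcd q : ℝ) * (Int.gcd h q).divisors.card ^ 2 *
      (Int.gcd (h + κ * q ^ 2) (a' * b : ℕ)).divisors.card) ≤
      2 * X * ((g.divisors.card : ℝ) ^ 3 * Yf n) * Jf (a' * b) := by
  classical
  set m := a' * b with hm
  have hm0 : m ≠ 0 := hsq.ne_zero
  calc _ ≤ ∑ q ∈ Ioc 0 X, ∑ i ∈ n.divisors, ∑ j ∈ m.divisors, (if i ∣ q ∧ (j : ℤ) ∣ h + κ * q ^ 2 then
        (g.gcd i : ℝ) * i.divisors.card ^ 2 else 0) := by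
        refine sum_le_sum fun q _ => ?_
        have e1 : Int.gcd h q = n.gcd q := by rw [hn]; simp [Int.gcd]
        have e2 : g.gcd q = g.gcd (n.gcd q) := by rw [← Nat.gcd_assoc, Nat.gcd_eq_left hgh]
        have hi : n.gcd q ∈ n.divisors := Nat.mem_divisors.2 ⟨Nat.gcd_dvd_left _ _, h0⟩
        refine le_trans ?_ (single_le_sum (f := fun i => ∑ j ∈ m.divisors, (if i ∣ q ∧ (j : ℤ) ∣ h + κ * q ^ 2 then
          (g.gcd i : ℝ) * i.divisors.card ^ 2 else 0)) (fun i _ => sum_nonneg fun j _ => by split_ifs <;> positivity) hi)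
        rw [e1, e2, tau_gcd_card _ _ hm0]
        simp only [Nat.gcd_dvd_right, true_and]
        rw [← sum_filter, sum_const, nsmul_eq_mul]
        exact le_of_eq (by ring)
    _ = ∑ i ∈ n.divisors, ∑ j ∈ m.divisors, ((g.gcd i : ℝ) * i.divisors.card ^ 2) *
          ((Ioc 0 X).filter fun q => i ∣ q ∧ (j : ℤ) ∣ h + κ * q ^ 2).card := by
        rw [sum_comm]
        refine sum_congr rfl fun i _ => ?_
        rw [sum_comm]
        refine sum_congr rfl fun j _ => ?_
        rw [← sum_filter, sum_const, nsmul_eq_mul]; ring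
    _ ≤ ∑ i ∈ n.divisors, ∑ j ∈ m.divisors, ((g.gcd i : ℝ) * i.divisors.card ^ 2) * (2 * X / i * (j.divisors.card / j)) := by
        refine sum_le_sum fun i hi => sum_le_sum fun j hj => ?_
        refine mul_le_mul_of_nonneg_left ?_ (by positivity)
        have hjm := Nat.dvd_of_mem_divisors hj
        refine q_count X i j (Nat.pos_of_mem_divisors hi) (hsq.squarefree_of_dvd hjm) h κ
          (hc.of_isCoprime_of_dvd_right (Int.natCast_dvd_natCast.2 hjm)) (le_trans ?_ hX)
        exact Nat.mul_le_mul (Nat.divisor_le hi) (Nat.divisor_le hj)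
    _ = 2 * X * (∑ i ∈ n.divisors, (g.gcd i : ℝ) * i.divisors.card ^ 2 / i) * Jf m := by
        unfold Jf
        rw [mul_sum (s := n.divisors), sum_mul_sum]
        refine sum_congr rfl fun i _ => sum_congr rfl fun j _ => by ring
    _ ≤ _ := by
        have := gcd_Y g n hg
        have := Jf_nonneg m
        gcongr

lemma triv_q (q : ℕ) (hq : 0 < q) (h : ℤ) (h0 : h ≠ 0) (F : Finset (ℤ × ℤ))
    (hF : ∀ w ∈ F, (-(q : ℤ) ≤ w.1 ∧ w.1 < q) ∧ (-(q : ℤ) ≤ w.2 ∧ w.2 < q) ∧ (q : ℤ) ∣ w.1 * w.2 - h) :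
    F.card ≤ 4 * q * h.natAbs := by
  classical
  have qz : (0 : ℤ) < q := by exact_mod_cast hq
  let I := F.image fun w : ℤ × ℤ => (w.1 % (q : ℤ), w.2 % (q : ℤ))
  have h1 : I.card ≤ q * (Int.gcd h q).divisors.card := by
    refine xy_count q hq h I ?_
    intro x hx
    obtain ⟨w, hw, rfl⟩ := mem_image.1 hx
    refine ⟨⟨Int.emod_nonneg _ qz.ne', Int.emod_lt_of_pos _ qz⟩, ⟨Int.emod_nonneg _ qz.ne', Int.emod_lt_of_pos _ qz⟩, ?_⟩
    have h5 : (w.1 % q) * (w.2 % q) ≡ w.1 * w.2 [ZMOD q] := (Int.mod_modEq _ _).mul (Int.mod_modEq _ _)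
    exact ((hF w hw).2.2.sub (Int.modEq_iff_dvd.1 h5)).trans (dvd_of_eq (by ring))
  have h2 : (Int.gcd h q).divisors.card ≤ h.natAbs :=
    (Nat.card_divisors_le_self _).trans (Nat.le_of_dvd (Int.natAbs_pos.2 h0) (by simp only [Int.gcd]; exact Nat.gcd_dvd_left _ _))
  have h3 : F.card ≤ (I ×ˢ (univ : Finset (Bool × Bool))).card := by
    refine card_le_card_of_injOn (fun w : ℤ × ℤ => ((w.1 % (q : ℤ), w.2 % (q : ℤ)), (decide (0 ≤ w.1), decide (0 ≤ w.2)))) ?_ ?_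
    · intro w hw
      exact mem_coe.2 (mem_product.2 ⟨mem_image_of_mem (fun w : ℤ × ℤ => (w.1 % (q : ℤ), w.2 % (q : ℤ))) (mem_coe.1 hw), mem_univ _⟩)
    · intro w hw w' hw' he
      simp only [Prod.mk.injEq, decide_eq_decide] at he
      obtain ⟨⟨e1, e2⟩, e3, e4⟩ := he
      obtain ⟨a1, a2, _⟩ := hF w hw
      obtain ⟨b1, b2, _⟩ := hF w' hw'
      have key : ∀ x y : ℤ, (-(q : ℤ) ≤ x ∧ x < q) → (-(q : ℤ) ≤ y ∧ y < q) → x % q = y % q → (0 ≤ x ↔ 0 ≤ y) → x = y := by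
        intro x y hx hy hm hs
        have hd : (q : ℤ) ∣ x - y := Int.ModEq.dvd hm.symm
        have : x - y = 0 := Int.eq_zero_of_abs_lt_dvd hd (by rw [abs_lt]; constructor <;> by_cases 0 ≤ x <;> grind)
        omega
      exact Prod.ext (key _ _ a1 b1 e1 e3) (key _ _ a2 b2 e2 e4)
  rw [card_product] at h3
  have h4 : (univ : Finset (Bool × Bool)).card = 4 := by decide
  rw [h4] at h3
  calc F.card ≤ I.card * 4 := h3
    _ ≤ (q * h.natAbs) * 4 := Nat.mul_le_mul_right _ (h1.trans (Nat.mul_le_mul_left _ h2))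
    _ = _ := by ring

open Classical in
/-- the off-diagonal count for one pair -/
lemma off_sum {a a2 : ℕ} {c d c2 d2 : ℤ} (h1 : Adm a c d) (h2 : Adm a2 c2 d2) (ha8 : 8 ≤ a) (hne : a ≠ a2)
    (X W : ℕ) (hX : (a * a2) ^ 2 ≤ X) (hW : 3 * (a * a2) ^ 8 ≤ W) (F : Finset (ℕ × (ℤ × ℤ)))
    (hF : ∀ w ∈ F, 0 < w.1 ∧ w.1 ≤ X ∧ (-(w.1 : ℤ) ≤ w.2.1 ∧ w.2.1 < w.1) ∧ (-(w.1 : ℤ) ≤ w.2.2 ∧ w.2.2 < w.1) ∧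
      ∃ p, OffD a a2 c d c2 d2 p w.1 w.2.1 w.2.2) :
    (F.card : ℝ) ≤ 296 * X ^ 2 / (a * a2) * ((a.gcd a2).divisors.card ^ 4 * Yf ((a : ℤ) - a2).natAbs) * (Jf a * Jf a2) +
      4 * X * ((a : ℤ) - a2).natAbs * ((Ioc 0 X).filter fun q => Exc W q).card := by
  set h : ℤ := (a : ℤ) - a2 with hh
  set n := h.natAbs with hn
  have hapos : 0 < a := by omega
  have ha2pos : 0 < a2 := Nat.pos_of_ne_zero h2.1.ne_zero
  have h0 : h ≠ 0 := sub_ne_zero.2 (by exact_mod_cast hne)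
  obtain ⟨g, a', b, hg, hab, ha, ha2⟩ := Nat.exists_coprime' (m := a) (n := a2) (Nat.gcd_pos_of_pos_left _ hapos)
  have hgg : a.gcd a2 = g := by
    rw [ha, ha2, Nat.gcd_mul_right, hab.gcd_eq_one, one_mul]
  rw [mul_comm] at ha ha2
  obtain ⟨κ, hκ⟩ := fixed_q h1 h2 ha ha2 hab ha8
  have hsq1 := h1.1; have hsq2 := h2.1
  rw [ha] at hsq1; rw [ha2] at hsq2
  obtain ⟨cga, _, sa'⟩ := Nat.squarefree_mul_iff.1 hsq1
  obtain ⟨cgb, _, sb⟩ := Nat.squarefree_mul_iff.1 hsq2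
  have hgn : g ∣ n := by
    rw [hn, ← Int.natCast_dvd]
    rw [hh, ha, ha2]; push_cast
    exact ⟨(a' : ℤ) - b, by ring⟩
  have hcop : IsCoprime h ((a' * b : ℕ) : ℤ) := by
    have hg' : h = g * ((a' : ℤ) - b) := by rw [hh, ha, ha2]; push_cast; ring
    have i1 := Nat.isCoprime_iff_coprime.2 cga
    have i2 := Nat.isCoprime_iff_coprime.2 cgb
    have i3 := Nat.isCoprime_iff_coprime.2 hab
    rw [hg']; push_cast
    refine IsCoprime.mul_left (i1.mul_right i2) (IsCoprime.mul_right ?_ ?_)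
    · have : IsCoprime (-(b : ℤ) + a' * 1) (a' : ℤ) := (IsCoprime.add_mul_left_left_iff).2 i3.symm.neg_left
      rwa [show -(b : ℤ) + a' * 1 = a' - b by ring] at this
    · have : IsCoprime ((a' : ℤ) + b * (-1)) (b : ℤ) := (IsCoprime.add_mul_left_left_iff).2 i3
      rwa [show (a' : ℤ) + b * (-1) = a' - b by ring] at this
  have hn_le : n ≤ a * a2 := by
    have : a ≤ a * a2 := Nat.le_mul_of_pos_right _ ha2pos
    have : a2 ≤ a * a2 := Nat.le_mul_of_pos_left _ hapos
    omega
  have hab_le : a' * b ≤ a * a2 := Nat.mul_le_mul (by rw [ha]; exact Nat.le_mul_of_pos_left _ hg) (by rw [ha2]; exact Nat.le_mul_of_pos_left _ hg)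
  have hws := w_sum g a' b n X h κ hn hg.ne' hgn (Int.natAbs_ne_zero.2 h0) (Nat.squarefree_mul_iff.2 ⟨hab, sa', sb⟩) hcop
    ((Nat.mul_le_mul hn_le hab_le).trans (by rw [← sq]; exact hX))
  have hJ : Jf (a' * b) ≤ Jf a * Jf a2 := (Jf_mul _ _).trans (mul_le_mul (Jf_mono ⟨g, by rw [ha]; ring⟩ hapos.ne')
    (Jf_mono ⟨g, by rw [ha2]; ring⟩ ha2pos.ne') (Jf_nonneg _) (Jf_nonneg _))
  have aap : (0 : ℝ) < (a : ℝ) * a2 := by positivity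
  let w : ℕ → ℝ := fun q => (g.gcd q : ℝ) * (Int.gcd h q).divisors.card ^ 2 *
      (Int.gcd (h + κ * q ^ 2) (a' * b : ℕ)).divisors.card
  have hfib : ∀ q ∈ Ioc 0 X, ((F.filter fun x => x.1 = q).card : ℝ) ≤ 148 * X / (a * a2) * g.divisors.card * w q +
      (if Exc W q then (4 * X * n : ℝ) else 0) := by
    intro q hq
    obtain ⟨hq0, hqX⟩ := mem_Ioc.1 hq
    have hqX' : (q : ℝ) ≤ X := by exact_mod_cast hqX
    set Fq := (F.filter fun x => x.1 = q).image Prod.snd with hFq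
    have hcard : (F.filter fun x => x.1 = q).card = Fq.card := (card_image_of_injOn (by
      intro x hx y hy hxy
      exact Prod.ext ((mem_filter.1 hx).2.trans (mem_filter.1 hy).2.symm) hxy)).symm
    have hFq' : ∀ x ∈ Fq, (-(q : ℤ) ≤ x.1 ∧ x.1 < q) ∧ (-(q : ℤ) ≤ x.2 ∧ x.2 < q) ∧
      ∃ p, OffD a a2 c d c2 d2 p q x.1 x.2 := by
      intro x hx
      obtain ⟨y, hy, rfl⟩ := mem_image.1 hx
      obtain ⟨hy1, rfl⟩ := mem_filter.1 hy
      exact (hF y hy1).2.2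
    have w0 : 0 ≤ w q := by positivity
    rw [hcard]
    by_cases hE : Exc W q
    · rw [if_pos hE]
      have := triv_q q hq0 h h0 Fq (fun x hx => by
        obtain ⟨u1, u2, p, hp⟩ := hFq' x hx
        exact ⟨u1, u2, ⟨-p, by rw [hh, ← hp.1]; ring⟩⟩)
      have h3 : (Fq.card : ℝ) ≤ 4 * q * n := by exact_mod_cast this
      have h4 : (4 * q * n : ℝ) ≤ 4 * X * n := by gcongr
      have : 0 ≤ 148 * X / (a * a2 : ℝ) * g.divisors.card * w q := by positivity
      linarith
    · rw [if_neg hE, add_zero]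
      simp only [Exc, not_forall] at hE
      obtain ⟨l, hl, hWl, hlq, hlq2⟩ := hE
      have := hκ l q hl hq0 hlq hlq2 (hW.trans hWl) hne Fq hFq'
      refine this.trans ?_
      calc _ = 148 * q / (a * a2) * g.divisors.card * w q := by simp only [w]; ring
        _ ≤ _ := by gcongr
  calc (F.card : ℝ) = ∑ q ∈ Ioc 0 X, ((F.filter fun x => x.1 = q).card : ℝ) := by
        rw [card_eq_sum_card_fiberwise (f := Prod.fst) (t := Ioc 0 X)]
        · push_cast; rfl
        · intro x hx; exact mem_coe.2 (mem_Ioc.2 ⟨(hF x hx).1, (hF x hx).2.1⟩)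
    _ ≤ ∑ q ∈ Ioc 0 X, (148 * X / (a * a2) * g.divisors.card * w q +
      (if Exc W q then (4 * X * n : ℝ) else 0)) := sum_le_sum hfib
    _ = 148 * X / (a * a2) * g.divisors.card * ∑ q ∈ Ioc 0 X, w q +
        4 * X * n * ((Ioc 0 X).filter fun q => Exc W q).card := by
        rw [sum_add_distrib, ← mul_sum, ← sum_filter, sum_const, nsmul_eq_mul]; ring
    _ ≤ 148 * X / (a * a2) * g.divisors.card * (2 * X * ((g.divisors.card : ℝ) ^ 3 * Yf n) * (Jf a * Jf a2)) +
        4 * X * n * ((Ioc 0 X).filter fun q => Exc W q).card := by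
        have := Yf_nonneg n
        have h5 := hws.trans (mul_le_mul_of_nonneg_left hJ (by positivity))
        gcongr
    _ = _ := by rw [hgg]; ring

lemma tau_small (m K : ℕ) (hm : 1 ≤ m) (hK : 1 ≤ K) : ∃ C : ℕ, 1 ≤ C ∧ ∀ S : ℕ, 1 ≤ S → ∀ k : ℕ, 1 ≤ k → k ≤ K * S ^ 4 →
    k.divisors.card ^ m ≤ C * S := by
  obtain ⟨C, hC, h⟩ := tau_bound (m * 4) (by omega)
  refine ⟨C * K, Nat.mul_pos hC hK, fun S hS k hk hkS => ?_⟩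
  have h1 := h k hk
  rw [pow_mul] at h1
  refine le_of_pow_le_pow_left₀ (n := 4) (by norm_num) (by positivity) (h1.trans ?_)
  calc C * k ≤ C * (K * S ^ 4) := by gcongr
    _ = (C * K) * S ^ 4 := by ring
    _ ≤ (C * K) ^ 4 * S ^ 4 := by gcongr; exact Nat.le_self_pow (by norm_num) _
    _ = _ := by ring

lemma tau_sum_sq (m : ℕ) : ∃ C : ℝ, 0 ≤ C ∧ ∀ A : Finset ℕ, ∑ k ∈ A, (k.divisors.card : ℝ) ^ m / (k : ℝ) ^ 2 ≤ C := by
  obtain ⟨C, hC, h⟩ := tau_bound ((m + 1) * 2) (by omega)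
  have hs : Summable fun k : ℕ => Real.sqrt C * (1 / (k : ℝ) ^ (3 / 2 : ℝ)) :=
    (Real.summable_one_div_nat_rpow.2 (by norm_num)).mul_left _
  refine ⟨∑' k : ℕ, Real.sqrt C * (1 / (k : ℝ) ^ (3 / 2 : ℝ)), tsum_nonneg fun _ => by positivity, fun A => ?_⟩
  refine le_trans (sum_le_sum fun k _ => ?_) (hs.sum_le_tsum A fun _ _ => by positivity)
  rcases Nat.eq_zero_or_pos k with rfl | hk
  · simp
  have k0 : (0 : ℝ) < k := by exact_mod_cast hk
  have h1 : ((k.divisors.card : ℝ) ^ (m + 1)) ^ 2 ≤ C * k := by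
    rw [← pow_mul]; exact_mod_cast h k hk
  have h2 : (k.divisors.card : ℝ) ^ (m + 1) ≤ Real.sqrt (C * k) := Real.le_sqrt_of_sq_le h1
  have h4 : (1 : ℝ) ≤ k.divisors.card := by
    have : 1 ≤ k.divisors.card := card_pos.2 ⟨1, Nat.one_mem_divisors.2 hk.ne'⟩
    exact_mod_cast this
  have h3 : (k.divisors.card : ℝ) ^ m ≤ (k.divisors.card : ℝ) ^ (m + 1) := pow_le_pow_right₀ h4 (by omega)
  rw [Real.sqrt_mul (by positivity), Real.sqrt_eq_rpow (k : ℝ)] at h2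
  have h5 : (k : ℝ) ^ 2 = (k : ℝ) ^ (1 / 2 : ℝ) * (k : ℝ) ^ (3 / 2 : ℝ) := by
    rw [← Real.rpow_add k0, ← Real.rpow_natCast]; norm_num
  rw [div_le_iff₀ (by positivity), h5]
  have h6 : (k : ℝ) ^ (3 / 2 : ℝ) ≠ 0 := by positivity
  calc _ ≤ _ := h3.trans h2
    _ = _ := by field_simp

lemma tau_sum_log (m K : ℕ) (hm : 1 ≤ m) (hK : 1 ≤ K) : ∃ C : ℝ, 0 ≤ C ∧ ∀ S : ℕ, 1 ≤ S →
    ∑ k ∈ Ioc 0 (K * S ^ 4), (k.divisors.card : ℝ) ^ m / k ≤ C * S ^ 2 := by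
  obtain ⟨C, hC, h⟩ := tau_small m K hm hK
  refine ⟨C * (5 + K), by positivity, fun S hS => ?_⟩
  have S1 : (1 : ℝ) ≤ S := by exact_mod_cast hS
  have K1 : (1 : ℝ) ≤ K := by exact_mod_cast hK
  calc _ ≤ ∑ k ∈ Ioc 0 (K * S ^ 4), (C * S : ℝ) * (1 / k) := by
        refine sum_le_sum fun k hk => ?_
        obtain ⟨h1, h2⟩ := mem_Ioc.1 hk
        have : (k.divisors.card : ℝ) ^ m ≤ C * S := by exact_mod_cast h S hS k h1 h2
        rw [mul_one_div]; gcongr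
    _ = C * S * ∑ k ∈ Ioc 0 (K * S ^ 4), (1 : ℝ) / k := by rw [mul_sum]
    _ ≤ C * S * (1 + Real.log ((K * S ^ 4 : ℕ) : ℝ)) := by gcongr; exact sum_inv_le_log _
    _ ≤ C * S * ((5 + K) * S) := by
        gcongr
        push_cast
        rw [Real.log_mul (by positivity) (by positivity), Real.log_pow]
        have := Real.log_le_sub_one_of_pos (x := K) (by linarith)
        have := Real.log_le_sub_one_of_pos (x := S) (by linarith)
        push_cast
        nlinarith
    _ = _ := by ring

open Classical in
lemma avg_row (m K : ℕ) (hm : 1 ≤ m) (hK : 1 ≤ K) : ∃ C : ℝ, 0 ≤ C ∧ ∀ S : ℕ, 1 ≤ S → ∀ α β t b : ℤ, α.natAbs = m →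
    ∑ l ∈ Ico b (b + (S ^ 2 : ℕ)), ∑ k ∈ (Ioc 0 (K * S ^ 4)).filter (fun k : ℕ => Squarefree k ∧ (k : ℤ) ∣ α * l ^ 2 + β * l + t),
      (k.divisors.card : ℝ) ^ 9 / k ≤ C * S ^ 2 := by
  obtain ⟨C1, h1, hC1⟩ := tau_sum_sq 10
  obtain ⟨C2, h2, hC2⟩ := tau_sum_log 10 K (by norm_num) hK
  refine ⟨m * C1 + C2, by positivity, fun S hS α β t b hα => ?_⟩
  simp only [sum_filter]
  rw [sum_comm]
  have key : ∀ k ∈ Ioc 0 (K * S ^ 4), ∑ l ∈ Ico b (b + (S ^ 2 : ℕ)), (if Squarefree k ∧ (k : ℤ) ∣ α * l ^ 2 + β * l + t then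
      (k.divisors.card : ℝ) ^ 9 / k else 0) ≤ (m * S ^ 2 * ((k.divisors.card : ℝ) ^ 10 / (k : ℝ) ^ 2) + (k.divisors.card : ℝ) ^ 10 / k) := by
        intro k hk
        by_cases hs : Squarefree k
        · simp only [hs, true_and]
          rw [← sum_filter, sum_const, nsmul_eq_mul]
          have := root_count k hs α β t m hm (fun x hx => by
            rw [← hα, Int.natCast_natAbs]
            rcases abs_choice α with h | h <;> rw [h]
            · exact hx
            · rw [neg_mul]; exact hx.neg_right) ((Ico b (b + (S ^ 2 : ℕ))).filter fun l => (k : ℤ) ∣ α * l ^ 2 + β * l + t)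
              b (S ^ 2) (fun x hx => mem_Ico.1 (mem_filter.1 hx).1) (fun x hx => (mem_filter.1 hx).2)
          calc _ ≤ _ := mul_le_mul_of_nonneg_right this (by positivity)
            _ = _ := by push_cast; ring
        · simp only [hs, false_and, if_false, sum_const_zero]; positivity
  refine (sum_le_sum key).trans ?_
  calc _ = m * S ^ 2 * ∑ k ∈ Ioc 0 (K * S ^ 4), (k.divisors.card : ℝ) ^ 10 / (k : ℝ) ^ 2 +
        ∑ k ∈ Ioc 0 (K * S ^ 4), (k.divisors.card : ℝ) ^ 10 / k := by rw [sum_add_distrib, ← mul_sum]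
    _ ≤ m * S ^ 2 * C1 + C2 * S ^ 2 := by
        have := hC1 (Ioc 0 (K * S ^ 4)); have := hC2 S hS
        gcongr
    _ = _ := by ring

lemma Yf_sq (n : ℕ) (hn : n ≠ 0) : Yf n ^ 2 ≤ ∑ m ∈ n.divisors, (m.divisors.card : ℝ) ^ 6 / m := by
  classical
  unfold Yf
  rw [sq, sum_mul_sum, ← sum_product']
  have hmap : ∀ p ∈ n.divisors ×ˢ n.divisors, Nat.lcm p.1 p.2 ∈ n.divisors := by
    intro p hp
    obtain ⟨h1, h2⟩ := mem_product.1 hp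
    exact Nat.mem_divisors.2 ⟨Nat.lcm_dvd (Nat.dvd_of_mem_divisors h1) (Nat.dvd_of_mem_divisors h2), hn⟩
  rw [← sum_fiberwise_of_maps_to hmap]
  refine sum_le_sum fun m hm => ?_
  have m0 := Nat.pos_of_mem_divisors hm
  have m0' : (0 : ℝ) < m := by exact_mod_cast m0
  calc _ ≤ ∑ p ∈ m.divisors ×ˢ m.divisors, (m.divisors.card : ℝ) ^ 4 / m := by
        refine (sum_le_sum fun p hp => ?_).trans (sum_le_sum_of_subset_of_nonneg ?_ fun _ _ _ => by positivity)
        · obtain ⟨h1, h2⟩ := mem_filter.1 hp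
          obtain ⟨h3, h4⟩ := mem_product.1 h1
          have i0 := Nat.pos_of_mem_divisors h3
          have j0 := Nat.pos_of_mem_divisors h4
          have hle : (m : ℝ) ≤ p.1 * p.2 := by
            have := Nat.le_of_dvd (Nat.mul_pos i0 j0) (Nat.lcm_dvd_mul p.1 p.2)
            rw [h2] at this; exact_mod_cast this
          have t1 := tau_mono (h2 ▸ Nat.dvd_lcm_left p.1 p.2) m0.ne'
          have t2 := tau_mono (h2 ▸ Nat.dvd_lcm_right p.1 p.2) m0.ne'
          rw [div_mul_div_comm]
          calc (p.1.divisors.card : ℝ) ^ 2 * (p.2.divisors.card : ℝ) ^ 2 / (p.1 * p.2) ≤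
              (m.divisors.card : ℝ) ^ 2 * (m.divisors.card : ℝ) ^ 2 / m := by gcongr
            _ = _ := by ring
        · intro p hp
          obtain ⟨h1, h2⟩ := mem_filter.1 hp
          exact mem_product.2 ⟨Nat.mem_divisors.2 ⟨h2 ▸ Nat.dvd_lcm_left p.1 p.2, m0.ne'⟩,
            Nat.mem_divisors.2 ⟨h2 ▸ Nat.dvd_lcm_right p.1 p.2, m0.ne'⟩⟩
    _ = _ := by rw [sum_const, card_product, nsmul_eq_mul]; push_cast; ring

open Classical in
lemma sqf_part : ∃ C : ℝ, 0 ≤ C ∧ ∀ n : ℕ, n ≠ 0 → ∑ m ∈ n.divisors, (m.divisors.card : ℝ) ^ 6 / m ≤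
    C * ∑ k ∈ n.divisors.filter Squarefree, (k.divisors.card : ℝ) ^ 9 / k := by
  obtain ⟨C, hC, h⟩ := tau_sum_sq 12
  refine ⟨C, hC, fun n hn => ?_⟩
  choose f g hfg hsf using Nat.sq_mul_squarefree
  let W : ℕ × ℕ → ℝ := fun p => (p.1.divisors.card : ℝ) ^ 9 / p.1 * ((p.2.divisors.card : ℝ) ^ 12 / (p.2 : ℝ) ^ 2)
  have inj : Set.InjOn (fun i => (f i, g i)) (n.divisors : Set ℕ) := by
    intro i hi j hj hij
    simp only [Prod.mk.injEq] at hij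
    rw [← hfg i, ← hfg j, hij.1, hij.2]
  have step : ∀ m ∈ n.divisors, (m.divisors.card : ℝ) ^ 6 / m ≤ W (f m, g m) := by
    intro m hm
    have m0 := Nat.pos_of_mem_divisors hm
    have e := hfg m
    have f0 : 0 < f m := Nat.pos_of_ne_zero (hsf m).ne_zero
    have g0 : 0 < g m := Nat.pos_of_ne_zero (by intro h0; rw [h0] at e; simp at e; omega)
    have h1 : m.divisors.card ≤ (g m).divisors.card ^ 2 * (f m).divisors.card := by
      calc m.divisors.card = (g m ^ 2 * f m).divisors.card := by rw [e]
        _ ≤ (g m ^ 2).divisors.card * (f m).divisors.card := tau_mul _ _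
        _ ≤ _ := by gcongr; rw [sq, sq]; exact tau_mul _ _
    have h2 : (m.divisors.card : ℝ) ≤ ((g m).divisors.card : ℝ) ^ 2 * (f m).divisors.card := by exact_mod_cast h1
    have h3 : (m : ℝ) = (g m : ℝ) ^ 2 * f m := by exact_mod_cast e.symm
    have f0' : (0 : ℝ) < f m := by exact_mod_cast f0
    have g0' : (0 : ℝ) < g m := by exact_mod_cast g0
    have h4 : (1 : ℝ) ≤ (f m).divisors.card := by
      have : 1 ≤ (f m).divisors.card := card_pos.2 ⟨1, Nat.one_mem_divisors.2 f0.ne'⟩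
      exact_mod_cast this
    simp only [W]
    rw [h3]
    calc _ ≤ (((g m).divisors.card : ℝ) ^ 2 * (f m).divisors.card) ^ 6 / ((g m : ℝ) ^ 2 * f m) := by gcongr
      _ = ((f m).divisors.card : ℝ) ^ 6 / f m * (((g m).divisors.card : ℝ) ^ 12 / (g m : ℝ) ^ 2) := by
        rw [div_mul_div_comm]; ring_nf
      _ ≤ _ := by
        gcongr ?_ / _ * _
        exact pow_le_pow_right₀ h4 (by norm_num)
  calc _ ≤ ∑ m ∈ n.divisors, W (f m, g m) := sum_le_sum step
    _ = ∑ p ∈ n.divisors.image (fun i => (f i, g i)), W p := (sum_image inj).symm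
    _ ≤ ∑ p ∈ (n.divisors.filter Squarefree) ×ˢ (Ioc 0 n), W p := by
        refine sum_le_sum_of_subset_of_nonneg ?_ fun _ _ _ => by positivity
        intro p hp
        obtain ⟨m, hm, rfl⟩ := mem_image.1 hp
        have e := hfg m
        have hmn := Nat.dvd_of_mem_divisors hm
        have m0 := Nat.pos_of_mem_divisors hm
        have g0 : 0 < g m := Nat.pos_of_ne_zero (by intro h0; rw [h0] at e; simp at e; omega)
        refine mem_product.2 ⟨mem_filter.2 ⟨Nat.mem_divisors.2 ⟨(Dvd.intro_left _ e).trans hmn, hn⟩, hsf m⟩, mem_Ioc.2 ⟨g0, ?_⟩⟩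
        refine Nat.le_of_dvd (Nat.pos_of_ne_zero hn) (Dvd.dvd.trans ⟨g m * f m, ?_⟩ hmn)
        rw [← mul_assoc, ← sq]; exact e.symm
    _ = (∑ k ∈ n.divisors.filter Squarefree, (k.divisors.card : ℝ) ^ 9 / k) * ∑ k ∈ Ioc 0 n, (k.divisors.card : ℝ) ^ 12 / (k : ℝ) ^ 2 := by
        rw [sum_product, sum_mul_sum]
    _ ≤ _ := by
        rw [mul_comm]
        exact mul_le_mul_of_nonneg_right (h _) (sum_nonneg fun _ _ => by positivity)

lemma int_hα {α : ℤ} {m : ℕ} (hα : α.natAbs = m) (k : ℕ) (x : ℤ) (hx : (k : ℤ) ∣ α * x) : (k : ℤ) ∣ m * x := by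
  rw [← hα, Int.natCast_natAbs]
  rcases abs_choice α with h | h <;> rw [h]
  · exact hx
  · rw [neg_mul]; exact hx.neg_right

lemma pair_row (m K : ℕ) (hm : 1 ≤ m) (hK : 1 ≤ K) (C0 : ℝ) (hC0 : 0 ≤ C0) : ∃ C : ℝ, 0 ≤ C ∧ ∀ S : ℕ, 1 ≤ S →
    ∀ α β t b : ℤ, α.natAbs = m → ∀ a : ℕ, Squarefree a → a ≤ K * S ^ 4 →
    ∑ d ∈ a.divisors, (d.divisors.card : ℝ) ^ 9 / d ≤ C0 → ∀ (L : Finset ℤ) (fa : ℤ → ℕ),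
    (∀ l ∈ L, b ≤ l ∧ l < b + (S ^ 2 : ℕ) ∧ (fa l : ℤ) = α * l ^ 2 + β * l + t ∧ fa l ≤ K * S ^ 4 ∧ fa l ≠ a) →
    ∑ l ∈ L, ((a.gcd (fa l)).divisors.card : ℝ) ^ 4 * Yf ((a : ℤ) - fa l).natAbs ≤ C * S ^ 2 := by
  classical
  obtain ⟨C1, h1, H1⟩ := avg_row m K hm hK
  obtain ⟨C2, h2, H2⟩ := sqf_part
  obtain ⟨C3, h3, H3⟩ := tau_small 10 K (by norm_num) hK
  refine ⟨m * C0 + C3 + C2 * C1, by positivity, fun S hS α β t b hα a ha haK hG L fa hL => ?_⟩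
  have a0 : a ≠ 0 := ha.ne_zero
  have S1 : (1 : ℝ) ≤ S := by exact_mod_cast hS
  have A : ∑ l ∈ L, ((a.gcd (fa l)).divisors.card : ℝ) ^ 8 ≤ (m * C0 + C3) * S ^ 2 := by
    have s1 : ∀ l ∈ L, ((a.gcd (fa l)).divisors.card : ℝ) ^ 8 ≤
        ∑ d ∈ a.divisors, if d ∣ fa l then (d.divisors.card : ℝ) ^ 8 else 0 := by
      intro l hl
      rw [← sum_filter]
      refine single_le_sum (f := fun d : ℕ => (d.divisors.card : ℝ) ^ 8) (fun _ _ => by positivity) ?_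
      exact mem_filter.2 ⟨Nat.mem_divisors.2 ⟨Nat.gcd_dvd_left _ _, a0⟩, Nat.gcd_dvd_right _ _⟩
    refine (sum_le_sum s1).trans ?_
    rw [sum_comm]
    have s2 : ∀ d ∈ a.divisors, (∑ l ∈ L, if d ∣ fa l then (d.divisors.card : ℝ) ^ 8 else 0) ≤
        m * S ^ 2 * ((d.divisors.card : ℝ) ^ 9 / d) + (a.divisors.card : ℝ) ^ 9 := by
      intro d hd
      rw [← sum_filter, sum_const, nsmul_eq_mul]
      have hda := Nat.dvd_of_mem_divisors hd
      have := root_count d (ha.squarefree_of_dvd hda) α β t m hm (int_hα hα d) (L.filter fun l => d ∣ fa l) b (S ^ 2)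
        (fun x hx => ⟨(hL x (mem_filter.1 hx).1).1, (hL x (mem_filter.1 hx).1).2.1⟩)
        (fun x hx => by rw [← (hL x (mem_filter.1 hx).1).2.2.1]; exact_mod_cast (mem_filter.1 hx).2)
      have t1 : (d.divisors.card : ℝ) ≤ a.divisors.card := by exact_mod_cast tau_mono hda a0
      calc _ ≤ _ := mul_le_mul_of_nonneg_right this (by positivity)
        _ = m * S ^ 2 * ((d.divisors.card : ℝ) ^ 9 / d) + (d.divisors.card : ℝ) ^ 9 := by push_cast; ring
        _ ≤ _ := by gcongr
    refine (sum_le_sum s2).trans ?_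
    rw [sum_add_distrib, ← mul_sum, sum_const, nsmul_eq_mul]
    have t2 : (a.divisors.card : ℝ) * (a.divisors.card : ℝ) ^ 9 ≤ C3 * S := by
      have := H3 S hS a (Nat.pos_of_ne_zero a0) haK
      rw [← pow_succ']; exact_mod_cast this
    calc _ ≤ m * S ^ 2 * C0 + C3 * S := by gcongr
      _ ≤ m * S ^ 2 * C0 + C3 * S ^ 2 := by
        have : (S : ℝ) ≤ S ^ 2 := by nlinarith
        gcongr
      _ = _ := by ring
  have B : ∑ l ∈ L, Yf ((a : ℤ) - fa l).natAbs ^ 2 ≤ C2 * C1 * S ^ 2 := by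
    have s1 : ∀ l ∈ L, Yf ((a : ℤ) - fa l).natAbs ^ 2 ≤ C2 * ∑ k ∈ (Ioc 0 (K * S ^ 4)).filter
        (fun k : ℕ => Squarefree k ∧ (k : ℤ) ∣ α * l ^ 2 + β * l + (t - a)), (k.divisors.card : ℝ) ^ 9 / k := by
      intro l hl
      obtain ⟨l1, l2, l3, l4, l5⟩ := hL l hl
      have hn : ((a : ℤ) - fa l).natAbs ≠ 0 := by omega
      refine (Yf_sq _ hn).trans ((H2 _ hn).trans ?_)
      refine mul_le_mul_of_nonneg_left (sum_le_sum_of_subset_of_nonneg ?_ fun _ _ _ => by positivity) h2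
      intro k hk
      obtain ⟨k1, k2⟩ := mem_filter.1 hk
      have k3 := Nat.dvd_of_mem_divisors k1
      have k4 := Nat.le_of_dvd (by omega) k3
      refine mem_filter.2 ⟨mem_Ioc.2 ⟨Nat.pos_of_mem_divisors k1, k4.trans (by omega)⟩, k2, ?_⟩
      have : (k : ℤ) ∣ (a : ℤ) - fa l := Int.natCast_dvd.2 k3
      rw [show α * l ^ 2 + β * l + (t - a) = -((a : ℤ) - fa l) by rw [l3]; ring]
      exact this.neg_right
    refine (sum_le_sum s1).trans ?_
    rw [← mul_sum, mul_assoc]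
    refine mul_le_mul_of_nonneg_left (le_trans ?_ (H1 S hS α β (t - a) b hα)) h2
    refine sum_le_sum_of_subset_of_nonneg ?_ fun _ _ _ => sum_nonneg fun _ _ => by positivity
    intro l hl
    exact mem_Ico.2 ⟨(hL l hl).1, (hL l hl).2.1⟩
  calc _ ≤ ∑ l ∈ L, (((a.gcd (fa l)).divisors.card : ℝ) ^ 8 + Yf ((a : ℤ) - fa l).natAbs ^ 2) := by
        refine sum_le_sum fun l _ => ?_
        generalize ((a.gcd (fa l)).divisors.card : ℝ) = x
        generalize Yf ((a : ℤ) - fa l).natAbs = y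
        nlinarith [sq_nonneg (x ^ 4 - y), sq_nonneg (x ^ 4), sq_nonneg y]
    _ ≤ _ := by rw [sum_add_distrib]; linarith

lemma box2 (P X : ℕ) (T : ℝ) (hT : 0 ≤ T) (hP : 1 ≤ P) : ∑ w ∈ Ioc P X, (T / w + 1) ^ 2 ≤ T ^ 2 / P + 2 * T * (1 + Real.log X) + X := by
  have lg : 0 ≤ Real.log X := Real.log_natCast_nonneg _
  rcases le_total X P with h | h
  · rw [Ioc_eq_empty (by omega)]; simp only [sum_empty]; positivity
  have h1 := sum_Ioc_inv_sq_le_sub (α := ℝ) (k := P) (n := X) (by omega) h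
  have h2 : ∑ w ∈ Ioc P X, (1 : ℝ) / w ≤ 1 + Real.log X :=
    (sum_le_sum_of_subset_of_nonneg (Ioc_subset_Ioc_left (Nat.zero_le _)) fun _ _ _ => by positivity).trans (sum_inv_le_log X)
  have h3 : ((Ioc P X).card : ℝ) ≤ X := by rw [Nat.card_Ioc]; exact_mod_cast Nat.sub_le _ _
  calc ∑ w ∈ Ioc P X, (T / w + 1) ^ 2 = T ^ 2 * ∑ w ∈ Ioc P X, ((w : ℝ) ^ 2)⁻¹ + 2 * T * ∑ w ∈ Ioc P X, (1 : ℝ) / w + (Ioc P X).card := by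
        rw [mul_sum, mul_sum, ← sum_add_distrib, card_eq_sum_ones, Nat.cast_sum, ← sum_add_distrib]
        refine sum_congr rfl fun w _ => ?_
        push_cast; ring
    _ ≤ T ^ 2 * (P : ℝ)⁻¹ + 2 * T * (1 + Real.log X) + X := by
        have : (0 : ℝ) ≤ (X : ℝ)⁻¹ := by positivity
        gcongr; linarith
    _ = _ := by rw [div_eq_mul_inv]

lemma dvd_cnt (b : ℤ) (M w : ℕ) (hw : 0 < w) : (((Ioc b (b + M)).filter fun x : ℤ => (w : ℤ) ∣ x).card : ℝ) ≤ M / w + 1 := by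
  refine card_class' _ (b + 1) M w hw (fun x hx => ?_) (fun x hx y hy => dvd_sub (mem_filter.1 hx).2 (mem_filter.1 hy).2)
  have := mem_Ioc.1 (mem_filter.1 hx).1
  omega

open Classical in
lemma xy_mass (A B : ℤ) (a M : ℕ) (ha : a ≠ 0) (hA : IsCoprime A (a : ℤ)) (hs : ∑ p ∈ a.primeFactors, (1 : ℝ) / p ≤ 1 / 10)
    (hM : 10 + 2 * Real.log M + a ≤ M / 20) :
    (M : ℝ) ^ 2 / 10 ≤ ((Ioc (20 * M : ℤ) (20 * M + M) ×ˢ Ioc (0 : ℤ) (0 + M)).filter fun w : ℤ × ℤ =>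
      IsCoprime w.1 w.2 ∧ IsCoprime (A * w.1 + B * w.2) (a : ℤ)).card := by
  set P := Ioc (20 * M : ℤ) (20 * M + M) ×ˢ Ioc (0 : ℤ) (0 + M) with hP
  have lg : 0 ≤ Real.log M := Real.log_natCast_nonneg _
  have hPc : (P.card : ℝ) = M ^ 2 := by
    rw [hP, card_product]; simp [sq]
  set U1 := ((Ioc 0 M).filter Nat.Prime).biUnion fun w : ℕ => P.filter fun v : ℤ × ℤ => (w : ℤ) ∣ v.1 ∧ (w : ℤ) ∣ v.2 with hU1
  set U2 := (a.primeFactors).biUnion fun w : ℕ => P.filter fun v : ℤ × ℤ => (w : ℤ) ∣ A * v.1 + B * v.2 with hU2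
  have cover : P ⊆ (P.filter fun w : ℤ × ℤ => IsCoprime w.1 w.2 ∧ IsCoprime (A * w.1 + B * w.2) (a : ℤ)) ∪ (U1 ∪ U2) := by
    intro v hv
    by_cases h1 : IsCoprime v.1 v.2
    · by_cases h2 : IsCoprime (A * v.1 + B * v.2) (a : ℤ)
      · exact mem_union_left _ (mem_filter.2 ⟨hv, h1, h2⟩)
      · refine mem_union_right _ (mem_union_right _ ?_)
        rw [Int.isCoprime_iff_gcd_eq_one] at h2
        obtain ⟨p, hp, hp2⟩ := Nat.exists_prime_and_dvd h2
        have p1 : (p : ℤ) ∣ A * v.1 + B * v.2 := (Int.natCast_dvd_natCast.2 hp2).trans (Int.gcd_dvd_left ..)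
        have p2 : (p : ℤ) ∣ a := (Int.natCast_dvd_natCast.2 hp2).trans (Int.gcd_dvd_right ..)
        exact mem_biUnion.2 ⟨p, Nat.mem_primeFactors.2 ⟨hp, by exact_mod_cast p2, ha⟩, mem_filter.2 ⟨hv, p1⟩⟩
    · refine mem_union_right _ (mem_union_left _ ?_)
      rw [Int.isCoprime_iff_gcd_eq_one] at h1
      obtain ⟨p, hp, hp2⟩ := Nat.exists_prime_and_dvd h1
      have p1 : (p : ℤ) ∣ v.1 := (Int.natCast_dvd_natCast.2 hp2).trans (Int.gcd_dvd_left ..)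
      have p2 : (p : ℤ) ∣ v.2 := (Int.natCast_dvd_natCast.2 hp2).trans (Int.gcd_dvd_right ..)
      have hv2 := mem_Ioc.1 (mem_product.1 hv).2
      have := Int.le_of_dvd hv2.1 p2
      refine mem_biUnion.2 ⟨p, mem_filter.2 ⟨mem_Ioc.2 ⟨hp.pos, by omega⟩, hp⟩, mem_filter.2 ⟨hv, p1, p2⟩⟩
  have c1 : (U1.card : ℝ) ≤ M ^ 2 * (1 / 4 + 1 / 9 + 1 / 4) + M * (5 / 3) + 2 + 2 * M * (1 + Real.log M) + M := by
    have step : ∀ w ∈ (Ioc 0 M).filter Nat.Prime, ((P.filter fun v : ℤ × ℤ => (w : ℤ) ∣ v.1 ∧ (w : ℤ) ∣ v.2).card : ℝ) ≤ ((M : ℝ) / w + 1) ^ 2 := by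
      intro w hw
      have w0 := (mem_Ioc.1 (mem_filter.1 hw).1).1
      rw [hP, filter_product (fun x : ℤ => (w : ℤ) ∣ x) (fun x : ℤ => (w : ℤ) ∣ x), card_product, Nat.cast_mul, sq]
      exact mul_le_mul (dvd_cnt _ _ _ w0) (dvd_cnt _ _ _ w0) (by positivity) (by positivity)
    calc (U1.card : ℝ) ≤ ∑ w ∈ (Ioc 0 M).filter Nat.Prime, ((P.filter fun v : ℤ × ℤ => (w : ℤ) ∣ v.1 ∧ (w : ℤ) ∣ v.2).card : ℝ) := by
          exact_mod_cast card_biUnion_le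
      _ ≤ ∑ w ∈ (Ioc 0 M).filter Nat.Prime, ((M : ℝ) / w + 1) ^ 2 := sum_le_sum step
      _ ≤ ∑ w ∈ ({2, 3} : Finset ℕ) ∪ Ioc 4 M, ((M : ℝ) / w + 1) ^ 2 := by
          refine sum_le_sum_of_subset_of_nonneg ?_ fun _ _ _ => by positivity
          intro w hw
          obtain ⟨h1, h2⟩ := mem_filter.1 hw
          have h3 := h2.two_le
          have h4 : w ≠ 4 := by rintro rfl; norm_num at h2
          simp only [mem_Ioc, mem_union, mem_insert, mem_singleton] at h1 ⊢
          omega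
      _ ≤ ∑ w ∈ ({2, 3} : Finset ℕ), ((M : ℝ) / w + 1) ^ 2 + ∑ w ∈ Ioc 4 M, ((M : ℝ) / w + 1) ^ 2 := by
          rw [← sum_union_inter]; have : 0 ≤ ∑ w ∈ ({2, 3} : Finset ℕ) ∩ Ioc 4 M, ((M : ℝ) / w + 1) ^ 2 := sum_nonneg fun _ _ => by positivity
          linarith
      _ ≤ _ := by
          have := box2 4 M M (by positivity) (by norm_num)
          rw [sum_pair (by norm_num)]
          push_cast at this ⊢
          nlinarith
  have c2 : (U2.card : ℝ) ≤ M * (M * (1 / 10) + a) := by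
    have step : ∀ w ∈ a.primeFactors, ((P.filter fun v : ℤ × ℤ => (w : ℤ) ∣ A * v.1 + B * v.2).card : ℝ) ≤ M * (M / w + 1) := by
      intro w hw
      have hwp := Nat.prime_of_mem_primeFactors hw
      have hwa := Nat.dvd_of_mem_primeFactors hw
      have hcop : IsCoprime (w : ℤ) A := (hA.of_isCoprime_of_dvd_right (Int.natCast_dvd_natCast.2 hwa)).symm
      have := card_le_mul_card_image_of_maps_to (s := P.filter fun v : ℤ × ℤ => (w : ℤ) ∣ A * v.1 + B * v.2) (t := Ioc (0 : ℤ) (0 + M)) (f := Prod.snd)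
        (fun v hv => (mem_product.1 (mem_filter.1 hv).1).2) ((M - 1) / w + 1) ?_
      · have h2 : (((M - 1) / w + 1 : ℕ) : ℝ) ≤ M / w + 1 := by
          push_cast
          refine add_le_add (Nat.cast_div_le.trans ?_) le_rfl
          gcongr; omega
        calc _ ≤ ((((M - 1) / w + 1) * (Ioc (0 : ℤ) (0 + M)).card : ℕ) : ℝ) := by exact_mod_cast this
          _ = (((M - 1) / w + 1 : ℕ) : ℝ) * M := by rw [Nat.cast_mul]; simp
          _ ≤ _ := by rw [mul_comm]; gcongr
      · intro y hy
        have inj : Set.InjOn Prod.fst (((P.filter fun v : ℤ × ℤ => (w : ℤ) ∣ A * v.1 + B * v.2).filter fun v => v.2 = y : Finset (ℤ × ℤ)) : Set (ℤ × ℤ)) := by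
          intro v hv v' hv' h
          have e1 := (mem_filter.1 hv).2
          have e2 := (mem_filter.1 hv').2
          exact Prod.ext h (e1.trans e2.symm)
        rw [← card_image_of_injOn inj]
        refine card_class _ (20 * M + 1) M w hwp.pos ?_ ?_
        · intro x hx
          obtain ⟨v, hv, rfl⟩ := mem_image.1 hx
          have := mem_Ioc.1 (mem_product.1 (mem_filter.1 (mem_filter.1 hv).1).1).1
          omega
        · intro x hx x' hx'
          obtain ⟨v, hv, rfl⟩ := mem_image.1 hx
          obtain ⟨v', hv', rfl⟩ := mem_image.1 hx'
          obtain ⟨f1, f2⟩ := mem_filter.1 hv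
          obtain ⟨g1, g2⟩ := mem_filter.1 hv'
          have := dvd_sub (mem_filter.1 f1).2 (mem_filter.1 g1).2
          rw [f2, g2] at this
          exact hcop.dvd_of_dvd_mul_left (this.trans (dvd_of_eq (by ring)))
    have h3 : ((a.primeFactors).card : ℝ) ≤ a := by
      have h : a.primeFactors ⊆ Ioc 0 a := fun p hp => mem_Ioc.2 ⟨(Nat.prime_of_mem_primeFactors hp).pos, Nat.le_of_mem_primeFactors hp⟩
      have := card_le_card h
      rw [Nat.card_Ioc] at this
      exact_mod_cast this
    calc (U2.card : ℝ) ≤ ∑ w ∈ a.primeFactors, ((P.filter fun v : ℤ × ℤ => (w : ℤ) ∣ A * v.1 + B * v.2).card : ℝ) := by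
          exact_mod_cast card_biUnion_le
      _ ≤ ∑ w ∈ a.primeFactors, (M : ℝ) * (M / w + 1) := sum_le_sum step
      _ = M * (M * (∑ w ∈ a.primeFactors, (1 : ℝ) / w) + (a.primeFactors).card) := by
          rw [← mul_sum, sum_add_distrib, mul_sum]; simp [div_eq_mul_inv]
      _ ≤ _ := by gcongr
  have tot : (P.card : ℝ) ≤ ((P.filter fun w : ℤ × ℤ => IsCoprime w.1 w.2 ∧ IsCoprime (A * w.1 + B * w.2) (a : ℤ)).card : ℝ) + (U1.card + U2.card) := by
    have := (card_le_card cover).trans (card_union_le _ _)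
    have h2 := card_union_le U1 U2
    exact_mod_cast this.trans (by omega)
  have M1 : (1 : ℝ) ≤ M := by
    have : (0 : ℝ) ≤ a := by positivity
    linarith
  have : (M : ℝ) * (10 + 2 * Real.log M + a) ≤ M * (M / 20) := by gcongr
  rw [hPc] at tot
  nlinarith

def Par (D : ℕ) (u0 : ℤ) : Prop := 0 < D ∧ 0 ≤ u0 ∧ u0 ≤ D ∧ ∀ p : ℕ, p.Prime → ((p ∣ D ↔ p ≤ 200) ∧ (p ∣ D → ¬ (p : ℤ) ∣ 8 * u0 ^ 2 + 4 * u0 + 23))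

lemma par_exists : ∃ (D : ℕ) (u0 : ℤ), Par D u0 := by
  have p23 : Nat.Prime 23 := by norm_num
  obtain ⟨Q, hQ⟩ : ∃ Q, Q = ∏ p ∈ ((range 201).filter Nat.Prime).erase 23, p := ⟨_, rfl⟩
  have Q0 : 0 < Q := hQ ▸ prod_pos fun p hp => (mem_filter.1 (mem_of_mem_erase hp)).2.pos
  have hpQ : ∀ p : ℕ, p.Prime → (p ∣ Q ↔ p ≠ 23 ∧ p ≤ 200) := by
    intro p hp
    rw [hQ, hp.prime.dvd_finsetProd_iff]
    constructor
    · rintro ⟨q, hq, hpq⟩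
      have h := mem_filter.1 (mem_of_mem_erase hq)
      have := (Nat.prime_dvd_prime_iff_eq hp h.2).1 hpq
      subst this
      exact ⟨ne_of_mem_erase hq, by have := mem_range.1 h.1; omega⟩
    · rintro ⟨h1, h2⟩
      exact ⟨p, mem_erase.2 ⟨h1, mem_filter.2 ⟨mem_range.2 (by omega), hp⟩⟩, dvd_rfl⟩
  clear hQ
  have Q23 : ¬ 23 ∣ Q := fun h => ((hpQ 23 p23).1 h).1 rfl
  obtain ⟨w, hw1, hw2, hw3⟩ : ∃ w : ℤ, 0 ≤ w ∧ w ≤ 2 ∧ ¬ (23 : ℤ) ∣ 8 * (Q * w) ^ 2 + 4 * (Q * w) + 23 := by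
    have pz : Prime (23 : ℤ) := by exact_mod_cast Nat.prime_iff_prime_int.1 p23
    have key : ∀ x : ℤ, (23 : ℤ) ∣ 8 * x ^ 2 + 4 * x + 23 → 23 ∣ x ∨ 23 ∣ 2 * x + 1 := by
      intro x hx
      have h1 : (23 : ℤ) ∣ 4 * (x * (2 * x + 1)) := by
        have := dvd_sub hx (dvd_refl 23); exact this.trans (dvd_of_eq (by ring))
      rcases pz.dvd_or_dvd h1 with h | h
      · norm_num at h
      · exact pz.dvd_or_dvd h
    by_cases h : (23 : ℤ) ∣ 8 * (Q * 1) ^ 2 + 4 * (Q * 1) + 23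
    · refine ⟨2, by norm_num, le_rfl, fun h' => ?_⟩
      rcases key _ h with h1 | h1 <;> rcases key _ h' with h2 | h2 <;> omega
    · exact ⟨1, by norm_num, by norm_num, h⟩
  refine ⟨23 * Q, Q * w, by positivity, by positivity, by push_cast; nlinarith, fun p hp => ⟨?_, fun hpD => ?_⟩⟩
  · rw [hp.dvd_mul, hpQ p hp, Nat.prime_dvd_prime_iff_eq hp p23]
    constructor
    · rintro (h | h) <;> omega
    · intro h; by_cases h' : p = 23 <;> tauto
  · by_cases h' : p = 23
    · subst h'; exact hw3
    · intro hd
      have h1 : (p : ℤ) ∣ Q := Int.natCast_dvd_natCast.2 ((hpQ p hp).2 ⟨h', by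
        rw [hp.dvd_mul, hpQ p hp, Nat.prime_dvd_prime_iff_eq hp p23] at hpD; omega⟩)
      have h2 : (p : ℤ) ∣ 23 := by
        have h3 : (p : ℤ) ∣ Q * (8 * Q * w ^ 2 + 4 * w) := h1.mul_right _
        exact (dvd_sub hd h3).trans (dvd_of_eq (by ring))
      have h3 : p ∣ 23 := by exact_mod_cast h2
      exact h' ((Nat.prime_dvd_prime_iff_eq hp p23).1 h3)

def gU (D : ℕ) (u0 : ℤ) (e : ℤ × ℤ) : ℤ := u0 + D * e.1
def gV (D : ℕ) (e : ℤ × ℤ) : ℤ := -1 - D * e.2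
def gA (D : ℕ) (u0 : ℤ) (e : ℤ × ℤ) : ℤ := 8 * gU D u0 e ^ 2 - 4 * gU D u0 e * gV D e + 13 * gV D e ^ 2 + 10
noncomputable def gBox (T : ℕ) : Finset (ℤ × ℤ) := Ico (20 * T : ℤ) (20 * T + T) ×ˢ Ico (20 * T : ℤ) (20 * T + T)

lemma gA_bounds {D T : ℕ} {u0 : ℤ} (h : Par D u0) (hT : 0 < T) {e : ℤ × ℤ} (he : e ∈ gBox T) :
    10000 * ((D : ℤ) * T) ^ 2 ≤ gA D u0 e ∧ gA D u0 e ≤ 14000 * ((D : ℤ) * T) ^ 2 ∧ 20 * ((D : ℤ) * T) ≤ gU D u0 e ∧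
    gU D u0 e ≤ 22 * ((D : ℤ) * T) ∧ 20 * ((D : ℤ) * T) ≤ - gV D e ∧ -gV D e ≤ 22 * ((D : ℤ) * T) := by
  obtain ⟨h0, h1, h2, -⟩ := h
  obtain ⟨k, l⟩ := e
  obtain ⟨hk, hl⟩ := mem_product.1 he
  simp only [mem_Ico] at hk hl
  have D0 : (1 : ℤ) ≤ D := by exact_mod_cast h0
  have T0 : (1 : ℤ) ≤ T := by exact_mod_cast hT
  have DT : (1 : ℤ) ≤ D * T := by nlinarith
  have hk1 : (D : ℤ) * (20 * T) ≤ D * k := by nlinarith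
  have hk2 : (D : ℤ) * k + D ≤ D * (21 * T) := by nlinarith
  have hl1 : (D : ℤ) * (20 * T) ≤ D * l := by nlinarith
  have hl2 : (D : ℤ) * l + D ≤ D * (21 * T) := by nlinarith
  simp only [gA, gU, gV]
  set m : ℤ := D * T with hm
  have hu1 : 20 * m ≤ u0 + D * k := by linarith
  have hu2 : u0 + D * k ≤ 21 * m := by linarith
  have hv1 : 20 * m ≤ 1 + D * l := by linarith
  have hv2 : 1 + D * l ≤ 21 * m := by linarith
  generalize u0 + D * k = u at *
  rw [show -1 - (D : ℤ) * l = -(1 + D * l) by ring]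
  generalize 1 + (D : ℤ) * l = v at *
  refine ⟨by nlinarith, ?_, by linarith, by linarith, by linarith, by linarith⟩
  have a1 : u ^ 2 ≤ 441 * m ^ 2 := by nlinarith
  have a2 : v ^ 2 ≤ 441 * m ^ 2 := by nlinarith
  have a3 : u * v ≤ 441 * m ^ 2 := by nlinarith
  nlinarith

lemma par_gt {D : ℕ} {u0 : ℤ} (h : Par D u0) {e : ℤ × ℤ} {p : ℕ} (hp : p.Prime) (hpa : (p : ℤ) ∣ gA D u0 e) : 200 < p := by
  obtain ⟨-, -, -, h⟩ := h
  by_contra hc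
  have hD : p ∣ D := (h p hp).1.2 (by omega)
  refine (h p hp).2 hD ?_
  have h3 : (p : ℤ) ∣ D * (e.1 * (8 * (2 * u0 + D * e.1) + 4) + 4 * (gU D u0 e) * e.2 + 13 * e.2 * (2 + D * e.2)) :=
    (Int.natCast_dvd_natCast.2 hD).mul_right _
  refine (dvd_sub hpa h3).trans (dvd_of_eq ?_)
  simp only [gA, gU, gV]; ring

lemma par_cop {D : ℕ} {u0 : ℤ} (h : Par D u0) {p : ℕ} (hp : p.Prime) (hp2 : 200 < p) (n : ℕ) (hn : 0 < n) (hn2 : n ≤ 200) (i : ℕ) :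
    IsCoprime (p : ℤ) (n * (D : ℤ) ^ i) := by
  obtain ⟨-, -, -, h⟩ := h
  have h1 : Nat.Coprime p D := (Nat.Prime.coprime_iff_not_dvd hp).2 fun hd => by have := (h p hp).1.1 hd; omega
  have h2 : Nat.Coprime p n := (Nat.Prime.coprime_iff_not_dvd hp).2 fun hd => by have := Nat.le_of_dvd hn hd; omega
  exact IsCoprime.mul_right (Nat.isCoprime_iff_coprime.2 h2) ((Nat.isCoprime_iff_coprime.2 h1).pow_right)

lemma fib_real (F : Finset (ℤ × ℤ)) (Ks : Finset ℤ) (n κ : ℝ) (hmap : ∀ w ∈ F, w.1 ∈ Ks) (hK : (Ks.card : ℝ) ≤ κ) (hn : 0 ≤ n)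
    (h : ∀ k ∈ Ks, ∀ L : Finset ℤ, (∀ l ∈ L, (k, l) ∈ F) → (L.card : ℝ) ≤ n) : (F.card : ℝ) ≤ κ * n := by
  classical
  rw [card_eq_sum_card_fiberwise hmap, Nat.cast_sum]
  calc _ ≤ ∑ k ∈ Ks, n := by
        refine sum_le_sum fun k hk => ?_
        have inj : Set.InjOn Prod.snd ((F.filter fun w => w.1 = k : Finset (ℤ × ℤ)) : Set (ℤ × ℤ)) := by
          intro v hv v' hv' e
          exact Prod.ext ((mem_filter.1 hv).2.trans (mem_filter.1 hv').2.symm) e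
        rw [← card_image_of_injOn inj]
        refine h k hk _ fun l hl => ?_
        obtain ⟨⟨x, y⟩, hv, rfl⟩ := mem_image.1 hl
        obtain ⟨h1, h2⟩ := mem_filter.1 hv
        simp only at h2
        subst h2; exact h1
    _ = Ks.card * n := by simp
    _ ≤ _ := by gcongr

lemma quad_cnt {p : ℕ} (hp : p.Prime) (α β t : ℤ) (hα : IsCoprime (p : ℤ) α) (S : Finset ℤ) (b : ℤ) (T : ℕ)
    (hb : ∀ x ∈ S, b ≤ x ∧ x < b + T) (hS : ∀ x ∈ S, (p : ℤ) ∣ α * x ^ 2 + β * x + t) : (S.card : ℝ) ≤ 2 * ((T : ℝ) / p + 1) := by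
  have := root_count p hp.squarefree α β t 1 one_pos (fun x hx => by rw [Nat.cast_one, one_mul]; exact hα.dvd_of_dvd_mul_left hx) S b T hb hS
  rw [hp.divisors, card_pair hp.one_lt.ne] at this
  simpa using this

lemma lin_cnt {p : ℕ} (hp : 0 < p) (α : ℤ) (hα : IsCoprime (p : ℤ) α) (S : Finset ℤ) (b : ℤ) (T : ℕ)
    (hb : ∀ x ∈ S, b ≤ x ∧ x < b + T) (β : ℤ) (hS : ∀ x ∈ S, (p : ℤ) ∣ α * x + β) : (S.card : ℝ) ≤ (T : ℝ) / p + 1 := by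
  refine card_class' S b T p hp hb fun x hx y hy => hα.dvd_of_dvd_mul_left ?_
  exact (dvd_sub (hS x hx) (hS y hy)).trans (dvd_of_eq (by ring))

open Classical in
lemma bad1 {D T p : ℕ} {u0 : ℤ} (h : Par D u0) (hp : p.Prime) (hp2 : 200 < p) :
    (((gBox T).filter fun e : ℤ × ℤ => (p : ℤ) ∣ gU D u0 e + gV D e ∧ ((p : ℤ) ∣ gU D u0 e ∨ (p : ℤ) ∣ 25 * gU D u0 e ^ 2 + 10)).card : ℝ) ≤
      3 * ((T : ℝ) / p + 1) ^ 2 := by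
  set I := Ico (20 * T : ℤ) (20 * T + T) with hI
  have c1 : ((I.filter fun k : ℤ => (p : ℤ) ∣ D * k + u0).card : ℝ) ≤ (T : ℝ) / p + 1 :=
    lin_cnt hp.pos D (by simpa using par_cop h hp hp2 1 one_pos (by norm_num) 1) _ (20 * T) T (fun x hx => mem_Ico.1 (mem_filter.1 hx).1) u0
      fun x hx => (mem_filter.1 hx).2
  have c2 : ((I.filter fun k : ℤ => (p : ℤ) ∣ (25 * D ^ 2) * k ^ 2 + (50 * u0 * D) * k + (25 * u0 ^ 2 + 10)).card : ℝ) ≤ 2 * ((T : ℝ) / p + 1) :=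
    quad_cnt hp _ _ _ (by exact_mod_cast par_cop h hp hp2 25 (by norm_num) (by norm_num) 2) _ (20 * T) T (fun x hx => mem_Ico.1 (mem_filter.1 hx).1)
      fun x hx => (mem_filter.1 hx).2
  rw [show 3 * ((T : ℝ) / p + 1) ^ 2 = ((T : ℝ) / p + 1 + 2 * ((T : ℝ) / p + 1)) * ((T : ℝ) / p + 1) by ring]
  refine fib_real _ (I.filter (fun k : ℤ => (p : ℤ) ∣ D * k + u0) ∪ I.filter fun k : ℤ => (p : ℤ) ∣ (25 * D ^ 2) * k ^ 2 + (50 * u0 * D) * k + (25 * u0 ^ 2 + 10)) _ _ ?_ ?_ (by positivity) ?_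
  · rintro ⟨k, l⟩ he
    obtain ⟨h1, -, h2⟩ := mem_filter.1 he
    have h3 := (mem_product.1 h1).1
    rcases h2 with h2 | h2
    · exact mem_union_left _ (mem_filter.2 ⟨h3, h2.trans (dvd_of_eq (by simp only [gU]; ring))⟩)
    · exact mem_union_right _ (mem_filter.2 ⟨h3, h2.trans (dvd_of_eq (by simp only [gU]; ring))⟩)
  · refine le_trans ?_ (add_le_add c1 c2)
    exact_mod_cast card_union_le _ _
  · intro k _ L hL
    refine lin_cnt hp.pos D (by simpa using par_cop h hp hp2 1 one_pos (by norm_num) 1) L (20 * T) T (fun x hx => ?_) (1 - u0 - D * k) fun x hx => ?_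
    · exact mem_Ico.1 (mem_product.1 (mem_filter.1 (hL x hx)).1).2
    · have := (mem_filter.1 (hL x hx)).2.1
      exact (this.neg_right).trans (dvd_of_eq (by simp only [gU, gV]; ring))

open Classical in
lemma bad2s {D T p : ℕ} {u0 : ℤ} (h : Par D u0) (hp : p.Prime) (hp2 : 200 < p) :
    (((gBox T).filter fun e : ℤ × ℤ => (p : ℤ) ∣ gA D u0 e ∧ (p : ℤ) ∣ 26 * gV D e - 4 * gU D u0 e).card : ℝ) ≤
      2 * ((T : ℝ) / p + 1) ^ 2 := by
  set I := Ico (20 * T : ℤ) (20 * T + T) with hI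
  have c2 : ((I.filter fun k : ℤ => (p : ℤ) ∣ (10 * D ^ 2) * k ^ 2 + (20 * u0 * D) * k + (10 * u0 ^ 2 + 13)).card : ℝ) ≤ 2 * ((T : ℝ) / p + 1) :=
    quad_cnt hp _ _ _ (by exact_mod_cast par_cop h hp hp2 10 (by norm_num) (by norm_num) 2) _ (20 * T) T (fun x hx => mem_Ico.1 (mem_filter.1 hx).1)
      fun x hx => (mem_filter.1 hx).2
  rw [show 2 * ((T : ℝ) / p + 1) ^ 2 = (2 * ((T : ℝ) / p + 1)) * ((T : ℝ) / p + 1) by ring]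
  refine fib_real _ _ _ _ ?_ c2 (by positivity) ?_
  · rintro ⟨k, l⟩ he
    obtain ⟨h1, h2, h3⟩ := mem_filter.1 he
    refine mem_filter.2 ⟨(mem_product.1 h1).1, ?_⟩
    have h4 : (p : ℤ) ∣ 40 * ((10 * D ^ 2) * k ^ 2 + (20 * u0 * D) * k + (10 * u0 ^ 2 + 13)) := by
      refine (dvd_sub (h2.mul_left 52) (h3.mul_left (26 * gV D (k, l) - 4 * gU D u0 (k, l)))).trans (dvd_of_eq ?_)
      simp only [gA, gU, gV]; ring
    exact (by simpa using par_cop h hp hp2 40 (by norm_num) (by norm_num) 0 : IsCoprime (p : ℤ) 40).dvd_of_dvd_mul_left h4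
  · intro k _ L hL
    refine lin_cnt hp.pos (26 * D) (by simpa using par_cop h hp hp2 26 (by norm_num) (by norm_num) 1) L (20 * T) T (fun x hx => ?_) (26 + 4 * (u0 + D * k)) fun x hx => ?_
    · exact mem_Ico.1 (mem_product.1 (mem_filter.1 (hL x hx)).1).2
    · have := (mem_filter.1 (hL x hx)).2.2
      exact (this.neg_right).trans (dvd_of_eq (by simp only [gU, gV]; ring))

open Classical in
lemma bad2n {D T p : ℕ} {u0 : ℤ} (h : Par D u0) (hp : p.Prime) (hp2 : 200 < p) :
    (((gBox T).filter fun e : ℤ × ℤ => (p : ℤ) ^ 2 ∣ gA D u0 e ∧ ¬ (p : ℤ) ∣ 26 * gV D e - 4 * gU D u0 e).card : ℝ) ≤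
      T * (2 * ((T : ℝ) / (p : ℝ) ^ 2 + 1)) := by
  refine fib_real _ (Ico (20 * T : ℤ) (20 * T + T)) _ _ (fun w hw => (mem_product.1 (mem_filter.1 hw).1).1) (by simp) (by positivity) ?_
  intro k _ L hL
  rcases L.eq_empty_or_nonempty with rfl | ⟨l0, hl0⟩
  · simp; positivity
  have pz : Prime (p : ℤ) := Nat.prime_iff_prime_int.1 hp
  have hb : ∀ x ∈ L, (20 * T : ℤ) ≤ x ∧ x < 20 * T + T := fun x hx => mem_Ico.1 (mem_product.1 (mem_filter.1 (hL x hx)).1).2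
  have cop : IsCoprime ((p ^ 2 : ℕ) : ℤ) (13 * D) := by
    have := par_cop h hp hp2 13 (by norm_num) (by norm_num) 1
    rw [pow_one] at this
    push_cast
    exact this.pow_left
  have copD : IsCoprime ((p ^ 2 : ℕ) : ℤ) D := cop.of_mul_right_right
  have cover : L ⊆ (L.filter fun l : ℤ => ((p ^ 2 : ℕ) : ℤ) ∣ D * l + (-(D * l0))) ∪ L.filter fun l : ℤ => ((p ^ 2 : ℕ) : ℤ) ∣ (13 * D) * l + (26 + 13 * D * l0 + 4 * (u0 + D * k)) := by
    intro l hl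
    have h1 := (mem_filter.1 (hL l hl)).2
    have h0 := (mem_filter.1 (hL l0 hl0)).2
    have hprod : (p : ℤ) ^ 2 ∣ (D * l + (-(D * l0))) * ((13 * D) * l + (26 + 13 * D * l0 + 4 * (u0 + D * k))) := by
      refine (dvd_sub h1.1 h0.1).trans (dvd_of_eq ?_)
      simp only [gA, gU, gV]; ring
    rw [mem_union, mem_filter, mem_filter]
    push_cast
    by_cases hp1 : (p : ℤ) ∣ D * l + (-(D * l0))
    · left
      refine ⟨hl, ?_⟩
      refine pz.pow_dvd_of_dvd_mul_right 2 (fun h2 => h1.2 ?_) hprod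
      refine (dvd_sub (hp1.mul_left (-13)) h2).trans (dvd_of_eq ?_)
      simp only [gU, gV]; ring
    · right
      exact ⟨hl, pz.pow_dvd_of_dvd_mul_left 2 hp1 hprod⟩
  have c1 := lin_cnt (p := p ^ 2) (by positivity) D copD (L.filter fun l : ℤ => ((p ^ 2 : ℕ) : ℤ) ∣ D * l + (-(D * l0))) (20 * T) T (fun x hx => hb x (mem_filter.1 hx).1) _ fun x hx => (mem_filter.1 hx).2
  have c2 := lin_cnt (p := p ^ 2) (by positivity) (13 * D) cop (L.filter fun l : ℤ => ((p ^ 2 : ℕ) : ℤ) ∣ (13 * D) * l + (26 + 13 * D * l0 + 4 * (u0 + D * k))) (20 * T) T (fun x hx => hb x (mem_filter.1 hx).1) _ fun x hx => (mem_filter.1 hx).2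
  have := (card_le_card cover).trans (card_union_le _ _)
  have h3 := (Nat.cast_le (α := ℝ)).2 this
  rw [Nat.cast_add] at h3
  have h4 : ((p ^ 2 : ℕ) : ℝ) = (p : ℝ) ^ 2 := by push_cast; rfl
  rw [h4] at c1 c2
  linarith

open Classical in
lemma pa_cnt {D T p : ℕ} {u0 : ℤ} (h : Par D u0) (hp : p.Prime) (hp2 : 200 < p) :
    (((gBox T).filter fun e : ℤ × ℤ => (p : ℤ) ∣ gA D u0 e).card : ℝ) ≤ T * (2 * ((T : ℝ) / p + 1)) := by
  refine fib_real _ (Ico (20 * T : ℤ) (20 * T + T)) _ _ (fun w hw => (mem_product.1 (mem_filter.1 hw).1).1) (by simp) (by positivity) ?_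
  intro k _ L hL
  refine quad_cnt hp (13 * D ^ 2) (26 * D + 4 * (u0 + D * k) * D) (8 * (u0 + D * k) ^ 2 + 4 * (u0 + D * k) + 23)
    (by exact_mod_cast par_cop h hp hp2 13 (by norm_num) (by norm_num) 2) L (20 * T) T (fun x hx => ?_) fun x hx => ?_
  · exact mem_Ico.1 (mem_product.1 (mem_filter.1 (hL x hx)).1).2
  · exact ((mem_filter.1 (hL x hx)).2).trans (dvd_of_eq (by simp only [gA, gU, gV]; ring))

lemma ev_small (ε : ℝ) (hε : 0 < ε) : ∃ X0 : ℕ, ∀ n : ℕ, X0 ≤ n → Real.log n ≤ ε * n ∧ (Nat.primeCounting n : ℝ) ≤ ε * n := by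
  have h1 : ∀ᶠ x : ℝ in Filter.atTop, Real.log x ≤ ε * x := by
    filter_upwards [Real.isLittleO_log_id_atTop.bound hε, Filter.eventually_ge_atTop 1] with x hx hx1
    rw [Real.norm_of_nonneg (Real.log_nonneg hx1), id, Real.norm_of_nonneg (by linarith)] at hx
    exact hx
  have h2 : ∀ᶠ x : ℝ in Filter.atTop, (Nat.primeCounting ⌊x⌋₊ : ℝ) ≤ ε * x := by
    filter_upwards [Chebyshev.eventually_primeCounting_le one_pos, Filter.eventually_ge_atTop 2,
      Real.tendsto_log_atTop.eventually_ge_atTop ((Real.log 4 + 1) / ε)] with x hx hx2 hx3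
    refine hx.trans ?_
    have l0 : 0 < Real.log x := Real.log_pos (by linarith)
    rw [div_le_iff₀ l0]
    rw [div_le_iff₀ hε] at hx3
    nlinarith
  have h3 := (h1.and h2)
  have h4 := tendsto_natCast_atTop_atTop (R := ℝ) |>.eventually h3
  obtain ⟨X0, h⟩ := Filter.eventually_atTop.1 h4
  exact ⟨X0, fun n hn => by have := h n hn; rwa [Nat.floor_natCast] at this⟩

lemma ev_T (D : ℕ) (hD : 0 < D) : ∃ T0 : ℕ, 1 ≤ T0 ∧ ∀ T : ℕ, T0 ≤ T →
    31 + 246 * (D : ℝ) + 50 * Real.log (120 * (D * T) : ℕ) + 2 * (Nat.primeCounting (120 * (D * T)) : ℝ) ≤ T / 10 := by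
  obtain ⟨X0, h⟩ := ev_small (1 / (120 * D * 10000)) (by positivity)
  have hD1 : (1 : ℝ) ≤ D := by exact_mod_cast hD
  refine ⟨X0 + 100 * (31 + 246 * D), by omega, fun T hT => ?_⟩
  have hX : X0 ≤ 120 * (D * T) := by nlinarith
  obtain ⟨h1, h2⟩ := h _ hX
  have h3 : 1 / (120 * D * 10000) * ((120 * (D * T) : ℕ) : ℝ) = T / 10000 := by
    push_cast; field_simp
  rw [h3] at h1 h2
  have h4 : (X0 : ℝ) + 100 * (31 + 246 * D) ≤ T := by exact_mod_cast hT
  have h5 : (0 : ℝ) ≤ X0 := by positivity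
  linarith

noncomputable def gN (D : ℕ) (u0 : ℤ) (e : ℤ × ℤ) : ℕ := (gA D u0 e).toNat

noncomputable def G9s (a : ℕ) : ℝ := ∑ d ∈ a.divisors, (d.divisors.card : ℝ) ^ 9 / d

def GoodE (D : ℕ) (u0 : ℤ) (C0 : ℝ) (e : ℤ × ℤ) : Prop :=
  IsCoprime (gU D u0 e) (gV D e) ∧ Squarefree (gN D u0 e) ∧ IsCoprime (2 * (gU D u0 e + gV D e)) (gN D u0 e : ℤ) ∧
  G9s (gN D u0 e) ≤ C0 ∧ ∑ p ∈ (gN D u0 e).primeFactors, (1 : ℝ) / p ≤ 1 / 10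

lemma gN_cast {D T : ℕ} {u0 : ℤ} (h : Par D u0) (hT : 0 < T) {e : ℤ × ℤ} (he : e ∈ gBox T) : (gN D u0 e : ℤ) = gA D u0 e ∧
    0 < gN D u0 e ∧ gN D u0 e ≤ 14000 * D ^ 2 * T ^ 2 ∧ 10000 * D ^ 2 * T ^ 2 ≤ gN D u0 e := by
  obtain ⟨h1, h2, -⟩ := gA_bounds h hT he
  have h3 : (0 : ℤ) < 10000 * ((D : ℤ) * T) ^ 2 := by have := h.1; positivity
  have h4 : (gN D u0 e : ℤ) = gA D u0 e := Int.toNat_of_nonneg (by linarith)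
  refine ⟨h4, by have : (0 : ℤ) < gN D u0 e := by linarith
                 exact_mod_cast this, ?_, ?_⟩
  · rw [← h4] at h2; have : (gN D u0 e : ℤ) ≤ 14000 * D ^ 2 * T ^ 2 := by linarith
    exact_mod_cast this
  · rw [← h4] at h1; have : 10000 * D ^ 2 * T ^ 2 ≤ (gN D u0 e : ℤ) := by linarith
    exact_mod_cast this

open Classical in
lemma bad4 {D : ℕ} {u0 : ℤ} (h : Par D u0) : ∃ C : ℝ, 0 ≤ C ∧ ∀ S : ℕ, 1 ≤ S →
    ∑ e ∈ (gBox (S ^ 2)).filter (fun e => Squarefree (gN D u0 e)), G9s (gN D u0 e) ≤ C * (S : ℝ) ^ 4 := by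
  obtain ⟨C, hC, H⟩ := avg_row (13 * D ^ 2) (14000 * D ^ 2) (Nat.succ_le_of_lt (by have := h.1; positivity)) (Nat.succ_le_of_lt (by have := h.1; positivity))
  refine ⟨C, hC, fun S hS => ?_⟩
  rw [sum_filter, gBox, sum_product]
  calc _ ≤ ∑ k ∈ Ico (20 * (S ^ 2 : ℕ) : ℤ) (20 * (S ^ 2 : ℕ) + (S ^ 2 : ℕ)), C * (S : ℝ) ^ 2 := by
        refine sum_le_sum fun k hk => ?_
        refine le_trans ?_ (H S hS (13 * D ^ 2) (26 * D + 4 * (u0 + D * k) * D) (8 * (u0 + D * k) ^ 2 + 4 * (u0 + D * k) + 23) (20 * (S ^ 2 : ℕ)) ?_)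
        · refine sum_le_sum fun l hl => ?_
          split_ifs with hsq
          · have he : (k, l) ∈ gBox (S ^ 2) := mem_product.2 ⟨hk, hl⟩
            obtain ⟨n1, n2, n3, -⟩ := gN_cast h (by positivity) he
            refine sum_le_sum_of_subset_of_nonneg ?_ fun _ _ _ => by positivity
            intro d hd
            have hda := Nat.dvd_of_mem_divisors hd
            refine mem_filter.2 ⟨mem_Ioc.2 ⟨Nat.pos_of_mem_divisors hd, (Nat.le_of_dvd n2 hda).trans (n3.trans (le_of_eq (by ring)))⟩, hsq.squarefree_of_dvd hda, ?_⟩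
            have := Int.natCast_dvd_natCast.2 hda
            rw [n1] at this
            exact this.trans (dvd_of_eq (by simp only [gA, gU, gV]; ring))
          · exact sum_nonneg fun _ _ => by positivity
        · rw [Int.natAbs_mul, Int.natAbs_pow, Int.natAbs_natCast]; rfl
    _ = _ := by rw [sum_const, Int.card_Ico, nsmul_eq_mul, add_sub_cancel_left, Int.toNat_natCast]; push_cast; ring

lemma inv_sq_tail (X : ℕ) : ∑ i ∈ Ioc 200 X, ((i : ℝ) ^ 2)⁻¹ ≤ 1 / 200 := by
  rcases le_total X 200 with h | h
  · rw [Ioc_eq_empty (by omega)]; norm_num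
  · have := sum_Ioc_inv_sq_le_sub (α := ℝ) (k := 200) (n := X) (by omega) h
    have h2 : (0 : ℝ) ≤ (X : ℝ)⁻¹ := by positivity
    have e : ((200 : ℕ) : ℝ)⁻¹ = 1 / 200 := by norm_num
    rw [e] at this
    linarith

open Classical in
lemma bad5 {D : ℕ} {u0 : ℤ} (h : Par D u0) (T : ℕ) (hT : 0 < T) :
    ∑ e ∈ gBox T, ∑ p ∈ (gN D u0 e).primeFactors, (1 : ℝ) / p ≤ 2 * T ^ 2 / 200 + 2 * T * (1 + Real.log (14000 * D ^ 2 * T ^ 2 : ℕ)) := by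
  set X := 14000 * D ^ 2 * T ^ 2 with hX
  have s1 : ∀ e ∈ gBox T, ∑ p ∈ (gN D u0 e).primeFactors, (1 : ℝ) / p ≤ ∑ p ∈ (Ioc 200 X).filter Nat.Prime, if (p : ℤ) ∣ gA D u0 e then (1 : ℝ) / p else 0 := by
    intro e he
    obtain ⟨n1, n2, n3, -⟩ := gN_cast h hT he
    rw [← sum_filter]
    refine sum_le_sum_of_subset_of_nonneg ?_ fun _ _ _ => by positivity
    intro p hp
    have hpp := Nat.prime_of_mem_primeFactors hp
    have hpa : (p : ℤ) ∣ gA D u0 e := by rw [← n1]; exact Int.natCast_dvd_natCast.2 (Nat.dvd_of_mem_primeFactors hp)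
    exact mem_filter.2 ⟨mem_filter.2 ⟨mem_Ioc.2 ⟨par_gt h hpp hpa, (Nat.le_of_mem_primeFactors hp).trans n3⟩, hpp⟩, hpa⟩
  refine (sum_le_sum s1).trans ?_
  rw [sum_comm]
  have s2 : ∀ p ∈ (Ioc 200 X).filter Nat.Prime, (∑ e ∈ gBox T, if (p : ℤ) ∣ gA D u0 e then (1 : ℝ) / p else 0) ≤ 2 * T ^ 2 * ((p : ℝ) ^ 2)⁻¹ + 2 * T * (1 / p) := by
    intro p hp
    obtain ⟨h1, h2⟩ := mem_filter.1 hp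
    rw [← sum_filter, sum_const, nsmul_eq_mul]
    calc _ ≤ (T * (2 * ((T : ℝ) / p + 1))) * (1 / p) := mul_le_mul_of_nonneg_right (pa_cnt h h2 (mem_Ioc.1 h1).1) (by positivity)
      _ = _ := by have : (p : ℝ) ≠ 0 := by exact_mod_cast h2.ne_zero
                  field_simp
  refine (sum_le_sum s2).trans ?_
  refine (sum_le_sum_of_subset_of_nonneg (filter_subset _ _) fun _ _ _ => by positivity).trans ?_
  rw [sum_add_distrib, ← mul_sum, ← mul_sum]
  have lg : 0 ≤ Real.log X := Real.log_natCast_nonneg _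
  refine add_le_add ?_ (mul_le_mul_of_nonneg_left ((sum_le_sum_of_subset_of_nonneg (Ioc_subset_Ioc_left (Nat.zero_le _)) fun _ _ _ => by positivity).trans (sum_inv_le_log X)) (by positivity))
  rw [mul_div_assoc]
  have := mul_le_mul_of_nonneg_left (inv_sq_tail X) (by positivity : (0 : ℝ) ≤ 2 * (T : ℝ) ^ 2)
  linarith

open Classical in
lemma mass_family {D : ℕ} {u0 : ℤ} (h : Par D u0) : ∃ C0 : ℝ, 1 ≤ C0 ∧ ∃ S0 : ℕ, 1 ≤ S0 ∧ ∀ S : ℕ, S0 ≤ S →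
    (S : ℝ) ^ 4 / 2 ≤ ((gBox (S ^ 2)).filter (GoodE D u0 C0)).card := by
  obtain ⟨C, hC, H4⟩ := bad4 h
  obtain ⟨T0, hT01, hT0⟩ := ev_T D h.1
  refine ⟨10 * C + 1, by linarith, T0, hT01, fun S hS => ?_⟩
  have hS1 : 1 ≤ S := hT01.trans hS
  have hD1 : (1 : ℝ) ≤ D := by exact_mod_cast h.1
  obtain ⟨T, hT⟩ : ∃ T, T = S ^ 2 := ⟨_, rfl⟩
  have hTS : T0 ≤ T := by rw [hT]; nlinarith
  have T1 : 0 < T := hT01.trans hTS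
  have hT1 : (1 : ℝ) ≤ T := by exact_mod_cast T1
  have hev := hT0 T hTS
  have hST : (S : ℝ) ^ 4 = (T : ℝ) ^ 2 := by rw [hT]; push_cast; ring
  have H4' := H4 S hS1
  rw [← hT, hST] at H4'
  rw [← hT, hST]
  set L := Real.log (120 * (D * T) : ℕ) with hL
  have hDT : (1 : ℝ) ≤ D * T := by nlinarith
  have lg1 : Real.log (2 * D * T : ℕ) ≤ L := Real.log_le_log (by push_cast; positivity) (by push_cast; nlinarith)
  have lg2 : Real.log (14000 * D ^ 2 * T ^ 2 : ℕ) ≤ 2 * L := by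
    rw [hL, ← Real.log_rpow (by push_cast; positivity)]
    refine Real.log_le_log (by push_cast; positivity) ?_
    rw [Real.rpow_two]; push_cast
    nlinarith [sq_nonneg ((D : ℝ) * T)]
  have Bc : ((gBox T).card : ℝ) = (T : ℝ) ^ 2 := by rw [gBox, card_product]; simp [sq]
  set Z0 := (gBox T).filter fun e => gU D u0 e + gV D e = 0 with hZ0
  set Z1 := ((Ioc 200 (2 * D * T)).filter Nat.Prime).biUnion fun p : ℕ => (gBox T).filter fun e : ℤ × ℤ => (p : ℤ) ∣ gU D u0 e + gV D e ∧ ((p : ℤ) ∣ gU D u0 e ∨ (p : ℤ) ∣ 25 * gU D u0 e ^ 2 + 10) with hZ1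
  set Z2 := ((Ioc 200 (120 * (D * T))).filter Nat.Prime).biUnion fun p : ℕ => (gBox T).filter fun e : ℤ × ℤ => (p : ℤ) ∣ gA D u0 e ∧ (p : ℤ) ∣ 26 * gV D e - 4 * gU D u0 e with hZ2
  set Z3 := ((Ioc 200 (120 * (D * T))).filter Nat.Prime).biUnion fun p : ℕ => (gBox T).filter fun e : ℤ × ℤ => (p : ℤ) ^ 2 ∣ gA D u0 e ∧ ¬ (p : ℤ) ∣ 26 * gV D e - 4 * gU D u0 e with hZ3
  set Z4 := ((gBox T).filter (fun e => Squarefree (gN D u0 e))).filter fun e => 10 * C + 1 < G9s (gN D u0 e) with hZ4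
  set Z5 := (gBox T).filter fun e => (1 : ℝ) / 10 < ∑ p ∈ (gN D u0 e).primeFactors, (1 : ℝ) / p with hZ5
  have z0 : (Z0.card : ℝ) ≤ T := by
    rw [← mul_one (T : ℝ)]
    refine fib_real _ (Ico (20 * T : ℤ) (20 * T + T)) _ _ (fun w hw => (mem_product.1 (mem_filter.1 hw).1).1) (by simp) zero_le_one ?_
    intro k _ F hF
    have : F.card ≤ 1 := card_le_one.2 fun x hx y hy => by
      have e1 := (mem_filter.1 (hF x hx)).2
      have e2 := (mem_filter.1 (hF y hy)).2
      simp only [gU, gV] at e1 e2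
      have e3 : (D : ℤ) * x = D * y := by linarith
      exact mul_left_cancel₀ (by have := h.1; positivity) e3
    exact_mod_cast this
  have bsum : ∀ (X : ℕ) (κ : ℝ) (f : ℕ → Finset (ℤ × ℤ)), 0 ≤ κ → (∀ p : ℕ, p.Prime → 200 < p → ((f p).card : ℝ) ≤ κ * ((T : ℝ) / p + 1) ^ 2) →
      ((((Ioc 200 X).filter Nat.Prime).biUnion f).card : ℝ) ≤ κ * ((T : ℝ) ^ 2 / 200 + 2 * T * (1 + Real.log X) + X) := by
    intro X κ f hκ hf
    calc ((((Ioc 200 X).filter Nat.Prime).biUnion f).card : ℝ) ≤ ∑ p ∈ (Ioc 200 X).filter Nat.Prime, ((f p).card : ℝ) := by exact_mod_cast card_biUnion_le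
      _ ≤ ∑ p ∈ (Ioc 200 X).filter Nat.Prime, κ * ((T : ℝ) / p + 1) ^ 2 :=
          sum_le_sum fun p hp => hf p (mem_filter.1 hp).2 (mem_Ioc.1 (mem_filter.1 hp).1).1
      _ ≤ ∑ p ∈ Ioc 200 X, κ * ((T : ℝ) / p + 1) ^ 2 := sum_le_sum_of_subset_of_nonneg (filter_subset _ _) fun _ _ _ => by positivity
      _ ≤ _ := by
          rw [← mul_sum]
          have := box2 200 X T (by positivity) (by norm_num)
          push_cast at this
          gcongr
  have z1 := bsum (2 * D * T) 3 _ (by norm_num) fun p hp hp2 => bad1 (T := T) h hp hp2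
  have z2 := bsum (120 * (D * T)) 2 _ (by norm_num) fun p hp hp2 => bad2s (T := T) h hp hp2
  have z3 : (Z3.card : ℝ) ≤ 2 * T ^ 2 / 200 + 2 * T * Nat.primeCounting (120 * (D * T)) := by
    set X := 120 * (D * T) with hX
    have pc : (((Ioc 200 X).filter Nat.Prime).card : ℝ) ≤ Nat.primeCounting X := by
      rw [← Nat.primesLE_card_eq_primeCounting]
      refine Nat.cast_le.2 (card_le_card fun p hp => ?_)
      obtain ⟨h1, h2⟩ := mem_filter.1 hp
      exact Nat.mem_primesLE.2 ⟨(mem_Ioc.1 h1).2, h2⟩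
    calc (Z3.card : ℝ) ≤ ∑ p ∈ (Ioc 200 X).filter Nat.Prime, _ := by exact_mod_cast card_biUnion_le
      _ ≤ ∑ p ∈ (Ioc 200 X).filter Nat.Prime, (2 * (T : ℝ) ^ 2 * ((p : ℝ) ^ 2)⁻¹ + 2 * T * 1) :=
          sum_le_sum fun p hp => (bad2n h (mem_filter.1 hp).2 (mem_Ioc.1 (mem_filter.1 hp).1).1).trans (le_of_eq (by rw [div_eq_mul_inv]; ring))
      _ = 2 * (T : ℝ) ^ 2 * ∑ p ∈ (Ioc 200 X).filter Nat.Prime, ((p : ℝ) ^ 2)⁻¹ + 2 * T * ((Ioc 200 X).filter Nat.Prime).card := by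
          rw [sum_add_distrib, ← mul_sum, ← mul_sum, sum_const, nsmul_eq_mul, mul_one]
      _ ≤ 2 * (T : ℝ) ^ 2 * (1 / 200) + 2 * T * Nat.primeCounting X := by
          gcongr
          refine (sum_le_sum_of_subset_of_nonneg (filter_subset _ _) fun _ _ _ => by positivity).trans ?_
          exact inv_sq_tail X
      _ = _ := by ring
  have z4 : (Z4.card : ℝ) ≤ T ^ 2 / 10 := by
    have h1 : (Z4.card : ℝ) * (10 * C + 1) ≤ C * T ^ 2 := by
      refine le_trans ?_ H4'
      rw [← nsmul_eq_mul]
      refine (card_nsmul_le_sum Z4 _ _ fun e he => (mem_filter.1 he).2.le).trans ?_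
      exact sum_le_sum_of_subset_of_nonneg (filter_subset _ _) fun _ _ _ => sum_nonneg fun _ _ => by positivity
    by_contra hc
    push Not at hc
    nlinarith [sq_nonneg (T : ℝ)]
  have z5 : (Z5.card : ℝ) * (1 / 10) ≤ 2 * T ^ 2 / 200 + 2 * T * (1 + 2 * L) := by
    refine le_trans ?_ ((bad5 h T T1).trans ?_)
    · rw [← nsmul_eq_mul]
      refine (card_nsmul_le_sum Z5 _ _ fun e he => (mem_filter.1 he).2.le).trans ?_
      exact sum_le_sum_of_subset_of_nonneg (filter_subset _ _) fun _ _ _ => sum_nonneg fun _ _ => by positivity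
    · gcongr
  have cover : gBox T ⊆ (gBox T).filter (GoodE D u0 (10 * C + 1)) ∪ (Z0 ∪ (Z1 ∪ (Z2 ∪ (Z3 ∪ (Z4 ∪ Z5))))) := by
    intro e he
    by_contra hc
    simp only [mem_union, not_or] at hc
    obtain ⟨hg, n0, n1, n2, n3, n4, n5⟩ := hc
    obtain ⟨b1, b2, b3, b4, b5, b6⟩ := gA_bounds h T1 he
    obtain ⟨c1, c2, c3, -⟩ := gN_cast h T1 he
    have hne : gU D u0 e + gV D e ≠ 0 := fun h0 => n0 (mem_filter.2 ⟨he, h0⟩)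
    have hle : ∀ p : ℕ, (p : ℤ) ∣ gU D u0 e + gV D e → p ≤ 2 * D * T := by
      intro p hp
      have h1 := Int.le_of_dvd (abs_pos.2 hne) ((dvd_abs _ _).2 hp)
      have h2 : |gU D u0 e + gV D e| ≤ 2 * ((D : ℤ) * T) := abs_le.2 ⟨by linarith, by linarith⟩
      have : (p : ℤ) ≤ 2 * D * T := by linarith
      exact_mod_cast this
    have key : ∀ p : ℕ, p.Prime → 200 < p → (p : ℤ) ∣ gU D u0 e + gV D e → ((p : ℤ) ∣ gU D u0 e ∨ (p : ℤ) ∣ 25 * gU D u0 e ^ 2 + 10) → False :=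
      fun p hp hp2 h1 h2 => n1 (by
        have q1 : p ∈ (Ioc 200 (2 * D * T)).filter Nat.Prime := mem_filter.2 ⟨mem_Ioc.2 ⟨hp2, hle p h1⟩, hp⟩
        rw [hZ1, mem_biUnion]
        exact ⟨p, q1, mem_filter.2 ⟨he, h1, h2⟩⟩)
    have hsq : Squarefree (gN D u0 e) := by
      rw [Nat.squarefree_iff_prime_squarefree]
      intro p hp hpp
      have d2 : (p : ℤ) ^ 2 ∣ gA D u0 e := by rw [← c1, sq]; exact_mod_cast hpp
      have d1 : (p : ℤ) ∣ gA D u0 e := (dvd_pow_self _ two_ne_zero).trans d2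
      have hp2 := par_gt h hp d1
      have hle2 : p ≤ 120 * (D * T) := by
        have := (Nat.le_of_dvd c2 hpp).trans c3
        by_contra hlt
        push Not at hlt
        have h2 : (120 * (D * T)) * (120 * (D * T)) < p * p := Nat.mul_lt_mul'' hlt hlt
        have h3 : (120 * (D * T)) * (120 * (D * T)) = 14400 * (D ^ 2 * T ^ 2) := by ring
        have h4 : 14000 * D ^ 2 * T ^ 2 = 14000 * (D ^ 2 * T ^ 2) := by ring
        omega
      have q1 : p ∈ (Ioc 200 (120 * (D * T))).filter Nat.Prime := mem_filter.2 ⟨mem_Ioc.2 ⟨hp2, hle2⟩, hp⟩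
      by_cases hs : (p : ℤ) ∣ 26 * gV D e - 4 * gU D u0 e
      · refine n2 ?_
        rw [hZ2, mem_biUnion]
        exact ⟨p, q1, mem_filter.2 ⟨he, d1, hs⟩⟩
      · refine n3 ?_
        rw [hZ3, mem_biUnion]
        exact ⟨p, q1, mem_filter.2 ⟨he, d2, hs⟩⟩
    refine hg (mem_filter.2 ⟨he, ?_, hsq, ?_, ?_, ?_⟩)
    · by_contra h1
      rw [Int.isCoprime_iff_gcd_eq_one] at h1
      obtain ⟨p, hp, hpd⟩ := Nat.exists_prime_and_dvd h1
      have p1 : (p : ℤ) ∣ gU D u0 e := (Int.natCast_dvd_natCast.2 hpd).trans (Int.gcd_dvd_left ..)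
      have p2 : (p : ℤ) ∣ gV D e := (Int.natCast_dvd_natCast.2 hpd).trans (Int.gcd_dvd_right ..)
      refine key p hp ?_ (dvd_add p1 p2) (Or.inl p1)
      by_contra hlt
      have hD : (p : ℤ) ∣ D := Int.natCast_dvd_natCast.2 ((h.2.2.2 p hp).1.2 (by omega))
      have : (p : ℤ) ∣ 1 := by
        refine (dvd_add p2 (hD.mul_right e.2)).neg_right.trans (dvd_of_eq ?_)
        simp only [gV]; ring
      have := Int.natCast_dvd_natCast.1 (by simpa using this : (p : ℤ) ∣ (1 : ℕ))
      exact hp.one_lt.ne' (Nat.dvd_one.1 this)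
    · by_contra h1
      rw [Int.isCoprime_iff_gcd_eq_one] at h1
      obtain ⟨p, hp, hpd⟩ := Nat.exists_prime_and_dvd h1
      have p1 : (p : ℤ) ∣ 2 * (gU D u0 e + gV D e) := (Int.natCast_dvd_natCast.2 hpd).trans (Int.gcd_dvd_left ..)
      have p2 : (p : ℤ) ∣ gA D u0 e := by rw [← c1]; exact (Int.natCast_dvd_natCast.2 hpd).trans (Int.gcd_dvd_right ..)
      have hp2 := par_gt h hp p2
      have p3 : (p : ℤ) ∣ gU D u0 e + gV D e := (by simpa using par_cop h hp hp2 2 (by norm_num) (by norm_num) 0 : IsCoprime (p : ℤ) 2).dvd_of_dvd_mul_left p1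
      refine key p hp hp2 p3 (Or.inr ?_)
      refine (dvd_sub p2 (p3.mul_right (13 * gV D e - 17 * gU D u0 e))).trans (dvd_of_eq ?_)
      simp only [gA]; ring
    · by_contra h1
      push Not at h1
      exact n4 (mem_filter.2 ⟨mem_filter.2 ⟨he, hsq⟩, h1⟩)
    · by_contra h1
      push Not at h1
      exact n5 (mem_filter.2 ⟨he, h1⟩)
  have tot : ((gBox T).card : ℝ) ≤ ((gBox T).filter (GoodE D u0 (10 * C + 1))).card + (Z0.card + (Z1.card + (Z2.card + (Z3.card + (Z4.card + Z5.card))))) := by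
    have := card_le_card cover
    have u1 := card_union_le ((gBox T).filter (GoodE D u0 (10 * C + 1))) (Z0 ∪ (Z1 ∪ (Z2 ∪ (Z3 ∪ (Z4 ∪ Z5)))))
    have u2 := card_union_le Z0 (Z1 ∪ (Z2 ∪ (Z3 ∪ (Z4 ∪ Z5))))
    have u3 := card_union_le Z1 (Z2 ∪ (Z3 ∪ (Z4 ∪ Z5)))
    have u4 := card_union_le Z2 (Z3 ∪ (Z4 ∪ Z5))
    have u5 := card_union_le Z3 (Z4 ∪ Z5)
    have u6 := card_union_le Z4 Z5
    have : (gBox T).card ≤ ((gBox T).filter (GoodE D u0 (10 * C + 1))).card + (Z0.card + (Z1.card + (Z2.card + (Z3.card + (Z4.card + Z5.card))))) := by omega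
    exact_mod_cast this
  rw [Bc] at tot
  have z1' : (Z1.card : ℝ) ≤ 3 * ((T : ℝ) ^ 2 / 200 + 2 * T * (1 + L) + 2 * D * T) := by
    refine z1.trans ?_
    push_cast
    push_cast at lg1
    gcongr
  have z2' : (Z2.card : ℝ) ≤ 2 * ((T : ℝ) ^ 2 / 200 + 2 * T * (1 + L) + 120 * (D * T)) := by
    refine z2.trans (le_of_eq ?_)
    rw [hL]; push_cast; ring
  have fin := mul_le_mul_of_nonneg_left hev (by positivity : (0 : ℝ) ≤ T)
  nlinarith [mul_nonneg (by positivity : (0 : ℝ) ≤ T) (by positivity : (0 : ℝ) ≤ D)]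

lemma lat_count (a : ℕ) (ha : 0 < a) (α β : ℤ) (hc : IsCoprime (α ^ 2 + β ^ 2) (a : ℤ)) (H : ℕ) (F : Finset (ℤ × ℤ))
    (hF : ∀ w ∈ F, |w.1| ≤ H ∧ |w.2| ≤ H ∧ (a : ℤ) ∣ α * w.1 + β * w.2) :
    (F.card : ℝ) ≤ (2 * H + 1 : ℝ) ^ 2 / a + 2 * (2 * H + 1) + 1 := by
  classical
  obtain ⟨g, hg⟩ : ∃ g, g = Int.gcd β a := ⟨_, rfl⟩
  have g0 : 0 < g := by rw [hg]; exact Int.gcd_pos_of_ne_zero_right _ (by exact_mod_cast ha.ne')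
  have gβ : (g : ℤ) ∣ β := hg ▸ Int.gcd_dvd_left ..
  have ga : g ∣ a := by have : (g : ℤ) ∣ a := hg ▸ Int.gcd_dvd_right ..
                        exact_mod_cast this
  obtain ⟨m, rfl⟩ := ga
  have m0 : 0 < m := Nat.pos_of_mul_pos_left ha
  have cop : IsCoprime (g : ℤ) α := by
    have h1 : IsCoprime (α ^ 2 + β ^ 2) (g : ℤ) := hc.of_isCoprime_of_dvd_right (by push_cast; exact dvd_mul_right _ _)
    obtain ⟨b, rfl⟩ := gβ
    have h2 : IsCoprime (α ^ 2) (g : ℤ) := by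
      have := IsCoprime.add_mul_left_left h1 (-(g * b ^ 2))
      rwa [show α ^ 2 + (g * b) ^ 2 + g * -(g * b ^ 2) = α ^ 2 by ring] at this
    exact (IsCoprime.pow_left_iff two_pos).1 h2 |>.symm
  have hdiv : ∀ x y : ℤ, ((g * m : ℕ) : ℤ) ∣ β * (x - y) → (m : ℤ) ∣ x - y := by
    intro x y h
    obtain ⟨b, hb⟩ := gβ
    have gz : (g : ℤ) ≠ 0 := by exact_mod_cast g0.ne'
    have h1 : (m : ℤ) ∣ b * (x - y) := by
      rw [hb, mul_assoc] at h; push_cast at h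
      exact (mul_dvd_mul_iff_left gz).1 h
    have h2 : IsCoprime (m : ℤ) b := by
      rw [Int.isCoprime_iff_gcd_eq_one]
      have h3 : g = g * Int.gcd b m := by
        conv_lhs => rw [hg, hb]
        push_cast
        rw [Int.gcd_mul_left, Int.natAbs_natCast]
      rw [Int.gcd_comm]
      exact (Nat.eq_of_mul_eq_mul_left g0 (by rw [← h3, mul_one])).symm
    exact h2.dvd_of_dvd_mul_left h1
  have := fib_real F (F.image Prod.fst) ((2 * H + 1 : ℕ) / (m : ℝ) + 1) ((2 * H + 1 : ℕ) / (g : ℝ) + 1)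
    (fun w hw => mem_image_of_mem _ hw) ?_ (by positivity) ?_
  · refine this.trans ?_
    have g1 : (1 : ℝ) ≤ g := by exact_mod_cast g0
    have m1 : (1 : ℝ) ≤ m := by exact_mod_cast m0
    have e : ∀ h gg mm : ℝ, 0 ≤ h → 1 ≤ gg → 1 ≤ mm → (h / gg + 1) * (h / mm + 1) ≤ h ^ 2 / (gg * mm) + 2 * h + 1 := by
      intro h gg mm h0 hg hm
      have e1 : h / gg ≤ h := div_le_self h0 hg
      have e2 : h / mm ≤ h := div_le_self h0 hm
      have e3 : (h / gg + 1) * (h / mm + 1) = h ^ 2 / (gg * mm) + h / gg + h / mm + 1 := by field_simp; ring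
      linarith
    have := e (2 * H + 1) g m (by positivity) g1 m1
    push_cast; exact this
  · refine card_class' _ (-H) (2 * H + 1) g g0 ?_ ?_
    · intro x hx
      obtain ⟨w, hw, rfl⟩ := mem_image.1 hx
      have := abs_le.1 (hF w hw).1
      push_cast; constructor <;> linarith
    · intro x hx y hy
      obtain ⟨w, hw, rfl⟩ := mem_image.1 hx
      obtain ⟨v, hv, rfl⟩ := mem_image.1 hy
      have key : ∀ w ∈ F, (g : ℤ) ∣ w.1 := fun w hw => cop.dvd_of_dvd_mul_left (by
        have h1 : (g : ℤ) ∣ α * w.1 + β * w.2 := (by push_cast; exact dvd_mul_right _ _ : (g : ℤ) ∣ ((g * m : ℕ) : ℤ)).trans (hF w hw).2.2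
        exact (dvd_add_left (gβ.mul_right _)).1 h1)
      exact dvd_sub (key w hw) (key v hv)
  · intro x _ L hL
    refine card_class' _ (-H) (2 * H + 1) m m0 ?_ ?_
    · intro y hy
      have := abs_le.1 (hF _ (hL y hy)).2.1
      push_cast; constructor <;> linarith
    · intro y hy y' hy'
      refine hdiv _ _ ((dvd_sub (hF _ (hL y hy)).2.2 (hF _ (hL y' hy')).2.2).trans (dvd_of_eq ?_))
      ring

def QP (a : ℕ) (c d c2 d2 N : ℤ) (w : (ℤ × ℤ) × (ℤ × ℤ)) : Prop :=
  IsCoprime w.1.1 w.1.2 ∧ w.1.1 ^ 2 + w.1.2 ^ 2 ≤ w.2.1 ^ 2 + w.2.2 ^ 2 ∧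
  (w.1.1 ^ 2 + w.1.2 ^ 2) * (w.2.1 ^ 2 + w.2.2 ^ 2) ≤ 4 * N ∧
  IsCoprime ((w.1.1 ^ 2 + w.1.2 ^ 2) * (w.2.1 ^ 2 + w.2.2 ^ 2)) (a : ℤ) ∧
  (a : ℤ) ∣ (c * w.1.1 + d * w.1.2) * w.2.2 + (c * w.1.2 - d * w.1.1) * w.2.1 ∧
  (a : ℤ) ∣ (c2 * w.1.1 + d2 * w.1.2) * w.2.2 + (d2 * w.1.1 - c2 * w.1.2) * w.2.1

lemma gauss_split {z1 z2 w1 w2 : ℤ} (hz : 0 < z1) (hw : 0 < w1) (h : z1 ^ 2 + z2 ^ 2 = w1 ^ 2 + w2 ^ 2) :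
    ∃ g k η1 η2 : ℤ, 0 < g ∧ IsCoprime η1 η2 ∧ 2 * z1 = g * η1 - k * η2 ∧ 2 * z2 = g * η2 + k * η1 ∧
      2 * w1 = g * η1 + k * η2 ∧ 2 * w2 = g * η2 - k * η1 := by
  have hg : 0 < Int.gcd (z1 + w1) (z2 + w2) := Int.gcd_pos_of_ne_zero_left _ (by omega)
  obtain ⟨η1, η2, hcop, e1, e2⟩ := Int.exists_gcd_one hg
  set g := Int.gcd (z1 + w1) (z2 + w2)
  have hcop' : IsCoprime η1 η2 := Int.isCoprime_iff_gcd_eq_one.2 hcop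
  have gz : (g : ℤ) ≠ 0 := by exact_mod_cast hg.ne'
  have e3 : (z1 - w1) * η1 + (z2 - w2) * η2 = 0 := by
    apply mul_left_cancel₀ gz
    have : g * ((z1 - w1) * η1 + (z2 - w2) * η2) = (z1 - w1) * (η1 * g) + (z2 - w2) * (η2 * g) := by ring
    rw [this, ← e1, ← e2]; linarith
  have η10 : η1 ≠ 0 := by rintro rfl; rw [zero_mul] at e1; omega
  obtain ⟨k, hk⟩ : η1 ∣ z2 - w2 := hcop'.dvd_of_dvd_mul_left ⟨-(z1 - w1), by linarith⟩
  have hk2 : z1 - w1 = - k * η2 := by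
    apply mul_left_cancel₀ η10
    rw [hk] at e3; linarith
  exact ⟨g, k, η1, η2, by exact_mod_cast hg, hcop', by linarith, by linarith, by linarith, by linarith⟩

lemma split_pairs {a : ℕ} {c d c2 d2 N : ℤ} (ha : IsCoprime 4 (a : ℤ)) (F : Finset ((ℤ × ℤ) × (ℤ × ℤ)))
    (hF : ∀ w ∈ F, 0 < w.1.1 ∧ 0 < w.2.1 ∧ w.1.1 ^ 2 + w.1.2 ^ 2 = w.2.1 ^ 2 + w.2.2 ^ 2 ∧ w.1.1 ^ 2 + w.1.2 ^ 2 ≤ N ∧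
      IsCoprime (w.1.1 ^ 2 + w.1.2 ^ 2) (a : ℤ) ∧ (a : ℤ) ∣ c * w.1.2 - d * w.1.1 ∧ (a : ℤ) ∣ c2 * w.2.2 - d2 * w.2.1)
    (Q1 Q2 : Finset ((ℤ × ℤ) × (ℤ × ℤ))) (h1 : ∀ w, QP a c d c2 d2 N w → w ∈ Q1) (h2 : ∀ w, QP a c d c2 (-d2) N w → w ∈ Q2) :
    F.card ≤ Q1.card + Q2.card := by
  classical
  set f1 : (ℤ × ℤ) × (ℤ × ℤ) → (ℤ × ℤ) × (ℤ × ℤ) := fun w => (((w.1.1 * w.2.1 - w.1.2 * w.2.2) / 2, (w.1.1 * w.2.2 + w.1.2 * w.2.1) / 2),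
    ((w.1.1 * w.2.1 + w.1.2 * w.2.2) / 2, (w.1.2 * w.2.1 - w.1.1 * w.2.2) / 2)) with hf1
  set f2 : (ℤ × ℤ) × (ℤ × ℤ) → (ℤ × ℤ) × (ℤ × ℤ) := fun w => (((w.1.1 * w.2.1 - w.1.2 * w.2.2) / 2, (w.1.1 * w.2.2 + w.1.2 * w.2.1) / 2),
    ((w.1.1 * w.2.1 + w.1.2 * w.2.2) / 2, (w.1.1 * w.2.2 - w.1.2 * w.2.1) / 2)) with hf2
  have sub : F ⊆ Q1.image f1 ∪ Q2.image f2 := by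
    rintro ⟨⟨z1, z2⟩, ⟨w1, w2⟩⟩ hw
    obtain ⟨a1, a2, a3, a4, a5, a6, a7⟩ := hF _ hw
    dsimp only at a1 a2 a3 a4 a5 a6 a7
    obtain ⟨g, k, η1, η2, g0, hη, e1, e2, e3, e4⟩ := gauss_split a1 a2 a3
    have nrm : (η1 ^ 2 + η2 ^ 2) * (g ^ 2 + k ^ 2) = 4 * (z1 ^ 2 + z2 ^ 2) := by
      have : 4 * (z1 ^ 2 + z2 ^ 2) = (2 * z1) ^ 2 + (2 * z2) ^ 2 := by ring
      rw [this, e1, e2]; ring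
    rw [mem_union]
    by_cases hc : η1 ^ 2 + η2 ^ 2 ≤ g ^ 2 + k ^ 2
    · left
      refine mem_image.2 ⟨((η1, η2), (g, k)), h1 _ ⟨hη, hc, by dsimp only; linarith, ?_, ?_, ?_⟩, ?_⟩
      · dsimp only; rw [nrm]; exact ha.mul_left a5
      · dsimp only
        refine (a6.mul_left 2).trans (dvd_of_eq ?_)
        linear_combination c * e2 - d * e1
      · dsimp only
        refine (a7.mul_left (-2)).trans (dvd_of_eq ?_)
        linear_combination -c2 * e4 + d2 * e3
      · simp only [hf1, Prod.mk.injEq]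
        have q1 : η1 * g - η2 * k = 2 * z1 := by linarith
        have q2 : η1 * k + η2 * g = 2 * z2 := by linarith
        have q3 : η1 * g + η2 * k = 2 * w1 := by linarith
        have q4 : η2 * g - η1 * k = 2 * w2 := by linarith
        rw [q1, q2, q3, q4]; refine ⟨⟨?_, ?_⟩, ?_, ?_⟩ <;> omega
    · right
      push Not at hc
      have tp : 0 < Int.gcd g k := Int.gcd_pos_of_ne_zero_left _ g0.ne'
      obtain ⟨κ1, κ2, hcop, g1, k1⟩ := Int.exists_gcd_one tp
      have t1 : (1 : ℤ) ≤ Int.gcd g k := by exact_mod_cast tp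
      generalize (Int.gcd g k : ℤ) = t at g1 k1 t1
      subst g1 k1
      have tt : 1 ≤ t ^ 2 := by nlinarith
      refine mem_image.2 ⟨((κ1, κ2), (t * η1, t * η2)), h2 _ ⟨Int.isCoprime_iff_gcd_eq_one.2 hcop, ?_, ?_, ?_, ?_, ?_⟩, ?_⟩
      · dsimp only
        have p1 : 0 ≤ κ1 ^ 2 + κ2 ^ 2 := by positivity
        have p2 : 0 ≤ η1 ^ 2 + η2 ^ 2 := by positivity
        nlinarith
      · dsimp only; linarith
      · dsimp only
        have : (κ1 ^ 2 + κ2 ^ 2) * ((t * η1) ^ 2 + (t * η2) ^ 2) = 4 * (z1 ^ 2 + z2 ^ 2) := by rw [← nrm]; ring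
        rw [this]; exact ha.mul_left a5
      · dsimp only
        refine (a6.mul_left 2).trans (dvd_of_eq ?_)
        linear_combination c * e2 - d * e1
      · dsimp only
        refine (a7.mul_left (2)).trans (dvd_of_eq ?_)
        linear_combination c2 * e4 - d2 * e3
      · simp only [hf2, Prod.mk.injEq]
        have q1 : κ1 * (t * η1) - κ2 * (t * η2) = 2 * z1 := by linarith
        have q2 : κ1 * (t * η2) + κ2 * (t * η1) = 2 * z2 := by linarith
        have q3 : κ1 * (t * η1) + κ2 * (t * η2) = 2 * w1 := by linarith
        have q4 : κ1 * (t * η2) - κ2 * (t * η1) = 2 * w2 := by linarith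
        rw [q1, q2, q3, q4]; refine ⟨⟨?_, ?_⟩, ?_, ?_⟩ <;> omega
  exact (card_le_card sub).trans ((card_union_le _ _).trans (add_le_add card_image_le card_image_le))

def Dl (c d c2 d2 : ℤ) (s : ℤ × ℤ) : ℤ := (c * d2 + d * c2) * (s.1 ^ 2 - s.2 ^ 2) - 2 * (c * c2 - d * d2) * (s.1 * s.2)

def nrm (s : ℤ × ℤ) : ℤ := s.1 ^ 2 + s.2 ^ 2

def DP (a : ℕ) (c d c2 d2 : ℤ) (s : ℤ × ℤ) : Prop := IsCoprime s.1 s.2 ∧ IsCoprime (nrm s) (a : ℤ) ∧ (a : ℤ) ∣ Dl c d c2 d2 s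

noncomputable def sBox (j : ℕ) : Finset (ℤ × ℤ) :=
  (Icc (-2 ^ (j + 1) : ℤ) (2 ^ (j + 1)) ×ˢ Icc (-2 ^ (j + 1) : ℤ) (2 ^ (j + 1))).filter fun s => 4 ^ j ≤ nrm s ∧ nrm s < 4 ^ (j + 1)

open Classical in
noncomputable def Sg (a : ℕ) (c d c2 d2 : ℤ) (j : ℕ) : Finset (ℤ × ℤ) := (sBox j).filter (DP a c d c2 d2)

lemma sq_lt_two_pow {x : ℤ} {j : ℕ} (h : x ^ 2 < 4 ^ (j + 1)) : |x| ≤ 2 ^ (j + 1) := by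
  have : (4 : ℤ) ^ (j + 1) = (2 ^ (j + 1)) ^ 2 := by rw [← pow_mul, mul_comm, pow_mul]; norm_num
  rw [this] at h
  exact (abs_lt_of_sq_lt_sq h (by positivity)).le

lemma mem_sBox {s : ℤ × ℤ} {j : ℕ} : s ∈ sBox j ↔ 4 ^ j ≤ nrm s ∧ nrm s < 4 ^ (j + 1) := by
  refine ⟨fun h => (mem_filter.1 h).2, fun h => mem_filter.2 ⟨?_, h⟩⟩
  have h1 := sq_lt_two_pow (x := s.1) (j := j) (by have := h.2; simp only [nrm] at this; nlinarith [sq_nonneg s.2])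
  have h2 := sq_lt_two_pow (x := s.2) (j := j) (by have := h.2; simp only [nrm] at this; nlinarith [sq_nonneg s.1])
  exact mem_product.2 ⟨mem_Icc.2 (abs_le.1 h1), mem_Icc.2 (abs_le.1 h2)⟩

lemma sBox_abs {s : ℤ × ℤ} {j : ℕ} (h : s ∈ sBox j) : |s.1| ≤ (2 ^ (j + 1) : ℕ) ∧ |s.2| ≤ (2 ^ (j + 1) : ℕ) := by
  have h := mem_product.1 (mem_filter.1 h).1
  push_cast
  exact ⟨abs_le.2 (mem_Icc.1 h.1), abs_le.2 (mem_Icc.1 h.2)⟩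

lemma sBox_card (j : ℕ) : ((sBox j).card : ℝ) ≤ 25 * 4 ^ j := by
  have h1 : (sBox j).card ≤ (2 * 2 ^ (j + 1) + 1) * (2 * 2 ^ (j + 1) + 1) := by
    refine (card_filter_le _ _).trans ?_
    rw [card_product, Int.card_Icc]
    have : ((2 : ℤ) ^ (j + 1) + 1 - -2 ^ (j + 1)).toNat = 2 * 2 ^ (j + 1) + 1 := by
      have : ((2 : ℤ) ^ (j + 1) + 1 - -2 ^ (j + 1)) = ((2 * 2 ^ (j + 1) + 1 : ℕ) : ℤ) := by push_cast; ring
      rw [this, Int.toNat_natCast]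
    rw [this]
  have h2 : (1 : ℝ) ≤ 2 ^ j := one_le_pow₀ (by norm_num)
  have h4 : (4 : ℝ) ^ j = 2 ^ j * 2 ^ j := by rw [← mul_pow]; norm_num
  calc ((sBox j).card : ℝ) ≤ ((2 * 2 ^ (j + 1) + 1) * (2 * 2 ^ (j + 1) + 1) : ℕ) := by exact_mod_cast h1
    _ ≤ _ := by push_cast; rw [h4, pow_succ]; nlinarith

lemma det_dvd {a : ℕ} {c d c2 d2 : ℤ} (sqa : Squarefree a) (ha2 : IsCoprime 4 (a : ℤ)) (hA : IsCoprime ((c ^ 2 + d ^ 2) * (c2 ^ 2 + d2 ^ 2)) (a : ℤ))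
    {s t o : ℤ × ℤ} (hs : DP a c d c2 d2 s) (ht : DP a c d c2 d2 t) (ho : DP a c d c2 d2 o)
    (he : Int.gcd a (s.1 * o.2 - o.1 * s.2) = Int.gcd a (t.1 * o.2 - o.1 * t.2)) : (a : ℤ) ∣ s.1 * t.2 - t.1 * s.2 := by
  obtain ⟨-, -, hs⟩ := hs
  obtain ⟨-, -, ht⟩ := ht
  obtain ⟨-, on, ho⟩ := ho
  obtain ⟨s1, s2⟩ := s
  obtain ⟨t1, t2⟩ := t
  obtain ⟨o1, o2⟩ := o
  simp only [Dl, nrm] at *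
  obtain ⟨Q, hQ⟩ : ∃ Q, Q = c * d2 + d * c2 := ⟨_, rfl⟩
  obtain ⟨P, hP⟩ : ∃ P, P = c * c2 - d * d2 := ⟨_, rfl⟩
  have hPQ : (c ^ 2 + d ^ 2) * (c2 ^ 2 + d2 ^ 2) = P ^ 2 + Q ^ 2 := by rw [hP, hQ]; ring
  rw [← hQ, ← hP] at hs ht ho
  rw [hPQ] at hA
  have k0 : (a : ℤ) ∣ (s1 * t2 - t1 * s2) * ((s1 * o2 - o1 * s2) * (t1 * o2 - o1 * t2)) := by
    have k1 : (a : ℤ) ∣ (s1 * t2 - t1 * s2) * ((s1 * o2 - o1 * s2) * (t1 * o2 - o1 * t2)) * Q := by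
      refine (dvd_add (dvd_add (hs.mul_left (t1 * t2 * o2 ^ 2 - o1 * o2 * t2 ^ 2)) (ht.mul_left (-(s1 * s2 * o2 ^ 2 - o1 * o2 * s2 ^ 2)))) (ho.mul_left (s1 * s2 * t2 ^ 2 - t1 * t2 * s2 ^ 2))).trans (dvd_of_eq ?_)
      ring
    have k2 : (a : ℤ) ∣ (s1 * t2 - t1 * s2) * ((s1 * o2 - o1 * s2) * (t1 * o2 - o1 * t2)) * (-2 * P) := by
      refine (dvd_add (dvd_add (hs.mul_left (-(t1 ^ 2 * o2 ^ 2 - o1 ^ 2 * t2 ^ 2))) (ht.mul_left ((s1 ^ 2 * o2 ^ 2 - o1 ^ 2 * s2 ^ 2)))) (ho.mul_left (-(s1 ^ 2 * t2 ^ 2 - t1 ^ 2 * s2 ^ 2)))).trans (dvd_of_eq ?_)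
      ring
    refine (ha2.mul_left hA).symm.dvd_of_dvd_mul_right ((dvd_add (k1.mul_right (4 * Q)) (k2.mul_right (-2 * P))).trans (dvd_of_eq ?_))
    ring
  obtain ⟨D1, hD1⟩ : ∃ D1, D1 = s1 * o2 - o1 * s2 := ⟨_, rfl⟩
  obtain ⟨D2, hD2⟩ : ∃ D2, D2 = t1 * o2 - o1 * t2 := ⟨_, rfl⟩
  obtain ⟨δ, hδ⟩ : ∃ δ, δ = s1 * t2 - t1 * s2 := ⟨_, rfl⟩
  rw [← hD1, ← hD2] at he k0
  rw [← hδ] at k0 ⊢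
  obtain ⟨f, hf⟩ : ∃ f, f = Int.gcd a D1 := ⟨_, rfl⟩
  have f1 : (f : ℤ) ∣ D1 := hf ▸ Int.gcd_dvd_right ..
  have f2 : (f : ℤ) ∣ D2 := by rw [hf, he]; exact Int.gcd_dvd_right ..
  have fa : f ∣ a := by have : (f : ℤ) ∣ a := hf ▸ Int.gcd_dvd_left ..
                        exact_mod_cast this
  have fδ : (f : ℤ) ∣ δ := by
    have h1 : (f : ℤ) ∣ δ * (o1 ^ 2 + o2 ^ 2) := by
      refine (dvd_add (f1.mul_right (t1 * o1 + t2 * o2)) (f2.mul_right (-(s1 * o1 + s2 * o2)))).trans (dvd_of_eq ?_)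
      rw [hD1, hD2, hδ]; ring
    exact (on.of_isCoprime_of_dvd_right (Int.natCast_dvd_natCast.2 fa)).symm.dvd_of_dvd_mul_right h1
  obtain ⟨m, hm⟩ := fa
  have cfm : Nat.Coprime f m := Nat.coprime_of_squarefree_mul (hm ▸ sqa)
  have cm : ∀ x : ℤ, f = Int.gcd a x → IsCoprime (m : ℤ) x := by
    intro x hx
    rw [Int.isCoprime_iff_gcd_eq_one]
    have h1 : Int.gcd m x ∣ f := by
      rw [hx]
      refine Int.dvd_gcd ((Int.gcd_dvd_left ..).trans ?_) (Int.gcd_dvd_right ..)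
      rw [hm]; push_cast; exact dvd_mul_left _ _
    have h2 : Int.gcd m x ∣ m := by
      have : ((Int.gcd m x : ℕ) : ℤ) ∣ m := Int.gcd_dvd_left ..
      exact_mod_cast this
    exact Nat.dvd_one.1 (cfm ▸ Nat.dvd_gcd h1 h2)
  have mδ : (m : ℤ) ∣ δ := by
    have h1 : (m : ℤ) ∣ δ * (D1 * D2) := (by rw [hm]; push_cast; exact dvd_mul_left _ _ : (m : ℤ) ∣ a).trans k0
    exact ((cm D1 hf).mul_right (cm D2 (hf.trans he))).dvd_of_dvd_mul_right h1
  rw [hm]; push_cast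
  exact (Nat.isCoprime_iff_coprime.2 cfm).mul_dvd fδ mδ

lemma sig_count {a : ℕ} {c d c2 d2 : ℤ} (sqa : Squarefree a) (ha2 : IsCoprime 4 (a : ℤ)) (hA : IsCoprime ((c ^ 2 + d ^ 2) * (c2 ^ 2 + d2 ^ 2)) (a : ℤ)) (j : ℕ) :
    ((Sg a c d c2 d2 j).card : ℝ) ≤ a.divisors.card * (25 * 4 ^ j / a + 11 * 2 ^ j) := by
  classical
  have ha0 : a ≠ 0 := sqa.ne_zero
  rcases (Sg a c d c2 d2 j).eq_empty_or_nonempty with h0 | ⟨o, ho⟩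
  · rw [h0, card_empty, Nat.cast_zero]; positivity
  have key := card_eq_sum_card_fiberwise (f := fun s : ℤ × ℤ => Int.gcd a (s.1 * o.2 - o.1 * s.2)) (s := Sg a c d c2 d2 j) (t := a.divisors)
    (fun s _ => Nat.mem_divisors.2 ⟨by
      have : ((Int.gcd a (s.1 * o.2 - o.1 * s.2) : ℕ) : ℤ) ∣ a := Int.gcd_dvd_left ..
      exact_mod_cast this, ha0⟩)
  rw [key, Nat.cast_sum, ← nsmul_eq_mul]
  refine sum_le_card_nsmul _ _ _ fun b _ => ?_
  rcases ((Sg a c d c2 d2 j).filter fun s : ℤ × ℤ => Int.gcd a (s.1 * o.2 - o.1 * s.2) = b).eq_empty_or_nonempty with h0 | ⟨t, ht⟩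
  · rw [h0, card_empty, Nat.cast_zero]; positivity
  obtain ⟨ht1, ht2⟩ := mem_filter.1 ht
  have htn := (mem_filter.1 ht1).2
  refine (lat_count a (Nat.pos_of_ne_zero ha0) t.2 (-t.1) ?_ (2 ^ (j + 1)) _ fun s hs => ?_).trans ?_
  · have := htn.2.1; simp only [nrm] at this
    rwa [show t.2 ^ 2 + (-t.1) ^ 2 = t.1 ^ 2 + t.2 ^ 2 by ring]
  · obtain ⟨hs1, hs2⟩ := mem_filter.1 hs
    obtain ⟨hs3, hs4⟩ := mem_filter.1 hs1
    refine ⟨(sBox_abs hs3).1, (sBox_abs hs3).2, ?_⟩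
    exact (det_dvd sqa ha2 hA hs4 htn (mem_filter.1 ho).2 (hs2.trans ht2.symm)).trans (dvd_of_eq (by ring))
  · have h2 : (1 : ℝ) ≤ 2 ^ j := one_le_pow₀ (by norm_num)
    have h4 : (4 : ℝ) ^ j = 2 ^ j * 2 ^ j := by rw [← mul_pow]; norm_num
    have e1 : (2 * ((2 ^ (j + 1) : ℕ) : ℝ) + 1) ≤ 5 * 2 ^ j := by push_cast; rw [pow_succ]; linarith
    have e2 : (2 * ((2 ^ (j + 1) : ℕ) : ℝ) + 1) ^ 2 ≤ 25 * 4 ^ j := by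
      rw [h4]; calc _ ≤ (5 * 2 ^ j : ℝ) ^ 2 := by gcongr
        _ = _ := by ring
    have e3 : (2 * ((2 ^ (j + 1) : ℕ) : ℝ) + 1) ^ 2 / a ≤ 25 * 4 ^ j / a := by gcongr
    linarith

lemma q_level {a : ℕ} {c d c2 d2 N : ℤ} (ha0 : 0 < a) (hA : IsCoprime (c ^ 2 + d ^ 2) (a : ℤ)) (r j : ℕ) (hr : N < (r : ℤ) ^ 2)
    (Q : Finset ((ℤ × ℤ) × (ℤ × ℤ))) (hQ : ∀ w ∈ Q, QP a c d c2 d2 N w ∧ w.1 ∈ sBox j) :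
    (Q.card : ℝ) ≤ (Sg a c d c2 d2 j).card * (36 * r ^ 2 / (4 ^ j * a) + 14 * r / 2 ^ j) := by
  classical
  have key := card_eq_sum_card_fiberwise (f := Prod.fst) (s := Q) (t := Sg a c d c2 d2 j) (fun w hw => by
    obtain ⟨⟨h1, h2, h3, h4, h5, h6⟩, h7⟩ := hQ w hw
    refine mem_filter.2 ⟨h7, h1, h4.of_mul_left_left, ?_⟩
    have k1 : (a : ℤ) ∣ (w.2.1 ^ 2 + w.2.2 ^ 2) * Dl c d c2 d2 w.1 := by
      simp only [Dl]
      refine (dvd_add (h5.mul_left ((d2 * w.1.1 - c2 * w.1.2) * w.2.2 - (c2 * w.1.1 + d2 * w.1.2) * w.2.1))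
        (h6.mul_left (-((c * w.1.2 - d * w.1.1) * w.2.2 - (c * w.1.1 + d * w.1.2) * w.2.1)))).trans (dvd_of_eq ?_)
      ring
    exact (h4.of_mul_left_right).symm.dvd_of_dvd_mul_left k1)
  rw [key, Nat.cast_sum, ← nsmul_eq_mul]
  refine sum_le_card_nsmul _ _ _ fun s hs => ?_
  have inj : Set.InjOn Prod.snd ((Q.filter fun w => w.1 = s : Finset _) : Set ((ℤ × ℤ) × (ℤ × ℤ))) := by
    intro v hv v' hv' e
    exact Prod.ext ((mem_filter.1 hv).2.trans (mem_filter.1 hv').2.symm) e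
  rw [← card_image_of_injOn inj]
  rcases ((Q.filter fun w => w.1 = s).image Prod.snd).eq_empty_or_nonempty with h0 | ⟨t0, ht0⟩
  · rw [h0, card_empty, Nat.cast_zero]; positivity
  have tb : ∀ t ∈ (Q.filter fun w => w.1 = s).image Prod.snd, QP a c d c2 d2 N (s, t) := by
    intro t ht
    obtain ⟨w, hw, rfl⟩ := mem_image.1 ht
    obtain ⟨hw1, rfl⟩ := mem_filter.1 hw
    exact (hQ w hw1).1
  obtain ⟨hsb, hsn, hsn2, -⟩ := mem_filter.1 hs
  have n4 := (mem_sBox.1 hsb).1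
  have f4 : (4 : ℤ) ^ j = (2 ^ j) ^ 2 := by rw [← pow_mul, mul_comm, pow_mul]; norm_num
  have tH : ∀ t : ℤ × ℤ, QP a c d c2 d2 N (s, t) → |t.1| ≤ (2 * r / 2 ^ j : ℕ) ∧ |t.2| ≤ (2 * r / 2 ^ j : ℕ) := by
    intro t ⟨_, _, h3, _⟩
    dsimp only at h3
    have h5 : (4 : ℤ) ^ j * (t.1 ^ 2 + t.2 ^ 2) ≤ 4 * N := (mul_le_mul_of_nonneg_right n4 (by positivity)).trans h3
    have gen : ∀ x : ℤ, x ^ 2 ≤ t.1 ^ 2 + t.2 ^ 2 → |x| ≤ (2 * r / 2 ^ j : ℕ) := by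
      intro x hx
      have h6 : (2 ^ j * x) ^ 2 < (2 * r) ^ 2 := by
        have := mul_le_mul_of_nonneg_left hx (by positivity : (0 : ℤ) ≤ 4 ^ j)
        rw [mul_pow, ← f4]; nlinarith
      have h7 := abs_lt_of_sq_lt_sq h6 (by positivity)
      rw [abs_mul, abs_of_nonneg (by positivity : (0 : ℤ) ≤ 2 ^ j)] at h7
      push_cast
      rw [Int.le_ediv_iff_mul_le (by positivity)]; linarith
    exact ⟨gen _ (by nlinarith [sq_nonneg t.2]), gen _ (by nlinarith [sq_nonneg t.1])⟩
  set H := 2 * r / 2 ^ j with hH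
  have H1 : 1 ≤ H := by
    by_contra hc
    have H0 : H = 0 := by clear_value H; omega
    obtain ⟨q1, q2⟩ := tH t0 (tb t0 ht0)
    obtain ⟨-, h2, -⟩ := tb t0 ht0
    dsimp only at h2
    rw [H0] at q1 q2
    have e1 : t0.1 = 0 := abs_nonpos_iff.1 (by exact_mod_cast q1)
    have e2 : t0.2 = 0 := abs_nonpos_iff.1 (by exact_mod_cast q2)
    rw [e1, e2] at h2
    have : (1 : ℤ) ≤ 4 ^ j := one_le_pow₀ (by norm_num)
    simp only [nrm] at n4
    linarith
  refine (lat_count a ha0 (c * s.2 - d * s.1) (c * s.1 + d * s.2) ?_ H _ fun t ht => ?_).trans ?_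
  · rw [show (c * s.2 - d * s.1) ^ 2 + (c * s.1 + d * s.2) ^ 2 = (c ^ 2 + d ^ 2) * (s.1 ^ 2 + s.2 ^ 2) by ring]
    exact hA.mul_left hsn2
  · have q := tb t ht
    refine ⟨(tH t q).1, (tH t q).2, ?_⟩
    obtain ⟨-, -, -, -, h5, -⟩ := q
    exact h5.trans (dvd_of_eq (by dsimp only; ring))
  · have Hr : (H : ℝ) ≤ 2 * r / 2 ^ j := by
      have : ((2 * r / 2 ^ j : ℕ) : ℝ) ≤ ((2 * r : ℕ) : ℝ) / ((2 ^ j : ℕ) : ℝ) := Nat.cast_div_le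
      push_cast at this; rw [hH]; exact_mod_cast this
    have H1r : (1 : ℝ) ≤ H := by exact_mod_cast H1
    have a0 : (0 : ℝ) < a := by exact_mod_cast ha0
    clear_value H
    have e1 : (2 * (H : ℝ) + 1) ^ 2 / a ≤ 36 * r ^ 2 / (4 ^ j * a) := by
      have h4 : (4 : ℝ) ^ j = (2 ^ j) ^ 2 := by rw [← pow_mul, mul_comm, pow_mul]; norm_num
      calc (2 * (H : ℝ) + 1) ^ 2 / a ≤ (3 * (2 * r / 2 ^ j)) ^ 2 / a := by gcongr; linarith
        _ = _ := by rw [h4]; field_simp; ring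
    have e2 : 14 * (r : ℝ) / 2 ^ j = 7 * (2 * r / 2 ^ j) := by ring
    rw [e2]; linarith

lemma q_total {a : ℕ} {c d c2 d2 N : ℤ} (ha0 : 0 < a) (hA : IsCoprime (c ^ 2 + d ^ 2) (a : ℤ)) (r J : ℕ) (hr : N < (r : ℤ) ^ 2) (hJ : 2 * r ≤ 4 ^ J)
    (Q : Finset ((ℤ × ℤ) × (ℤ × ℤ))) (hQ : ∀ w ∈ Q, QP a c d c2 d2 N w) :
    (Q.card : ℝ) ≤ ∑ j ∈ range J, ((Sg a c d c2 d2 j).card : ℝ) * (36 * r ^ 2 / (4 ^ j * a) + 14 * r / 2 ^ j) := by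
  classical
  have key := card_eq_sum_card_fiberwise (f := fun w : (ℤ × ℤ) × (ℤ × ℤ) => Nat.log 4 (nrm w.1).toNat) (s := Q) (t := range J) (fun w hw => by
    obtain ⟨h1, h2, h3, h4, h5, h6⟩ := hQ w hw
    rw [Finset.mem_coe, mem_range]
    have r0 : 0 < r := by
      by_contra hc
      have : r = 0 := by omega
      subst this
      have : 0 ≤ (w.1.1 ^ 2 + w.1.2 ^ 2) * (w.2.1 ^ 2 + w.2.2 ^ 2) := by positivity
      push_cast at hr
      linarith
    have n1 : nrm w.1 < 2 * r := by
      refine lt_of_pow_lt_pow_left₀ 2 (by positivity) ?_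
      simp only [nrm]
      have : 0 ≤ w.1.1 ^ 2 + w.1.2 ^ 2 := by positivity
      nlinarith
    refine Nat.log_lt_of_lt_pow' ?_ ?_
    · rintro rfl; simp at hJ; omega
    · have : (nrm w.1).toNat < 2 * r := by omega
      omega)
  rw [key, Nat.cast_sum]
  refine sum_le_sum fun j _ => q_level ha0 hA r j hr _ fun w hw => ?_
  obtain ⟨hw, hj⟩ := mem_filter.1 hw
  refine ⟨hQ w hw, mem_sBox.2 ?_⟩
  have n0 : 0 < nrm w.1 := by
    have hc := (hQ w hw).1
    simp only [nrm]
    rcases eq_or_ne w.1.1 0 with h | h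
    · have : w.1.2 ≠ 0 := fun h' => by rw [h, h'] at hc; exact absurd hc (by norm_num)
      positivity
    · positivity
  have hne : (nrm w.1).toNat ≠ 0 := by omega
  have l1 := Nat.pow_log_le_self 4 hne
  have l2 := Nat.lt_pow_succ_log_self (b := 4) (by norm_num) (nrm w.1).toNat
  rw [hj] at l1 l2
  have e : ((nrm w.1).toNat : ℤ) = nrm w.1 := Int.toNat_of_nonneg n0.le
  rw [← e]
  exact ⟨by exact_mod_cast l1, by exact_mod_cast l2⟩

lemma quad_two (α β γ : ℤ) (hα : α ≠ 0) (S : Finset ℤ) (h : ∀ x ∈ S, α * x ^ 2 + β * x + γ = 0) : S.card ≤ 2 := by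
  by_contra hc
  push Not at hc
  obtain ⟨x, hx, y, hy, z, hz, h1, h2, h3⟩ := two_lt_card.1 hc
  have e1 : (x - y) * (α * (x + y) + β) = 0 := by linear_combination h x hx - h y hy
  have e2 : (x - z) * (α * (x + z) + β) = 0 := by linear_combination h x hx - h z hz
  have e3 := (mul_eq_zero.1 e1).resolve_left (sub_ne_zero.2 h1)
  have e4 := (mul_eq_zero.1 e2).resolve_left (sub_ne_zero.2 h2)
  have e5 : α * (y - z) = 0 := by linear_combination e3 - e4
  exact (sub_ne_zero.2 h3) ((mul_eq_zero.1 e5).resolve_left hα)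

lemma pell_count (E m : ℤ) (hE : 1 ≤ E) (hm : 0 < m) (P : Finset (ℤ × ℤ)) (hP : ∀ w ∈ P, 0 < w.1 ∧ 0 < w.2 ∧ w.1 ^ 2 - E * w.2 ^ 2 = m)
    (hR : ∀ w ∈ P, ∀ w' ∈ P, w.2 ≤ 3 * w'.2) : (P.card : ℝ) ≤ 2 * (4 * m + 1) := by
  classical
  rcases P.eq_empty_or_nonempty with rfl | ⟨⟨Z1, V1⟩, h1⟩
  · have : (0 : ℝ) < m := by exact_mod_cast hm
    rw [card_empty, Nat.cast_zero]; positivity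
  obtain ⟨z10, v10, e1⟩ := hP _ h1
  dsimp only at z10 v10 e1
  have key := card_le_mul_card_image_of_maps_to (f := fun w : ℤ × ℤ => Z1 * w.2 - w.1 * V1) (s := P) (t := Icc (-(2 * m)) (2 * m)) ?_ 2 ?_
  · rw [Int.card_Icc] at key
    have : ((P.card : ℤ)) ≤ 2 * (4 * m + 1) := by omega
    exact_mod_cast this
  · rintro ⟨Z, V⟩ hw
    obtain ⟨z0, v0, e⟩ := hP _ hw
    have r1 := hR _ hw _ h1
    have r2 := hR _ h1 _ hw
    dsimp only at *
    have zv : V ≤ Z := by nlinarith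
    have zv1 : V1 ≤ Z1 := by nlinarith
    have id1 : (Z1 * V - Z * V1) * (Z1 * V + Z * V1) = m * (V ^ 2 - V1 ^ 2) := by linear_combination V ^ 2 * e1 - V1 ^ 2 * e
    have b1 : 2 * (V * V1) ≤ Z1 * V + Z * V1 := by nlinarith
    have vv : 0 < V * V1 := by positivity
    rw [mem_Icc]
    constructor
    · by_contra hc
      push Not at hc
      have k1 : (Z1 * V - Z * V1) * (Z1 * V + Z * V1) ≤ -(2 * m) * (2 * (V * V1)) := by nlinarith
      have k2 : -(3 * (V * V1)) ≤ V ^ 2 - V1 ^ 2 := by nlinarith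
      have k3 := mul_le_mul_of_nonneg_left k2 hm.le
      nlinarith [mul_pos hm vv]
    · by_contra hc
      push Not at hc
      have k1 : (2 * m) * (2 * (V * V1)) ≤ (Z1 * V - Z * V1) * (Z1 * V + Z * V1) := by nlinarith
      have k2 : V ^ 2 - V1 ^ 2 ≤ 3 * (V * V1) := by nlinarith
      have k3 := mul_le_mul_of_nonneg_left k2 hm.le
      nlinarith [mul_pos hm vv]
  · intro δ _
    have inj : Set.InjOn Prod.snd ((P.filter fun w : ℤ × ℤ => Z1 * w.2 - w.1 * V1 = δ : Finset _) : Set (ℤ × ℤ)) := by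
      rintro ⟨Z, V⟩ hv ⟨Z', V'⟩ hv' e
      have q1 := (mem_filter.1 hv).2
      have q2 := (mem_filter.1 hv').2
      dsimp only at q1 q2 e
      subst e
      have : Z * V1 = Z' * V1 := by linarith
      rw [mul_right_cancel₀ v10.ne' this]
    rw [← card_image_of_injOn inj]
    refine quad_two m (-2 * Z1 * δ) (δ ^ 2 - m * V1 ^ 2) hm.ne' _ fun x hx => ?_
    obtain ⟨⟨Z, V⟩, hw, rfl⟩ := mem_image.1 hx
    obtain ⟨hw1, hw2⟩ := mem_filter.1 hw
    have e := (hP _ hw1).2.2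
    dsimp only at *
    linear_combination (-V ^ 2) * e1 + V1 ^ 2 * e - (-(Z1 * V - δ) - Z * V1) * hw2

def gc (D : ℕ) (u0 : ℤ) (e : ℤ × ℤ) : ℤ := 2 * gU D u0 e - 3 * gV D e
def gd (D : ℕ) (u0 : ℤ) (e : ℤ × ℤ) : ℤ := 2 * (gU D u0 e + gV D e)

lemma gcd_sq (D : ℕ) (u0 : ℤ) (e : ℤ × ℤ) : gc D u0 e ^ 2 + gd D u0 e ^ 2 = gA D u0 e - 10 := by
  simp only [gc, gd, gA]; ring

lemma gcd_inj {D : ℕ} (hD : 0 < D) {u0 : ℤ} {e e' : ℤ × ℤ} (h1 : gc D u0 e = gc D u0 e') (h2 : gd D u0 e = gd D u0 e') : e = e' := by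
  have hD' : (D : ℤ) ≠ 0 := by exact_mod_cast hD.ne'
  simp only [gc, gd, gU, gV] at h1 h2
  have k1 : (D : ℤ) * e.1 = D * e'.1 := by linarith
  have k2 : (D : ℤ) * e.2 = D * e'.2 := by linarith
  exact Prod.ext (mul_left_cancel₀ hD' k1) (mul_left_cancel₀ hD' k2)

lemma good_facts {D T : ℕ} {u0 : ℤ} (h : Par D u0) (hT : 0 < T) {e : ℤ × ℤ} (he : e ∈ gBox T) :
    100 * ((D : ℤ) * T) ≤ gc D u0 e ∧ |gd D u0 e| ≤ 4 * ((D : ℤ) * T) ∧ gc D u0 e ^ 2 + gd D u0 e ^ 2 = gN D u0 e - 10 ∧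
    IsCoprime 10 (gN D u0 e : ℤ) ∧ IsCoprime 4 (gN D u0 e : ℤ) ∧ IsCoprime (gc D u0 e ^ 2 + gd D u0 e ^ 2) (gN D u0 e : ℤ) := by
  obtain ⟨-, -, b3, b4, b5, b6⟩ := gA_bounds h hT he
  obtain ⟨c1, c2, -, -⟩ := gN_cast h hT he
  have cop : ∀ n : ℕ, n.Prime → n ≤ 200 → IsCoprime (n : ℤ) (gN D u0 e : ℤ) := by
    intro n hn h2
    rw [Nat.isCoprime_iff_coprime, hn.coprime_iff_not_dvd]
    intro hd
    have := par_gt h hn (e := e) (by rw [← c1]; exact_mod_cast hd)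
    omega
  have p2 : IsCoprime (2 : ℤ) (gN D u0 e : ℤ) := by exact_mod_cast cop 2 Nat.prime_two (by norm_num)
  have p5 : IsCoprime (5 : ℤ) (gN D u0 e : ℤ) := by exact_mod_cast cop 5 Nat.prime_five (by norm_num)
  have e3 : gc D u0 e ^ 2 + gd D u0 e ^ 2 = gN D u0 e - 10 := by rw [c1, gcd_sq]
  have p10 : IsCoprime (10 : ℤ) (gN D u0 e : ℤ) := by have := p2.mul_left p5; norm_num at this; exact this
  refine ⟨by simp only [gc]; linarith, by simp only [gd]; exact abs_le.2 ⟨by linarith, by linarith⟩, e3, p10, by have := p2.mul_left p2; norm_num at this; exact this, ?_⟩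
  rw [e3]
  have := IsCoprime.add_mul_left_left p10.neg_left 1
  rwa [show -10 + (gN D u0 e : ℤ) * 1 = gN D u0 e - 10 by ring] at this

lemma e2_unique {a : ℕ} {c d c2 d2 c3 d3 A : ℤ} {s : ℤ × ℤ} (hA : (a : ℤ) = A + 10) (hA0 : 0 < A) (hco : IsCoprime A (a : ℤ)) (h1 : c ^ 2 + d ^ 2 = A)
    (h2 : c2 ^ 2 + d2 ^ 2 = A) (h3 : c3 ^ 2 + d3 ^ 2 = A) (p2 : 0 < c2) (p3 : 0 < c3)
    (q2 : DP a c d c2 d2 s) (q3 : DP a c d c3 d3 s) : c2 = c3 ∧ d2 = d3 := by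
  obtain ⟨-, hn, q2⟩ := q2
  obtain ⟨-, -, q3⟩ := q3
  simp only [Dl, nrm] at hn q2 q3
  have k : (a : ℤ) ∣ c2 * d3 - c3 * d2 := by
    have hw : IsCoprime (A * (s.1 ^ 2 + s.2 ^ 2) ^ 2) (a : ℤ) := hco.mul_left (hn.pow_left)
    refine hw.symm.dvd_of_dvd_mul_left ?_
    set w1 := c * (s.1 ^ 2 - s.2 ^ 2) + 2 * d * (s.1 * s.2) with hw1
    set w2 := d * (s.1 ^ 2 - s.2 ^ 2) - 2 * c * (s.1 * s.2) with hw2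
    have r2 : (a : ℤ) ∣ w1 * d2 + w2 * c2 := q2.trans (dvd_of_eq (by rw [hw1, hw2]; ring))
    have r3 : (a : ℤ) ∣ w1 * d3 + w2 * c3 := q3.trans (dvd_of_eq (by rw [hw1, hw2]; ring))
    have r4 : A * (s.1 ^ 2 + s.2 ^ 2) ^ 2 = w1 ^ 2 + w2 ^ 2 := by rw [← h1, hw1, hw2]; ring
    rw [r4]
    refine (dvd_add (r3.mul_left (w1 * c2 - w2 * d2)) (r2.mul_left (-(w1 * c3 - w2 * d3)))).trans (dvd_of_eq ?_)
    ring
  have sq : (c2 * d3 - c3 * d2) ^ 2 + (c2 * c3 + d2 * d3) ^ 2 = A ^ 2 := by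
    have : A ^ 2 = (c2 ^ 2 + d2 ^ 2) * (c3 ^ 2 + d3 ^ 2) := by rw [h2, h3]; ring
    rw [this]; ring
  have z : c2 * d3 - c3 * d2 = 0 := by
    refine Int.eq_zero_of_abs_lt_dvd k ?_
    have : |c2 * d3 - c3 * d2| ≤ A := abs_le_of_sq_le_sq (by nlinarith [sq_nonneg (c2 * c3 + d2 * d3)]) hA0.le
    linarith
  have e : c2 ^ 2 * A = c3 ^ 2 * A := by
    linear_combination (-c2 ^ 2) * h3 + c3 ^ 2 * h2 + (c2 * d3 + c3 * d2) * z
  have e2 : c2 = c3 := by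
    have e' := mul_right_cancel₀ hA0.ne' e
    exact (pow_left_inj₀ p2.le p3.le two_ne_zero).1 e'
  subst e2
  exact ⟨rfl, by have : c2 * d3 = c2 * d2 := by linarith
                 exact (mul_left_cancel₀ p2.ne' this).symm⟩

lemma zero_case {c d c2 d2 A : ℤ} {s : ℤ × ℤ} (hA0 : 0 < A) (h1 : c ^ 2 + d ^ 2 = A) (h2 : c2 ^ 2 + d2 ^ 2 = A) (hs : IsCoprime s.1 s.2)
    (hn : 0 < nrm s) (hD : Dl c d c2 d2 s = 0) : nrm s ∣ 2 * (c * s.1 + d * s.2) := by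
  have cop : IsCoprime (nrm s) s.1 := by
    have := (hs.symm.pow_left (m := 2)).add_mul_left_left s.1
    rw [show s.2 ^ 2 + s.1 * s.1 = nrm s by simp only [nrm]; ring] at this
    exact this
  simp only [nrm, Dl] at *
  obtain ⟨s1, s2⟩ := s
  dsimp only at *
  set x1 := c * s1 + d * s2 with hx1
  set x2 := c * s2 - d * s1 with hx2
  set y1 := c2 * s1 + d2 * s2 with hy1
  set y2 := d2 * s1 - c2 * s2 with hy2
  have nx : x1 ^ 2 + x2 ^ 2 = A * (s1 ^ 2 + s2 ^ 2) := by rw [← h1, hx1, hx2]; ring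
  have ny : y1 ^ 2 + y2 ^ 2 = A * (s1 ^ 2 + s2 ^ 2) := by rw [← h2, hy1, hy2]; ring
  have dt : x1 * y2 - x2 * y1 = 0 := by rw [← hD, hx1, hx2, hy1, hy2]; ring
  have An : A * (s1 ^ 2 + s2 ^ 2) ≠ 0 := by positivity
  have e : x1 ^ 2 * (A * (s1 ^ 2 + s2 ^ 2)) = y1 ^ 2 * (A * (s1 ^ 2 + s2 ^ 2)) := by
    linear_combination (-x1 ^ 2) * ny + y1 ^ 2 * nx + (x1 * y2 + x2 * y1) * dt
  have e1 := mul_right_cancel₀ An e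
  have e2 : x2 ^ 2 = y2 ^ 2 := by linarith
  have div : s1 ^ 2 + s2 ^ 2 ∣ x1 * s1 - x2 * s2 := by
    have k1 : (s1 ^ 2 + s2 ^ 2) * c2 = y1 * s1 - y2 * s2 := by rw [hy1, hy2]; ring
    rcases sq_eq_sq_iff_eq_or_eq_neg.1 e1 with f1 | f1
    · rcases eq_or_ne y1 0 with f0 | f0
      · rcases sq_eq_sq_iff_eq_or_eq_neg.1 e2 with f2 | f2
        · exact ⟨c2, by rw [k1, f1, f2]⟩
        · exact ⟨-c2, by rw [f1, f2, f0]; rw [f0] at k1; linarith⟩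
      · have : x2 = y2 := by
          rw [f1] at dt
          have : y1 * x2 = y1 * y2 := by linarith
          exact mul_left_cancel₀ f0 this
        exact ⟨c2, by rw [k1, f1, this]⟩
    · rcases eq_or_ne y1 0 with f0 | f0
      · rcases sq_eq_sq_iff_eq_or_eq_neg.1 e2 with f2 | f2
        · exact ⟨c2, by rw [k1, f1, f2, f0]; ring⟩
        · exact ⟨-c2, by rw [f1, f2]; linarith⟩
      · have : x2 = -y2 := by
          rw [f1] at dt
          have : y1 * x2 = y1 * (-y2) := by linarith
          exact mul_left_cancel₀ f0 this
        exact ⟨-c2, by rw [f1, this]; linarith⟩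
  have d2' : s1 ^ 2 + s2 ^ 2 ∣ 2 * x1 * s1 := by
    refine (dvd_add div (dvd_mul_right _ c)).trans (dvd_of_eq ?_)
    rw [hx1, hx2]; ring
  exact cop.dvd_of_dvd_mul_right d2'

open Classical in
lemma e0_count {D T : ℕ} {u0 : ℤ} (h : Par D u0) {s : ℤ × ℤ} (hs : IsCoprime s.1 s.2) (hn : 0 < nrm s) :
    (((gBox T).filter fun e => nrm s ∣ 2 * (gc D u0 e * s.1 + gd D u0 e * s.2)).card : ℝ) ≤ T * (26 * D * T / nrm s + 1) := by
  have D0 := h.1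
  have cop : IsCoprime (nrm s) s.1 := by
    have := (hs.symm.pow_left (m := 2)).add_mul_left_left s.1
    rw [show s.2 ^ 2 + s.1 * s.1 = nrm s by simp only [nrm]; ring] at this
    exact this
  have hnr : (0 : ℝ) < nrm s := by exact_mod_cast hn
  refine fib_real _ (Ico (20 * T : ℤ) (20 * T + T)) _ _ (fun w hw => (mem_product.1 (mem_filter.1 hw).1).1) (by simp) (by positivity) ?_
  intro k _ L hL
  obtain ⟨n, hnn⟩ : ∃ n : ℕ, (n : ℤ) = nrm s := ⟨(nrm s).toNat, Int.toNat_of_nonneg hn.le⟩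
  have n0 : 0 < n := by exact_mod_cast hnn ▸ hn
  obtain ⟨g, hg⟩ : ∃ g, g = Nat.gcd n (26 * D) := ⟨_, rfl⟩
  have g0 : 0 < g := hg ▸ Nat.gcd_pos_of_pos_left _ n0
  obtain ⟨m, hm⟩ : g ∣ n := hg ▸ Nat.gcd_dvd_left ..
  have m0 : 0 < m := by by_contra hc; have : m = 0 := by omega
                        rw [this] at hm; omega
  have gD : g ≤ 26 * D := Nat.le_of_dvd (by positivity) (hg ▸ Nat.gcd_dvd_right ..)
  have := card_class' L (20 * T) T m m0 (fun x hx => mem_Ico.1 (mem_product.1 (mem_filter.1 (hL x hx)).1).2) ?_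
  · refine this.trans ?_
    refine add_le_add ?_ le_rfl
    rw [div_le_div_iff₀ (by exact_mod_cast m0 : (0:ℝ) < m) hnr]
    have e : (nrm s : ℝ) = g * m := by rw [← hnn, hm]; push_cast; ring
    rw [e]
    have gDr : (g : ℝ) ≤ 26 * D := by exact_mod_cast gD
    have : (T : ℝ) * (g * m) = g * (T * m) := by ring
    rw [this]
    calc (g : ℝ) * (T * m) ≤ (26 * D) * (T * m) := by gcongr
      _ = _ := by ring
  · intro x hx y hy
    have e1 := (mem_filter.1 (hL x hx)).2
    have e2 := (mem_filter.1 (hL y hy)).2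
    have e3 : nrm s ∣ s.1 ^ 2 * (26 * D * (x - y)) := by
      have k1 := (dvd_sub e1 e2).mul_right (-(2 * s.2 + 3 * s.1))
      have k2 := (dvd_mul_right (nrm s) (8 * D * (x - y)))
      refine (dvd_sub k2 k1).trans (dvd_of_eq ?_)
      simp only [gc, gd, gU, gV, nrm]; ring
    have e4 : nrm s ∣ 26 * D * (x - y) := (cop.pow_right).dvd_of_dvd_mul_left e3
    rw [← hnn] at e4
    obtain ⟨b, hb⟩ : g ∣ 26 * D := hg ▸ Nat.gcd_dvd_right ..
    have cmb : Nat.Coprime m b := by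
      have : g = g * Nat.gcd m b := by
        conv_lhs => rw [hg, hm, hb, Nat.gcd_mul_left]
      exact (Nat.eq_of_mul_eq_mul_left g0 (by rw [← this, mul_one])).symm
    have hb' : (26 * D : ℤ) = g * b := by exact_mod_cast hb
    rw [hb', hm, mul_assoc] at e4
    push_cast at e4
    have gz : (g : ℤ) ≠ 0 := by exact_mod_cast g0.ne'
    exact (Nat.isCoprime_iff_coprime.2 cmb).dvd_of_dvd_mul_left ((mul_dvd_mul_iff_left gz).1 e4)

open Classical in
lemma fib_gen {α β : Type*} (F : Finset α) (Ks : Finset β) (f : α → β) (n κ : ℝ) (hmap : ∀ w ∈ F, f w ∈ Ks) (hK : (Ks.card : ℝ) ≤ κ) (hn : 0 ≤ n)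
    (h : ∀ k ∈ Ks, ∀ L : Finset α, (∀ w ∈ L, w ∈ F ∧ f w = k) → (L.card : ℝ) ≤ n) : (F.card : ℝ) ≤ κ * n := by
  rw [card_eq_sum_card_fiberwise (f := f) (t := Ks) (fun w hw => hmap w hw)]
  push_cast
  refine (sum_le_sum fun k hk => h k hk _ fun w hw => mem_filter.1 hw).trans ?_
  rw [sum_const, nsmul_eq_mul]
  gcongr

lemma gA_fib {D T : ℕ} {u0 : ℤ} (hD : 0 < D) (A : ℤ) (F : Finset (ℤ × ℤ)) (hF : ∀ e ∈ F, e ∈ gBox T ∧ gA D u0 e = A) : F.card ≤ 2 * T := by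
  have : (F.card : ℝ) ≤ T * 2 := by
    refine fib_real F (Ico (20 * T : ℤ) (20 * T + T)) _ _ (fun w hw => (mem_product.1 (hF w hw).1).1) (by simp) (by positivity) ?_
    intro k _ L hL
    have hD' : (D : ℤ) ≠ 0 := by exact_mod_cast hD.ne'
    have := quad_two (13 * D ^ 2) (26 * D + 4 * (u0 + D * k) * D) (8 * (u0 + D * k) ^ 2 + 4 * (u0 + D * k) + 23 - A) (by positivity) L (fun x hx => by
      have := (hF _ (hL x hx)).2
      simp only [gA, gU, gV] at this
      linear_combination this)
    exact_mod_cast this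
  have h2 : (F.card : ℝ) ≤ ((2 * T : ℕ) : ℝ) := by push_cast; linarith
  exact_mod_cast h2

lemma es_count {D T : ℕ} {u0 : ℤ} (h : Par D u0) {n s : ℤ} (hn : 1 ≤ n) (s0 : s ≠ 0) (sn : |s| < n) (hT : n ≤ T) (F : Finset (ℤ × ℤ))
    (hF : ∀ e ∈ F, e ∈ gBox T ∧ ∃ V : ℤ, V ^ 2 = (n * (gA D u0 e - 10)) ^ 2 - (s * gA D u0 e) ^ 2) : (F.card : ℝ) ≤ 1604 * T * n ^ 4 := by
  classical
  have D0 := h.1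
  have T0 : 0 < T := by omega
  have s2 : 1 ≤ s ^ 2 := by have : 0 < s ^ 2 := by positivity
                            omega
  have ss : s ^ 2 < n ^ 2 := sq_lt_sq' (abs_lt.1 sn).1 (abs_lt.1 sn).2
  set E := n ^ 2 - s ^ 2 with hE
  have E1 : 1 ≤ E := by omega
  set q : ℤ := ((D : ℤ) * T) ^ 2 with hq
  have nq : n ^ 2 ≤ q := by
    have : (1 : ℤ) ≤ D := by exact_mod_cast D0
    have : n ≤ D * T := by nlinarith
    rw [hq]; gcongr
  have q1 : 1 ≤ q := by nlinarith
  set f : ℤ × ℤ → ℤ × ℤ := fun e => (E * (gA D u0 e - 10) - 10 * s ^ 2, Int.sqrt ((n * (gA D u0 e - 10)) ^ 2 - (s * gA D u0 e) ^ 2)) with hf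
  have key : ∀ e ∈ F, ∃ A V : ℤ, gA D u0 e = A + 10 ∧ 9990 * q ≤ A ∧ A ≤ 14000 * q ∧ f e = (E * A - 10 * s ^ 2, V) ∧ 0 < V ∧ V ^ 2 ≤ E * A ^ 2 ∧ E * A ^ 2 ≤ 2 * V ^ 2 ∧ (E * A - 10 * s ^ 2) ^ 2 - E * V ^ 2 = 100 * s ^ 2 * n ^ 2 := by
    intro e he
    obtain ⟨hb, V, hV⟩ := hF e he
    obtain ⟨b1, b2, -⟩ := gA_bounds h T0 hb
    have e1 : Int.sqrt ((n * (gA D u0 e - 10)) ^ 2 - (s * gA D u0 e) ^ 2) = |V| := by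
      rw [← hV, sq, Int.sqrt_eq, Int.abs_eq_natAbs]
    obtain ⟨A, hA⟩ : ∃ A, A = gA D u0 e - 10 := ⟨_, rfl⟩
    have hA' : gA D u0 e = A + 10 := by omega
    have hV' : V ^ 2 = E * A ^ 2 - 20 * s ^ 2 * A - 100 * s ^ 2 := by rw [hV, ← hA, hA', hE]; ring
    have A1 : 9990 * q ≤ A := by rw [hA]; linarith
    have u1 : 100 * s ^ 2 ≤ A := by linarith
    have u2 : E * A ^ 2 ≤ 2 * V ^ 2 := by
      have : A ^ 2 ≤ E * A ^ 2 := by nlinarith [sq_nonneg A]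
      nlinarith
    have A0 : 0 < A := by linarith
    refine ⟨A, |V|, hA', A1, by linarith, ?_, ?_, ?_, ?_, ?_⟩
    · simp only [hf]; rw [e1, ← hA]
    · rw [abs_pos]; rintro rfl
      have : 0 < E * A ^ 2 := by positivity
      linarith
    · rw [sq_abs, hV']; nlinarith
    · rw [sq_abs]; exact u2
    · rw [sq_abs, hV', hE]; ring
  have c1 := card_le_mul_card_image_of_maps_to (f := f) (s := F) (t := F.image f) (fun e he => mem_image_of_mem f he) (2 * T) ?_
  · have c2 := pell_count E (100 * s ^ 2 * n ^ 2) E1 (by positivity) (F.image f) ?_ ?_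
    · have c3 : ((100 * s ^ 2 * n ^ 2 : ℤ) : ℝ) ≤ 100 * (n : ℝ) ^ 4 := by
        have : 100 * s ^ 2 * n ^ 2 ≤ 100 * n ^ 4 := by nlinarith [sq_nonneg n]
        exact_mod_cast this
      have n1 : (1 : ℝ) ≤ (n : ℝ) ^ 4 := one_le_pow₀ (by exact_mod_cast hn)
      calc (F.card : ℝ) ≤ (2 * T) * (F.image f).card := by exact_mod_cast c1
        _ ≤ (2 * T) * (802 * (n : ℝ) ^ 4) := by gcongr; linarith
        _ = _ := by ring
    · intro w hw
      obtain ⟨e, he, rfl⟩ := mem_image.1 hw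
      obtain ⟨A, V, -, k1, -, k3, k4, -, -, k5⟩ := key e he
      rw [k3]
      refine ⟨?_, k4, k5⟩
      dsimp only
      nlinarith
    · intro w hw w' hw'
      obtain ⟨e, he, rfl⟩ := mem_image.1 hw
      obtain ⟨A, V, -, k1, k2, k3, k4, k5, k6, k7⟩ := key e he
      obtain ⟨e', he', rfl⟩ := mem_image.1 hw'
      obtain ⟨A', V', -, l1, l2, l3, l4, l5, l6, l7⟩ := key e' he'
      rw [k3, l3]
      dsimp only
      have aa : A ^ 2 ≤ 2 * A' ^ 2 := by
        have : 999 * A ≤ 1400 * A' := by linarith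
        nlinarith
      have : V ^ 2 ≤ (3 * V') ^ 2 := by nlinarith
      exact (pow_le_pow_iff_left₀ k4.le (by positivity) two_ne_zero).1 this
  · intro p hp
    obtain ⟨e', he', rfl⟩ := mem_image.1 hp
    refine gA_fib (u0 := u0) D0 (gA D u0 e') _ fun e he => ?_
    obtain ⟨he, e1⟩ := mem_filter.1 he
    refine ⟨(hF e he).1, ?_⟩
    have : E * (gA D u0 e - 10) = E * (gA D u0 e' - 10) := by
      have := congrArg Prod.fst e1
      simp only [hf] at this
      linarith
    have := mul_left_cancel₀ (by omega) this
    linarith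

lemma dl_sq {c d c2 d2 A : ℤ} {s : ℤ × ℤ} (h1 : c ^ 2 + d ^ 2 = A) (h2 : c2 ^ 2 + d2 ^ 2 = A) :
    ((c * s.1 + d * s.2) * (c2 * s.1 + d2 * s.2) + (c * s.2 - d * s.1) * (d2 * s.1 - c2 * s.2)) ^ 2 = (nrm s * A) ^ 2 - Dl c d c2 d2 s ^ 2 := by
  have : (nrm s * A) ^ 2 = nrm s ^ 2 * ((c ^ 2 + d ^ 2) * (c2 ^ 2 + d2 ^ 2)) := by rw [h1, h2]; ring
  rw [this]; simp only [nrm, Dl]; ring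

def TripP (D T : ℕ) (u0 ε : ℤ) (j : ℕ) (w : (ℤ × ℤ) × (ℤ × ℤ) × (ℤ × ℤ)) : Prop :=
  w.1 ∈ gBox T ∧ w.2.1 ∈ gBox T ∧ w.2.2 ∈ sBox j ∧ gN D u0 w.1 = gN D u0 w.2.1 ∧ DP (gN D u0 w.1) (gc D u0 w.1) (gd D u0 w.1) (gc D u0 w.2.1) (ε * gd D u0 w.2.1) w.2.2

lemma trip_small {D T j : ℕ} {u0 ε : ℤ} (h : Par D u0) (hε : ε ^ 2 = 1) (hT : 4 ^ (j + 1) ≤ T) (F : Finset ((ℤ × ℤ) × (ℤ × ℤ) × (ℤ × ℤ)))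
    (hF : ∀ w ∈ F, TripP D T u0 ε j w) : (F.card : ℝ) ≤ 10 ^ 8 * (D * T ^ 2 + T * (4 ^ j) ^ 6) := by
  classical
  have T0 : 0 < T := lt_of_lt_of_le (by positivity) hT
  have D0 := h.1
  obtain ⟨q, hq⟩ : ∃ q : ℝ, q = 4 ^ j := ⟨_, rfl⟩
  have q1 : 1 ≤ q := by rw [hq]; exact one_le_pow₀ (by norm_num)
  have Tr : (0 : ℝ) < T := by exact_mod_cast T0
  have := fib_gen F (sBox j) (fun w => w.2.2) (T * (26 * D * T / q + 1) + 2 * (4 * q) * (1604 * T * (4 * q) ^ 4)) (25 * 4 ^ j) (fun w hw => (hF w hw).2.2.1) (sBox_card j) (by positivity) ?_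
  · refine this.trans ?_
    rw [← hq]
    have e : 25 * q * (T * (26 * D * T / q + 1) + 2 * (4 * q) * (1604 * T * (4 * q) ^ 4)) = 650 * (D * T ^ 2) + T * (25 * q + 82124800 * q ^ 6) := by
      field_simp; ring
    rw [e]
    have q6 : q ≤ q ^ 6 := le_self_pow₀ q1 (by norm_num)
    have : (T : ℝ) * (25 * q + 82124800 * q ^ 6) ≤ 10 ^ 8 * (T * q ^ 6) := by nlinarith
    have : (0 : ℝ) ≤ D * T ^ 2 := by positivity
    linarith
  intro s hs Fs hFs
  obtain ⟨n1, n2⟩ := mem_sBox.1 hs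
  have np : 1 ≤ nrm s := le_trans (one_le_pow₀ (by norm_num)) n1
  have nr1 : q ≤ (nrm s : ℝ) := by rw [hq]; exact_mod_cast n1
  have nr2 : (nrm s : ℝ) ≤ 4 * q := by
    have : (nrm s : ℝ) < 4 ^ (j + 1) := by exact_mod_cast n2
    rw [pow_succ] at this; rw [hq]; linarith
  have nT : nrm s ≤ T := n2.le.trans (by exact_mod_cast hT)
  have fact : ∀ w ∈ Fs, w.1 ∈ gBox T ∧ gc D u0 w.1 ^ 2 + gd D u0 w.1 ^ 2 = gA D u0 w.1 - 10 ∧ gc D u0 w.2.1 ^ 2 + (ε * gd D u0 w.2.1) ^ 2 = gA D u0 w.1 - 10 ∧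
      (gN D u0 w.1 : ℤ) = gA D u0 w.1 ∧ 0 < gA D u0 w.1 - 10 ∧ 0 < gc D u0 w.2.1 ∧ IsCoprime (gA D u0 w.1 - 10) (gN D u0 w.1 : ℤ) ∧
      DP (gN D u0 w.1) (gc D u0 w.1) (gd D u0 w.1) (gc D u0 w.2.1) (ε * gd D u0 w.2.1) s := by
    intro w hw
    obtain ⟨hw, e⟩ := hFs w hw
    obtain ⟨b1, b2, b3, b4, b5⟩ := hF w hw
    have g1 := gcd_sq D u0 w.1
    have g2 := gcd_sq D u0 w.2.1
    have m1 := (gN_cast h T0 b1).1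
    have m2 := (gN_cast h T0 b2).1
    have hm : gA D u0 w.1 = gA D u0 w.2.1 := by rw [← m1, ← m2, b4]
    obtain ⟨f1, -, f3, -, -, f6⟩ := good_facts h T0 b1
    obtain ⟨f1', -⟩ := good_facts h T0 b2
    have DT : (0 : ℤ) < D * T := by positivity
    refine ⟨b1, g1, by rw [mul_pow, hε, hm]; linarith, m1, ?_, by linarith, by rw [← g1]; exact f6, e ▸ b5⟩
    rw [← g1]; nlinarith [sq_nonneg (gd D u0 w.1)]
  have inj : Set.InjOn Prod.fst (Fs : Set ((ℤ × ℤ) × (ℤ × ℤ) × (ℤ × ℤ))) := by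
    rintro ⟨e, e2, t⟩ hw ⟨e', e2', t'⟩ hw' he
    obtain ⟨-, a1, a2, a3, a4, a5, a6, a7⟩ := fact _ hw
    obtain ⟨-, b1, b2, b3, b4, b5, b6, b7⟩ := fact _ hw'
    have t1 : t = s := (hFs _ hw).2
    have t2 : t' = s := (hFs _ hw').2
    dsimp only at *
    subst he t1 t2
    obtain ⟨u1, u2⟩ := e2_unique (by rw [a3]; ring) a4 a6 a1 a2 b2 a5 b5 a7 b7
    have ε0 : ε ≠ 0 := by rintro rfl; norm_num at hε
    rw [gcd_inj D0 u1 (mul_left_cancel₀ ε0 u2)]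
  rw [← card_image_of_injOn inj]
  have sub : Fs.image Prod.fst ⊆ ((gBox T).filter fun e => IsCoprime s.1 s.2 ∧ nrm s ∣ 2 * (gc D u0 e * s.1 + gd D u0 e * s.2)) ∪
      ((Ioo (-nrm s) (nrm s)).filter fun t => t ≠ 0).biUnion (fun t => (gBox T).filter fun e => ∃ V : ℤ, V ^ 2 = (nrm s * (gA D u0 e - 10)) ^ 2 - (t * gA D u0 e) ^ 2) := by
    intro e he
    obtain ⟨w, hw, rfl⟩ := mem_image.1 he
    obtain ⟨a0, a1, a2, a3, a4, a5, a6, a7⟩ := fact _ hw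
    obtain ⟨t, ht⟩ := a7.2.2
    rw [mem_union, mem_filter, mem_biUnion]
    have hV := dl_sq (s := s) a1 a2
    rcases eq_or_ne t 0 with t0 | t0
    · left
      exact ⟨a0, a7.1, zero_case a4 a1 a2 a7.1 (by linarith) (by rw [ht, t0, mul_zero])⟩
    · right
      refine ⟨t, mem_filter.2 ⟨mem_Ioo.2 (abs_lt.1 ?_), t0⟩, mem_filter.2 ⟨a0, _, hV.trans (by rw [ht, a3]; ring)⟩⟩
      have : |t * gA D u0 w.1| ≤ nrm s * (gA D u0 w.1 - 10) := by
        refine abs_le_of_sq_le_sq ?_ (by positivity)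
        have e : t * gA D u0 w.1 = Dl (gc D u0 w.1) (gd D u0 w.1) (gc D u0 w.2.1) (ε * gd D u0 w.2.1) s := by rw [ht, a3]; ring
        rw [e]
        nlinarith [sq_nonneg ((gc D u0 w.1 * s.1 + gd D u0 w.1 * s.2) * (gc D u0 w.2.1 * s.1 + ε * gd D u0 w.2.1 * s.2) + (gc D u0 w.1 * s.2 - gd D u0 w.1 * s.1) * (ε * gd D u0 w.2.1 * s.1 - gc D u0 w.2.1 * s.2))]
      rw [abs_mul, abs_of_pos (by linarith : 0 < gA D u0 w.1)] at this
      by_contra hc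
      push Not at hc
      nlinarith
  have c1 := (card_le_card sub).trans ((card_union_le _ _).trans (Nat.add_le_add_left card_biUnion_le _))
  refine (Nat.cast_le (α := ℝ).2 c1).trans ?_
  push_cast
  refine add_le_add ?_ ?_
  · by_cases hs : IsCoprime s.1 s.2
    · refine le_trans ?_ ((e0_count h (T := T) hs (by linarith)).trans (by gcongr))
      refine Nat.cast_le.2 (card_le_card fun e he => ?_)
      have he := mem_filter.1 he
      exact mem_filter.2 ⟨he.1, he.2.2⟩
    · rw [filter_false_of_mem (fun e _ he => hs he.1)]
      rw [card_empty, Nat.cast_zero]; positivity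
  · refine (sum_le_card_nsmul _ _ (1604 * T * (4 * q) ^ 4) fun t ht => ?_).trans ?_
    · obtain ⟨h1, h2⟩ := mem_filter.1 ht
      refine (es_count h np h2 (abs_lt.2 (mem_Ioo.1 h1)) nT _ fun e he => mem_filter.1 he).trans ?_
      gcongr
    · rw [nsmul_eq_mul]
      refine mul_le_mul_of_nonneg_right ?_ (by positivity)
      have k1 : (((Ioo (-nrm s) (nrm s)).filter fun t => t ≠ 0).card : ℤ) ≤ 2 * nrm s := by
        have := card_filter_le (Ioo (-nrm s) (nrm s)) (fun t => t ≠ 0)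
        rw [Int.card_Ioo] at this
        omega
      have k2 : (((Ioo (-nrm s) (nrm s)).filter fun t => t ≠ 0).card : ℝ) ≤ 2 * nrm s := by exact_mod_cast k1
      linarith

lemma pairs_count {D T τm : ℕ} {u0 : ℤ} (h : Par D u0) (T0 : 0 < T) (hτ : ∀ k : ℕ, 1 ≤ k → k ≤ 14000 * D ^ 2 * T ^ 2 → k.divisors.card ≤ τm) (F : Finset ((ℤ × ℤ) × (ℤ × ℤ)))
    (hF : ∀ w ∈ F, w.1 ∈ gBox T ∧ w.2 ∈ gBox T ∧ gN D u0 w.1 = gN D u0 w.2) : (F.card : ℝ) ≤ 83 * D ^ 2 * T ^ 2 * τm := by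
  classical
  have D0 := h.1
  have DT : (0 : ℤ) < D * T := by positivity
  have DT1 : 1 ≤ (D : ℝ) * T := by have : (1 : ℤ) ≤ D * T := DT
                                   exact_mod_cast this
  have Dr : 1 ≤ (D : ℝ) := by exact_mod_cast D0
  have τ1 : (1 : ℝ) ≤ τm := by
    have := hτ 1 le_rfl (by have : 0 < D ^ 2 * T ^ 2 := by positivity
                            nlinarith)
    rw [Nat.divisors_one, card_singleton] at this
    exact_mod_cast this
  have fact : ∀ w ∈ F, 0 < gc D u0 w.1 ∧ 0 < gc D u0 w.2 ∧ gc D u0 w.1 ^ 2 + gd D u0 w.1 ^ 2 = gc D u0 w.2 ^ 2 + gd D u0 w.2 ^ 2 ∧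
      |gd D u0 w.1| ≤ 4 * ((D : ℤ) * T) ∧ |gd D u0 w.2| ≤ 4 * ((D : ℤ) * T) := by
    intro w hw
    obtain ⟨h1, h2, h3⟩ := hF w hw
    obtain ⟨a1, a2, a3, -⟩ := good_facts h T0 h1
    obtain ⟨b1, b2, b3, -⟩ := good_facts h T0 h2
    exact ⟨by linarith, by linarith, by rw [a3, b3, h3], a2, b2⟩
  rw [← card_filter_add_card_filter_not (s := F) (fun w => gd D u0 w.1 ^ 2 = gd D u0 w.2 ^ 2)]
  have c1 := fib_gen (F.filter fun w => gd D u0 w.1 ^ 2 = gd D u0 w.2 ^ 2) (gBox T) (fun w => w.1) 2 (T ^ 2) (fun w hw => (hF w (mem_filter.1 hw).1).1)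
    (by simp only [gBox, card_product, Int.card_Ico]; simp [sq]) (by norm_num) (fun e _ L hL => by
      have inj : Set.InjOn (fun w : (ℤ × ℤ) × (ℤ × ℤ) => gd D u0 w.2) (L : Set ((ℤ × ℤ) × (ℤ × ℤ))) := by
        rintro ⟨x, y⟩ hx ⟨x', y'⟩ hx' e1
        obtain ⟨m1, m2⟩ := hL _ hx
        obtain ⟨m1', m2'⟩ := hL _ hx'
        obtain ⟨m1, m3⟩ := mem_filter.1 m1
        obtain ⟨m1', m3'⟩ := mem_filter.1 m1'
        have f1 := fact _ m1
        have f1' := fact _ m1'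
        dsimp only at *
        subst m2 m2'
        have : gc D u0 y ^ 2 = gc D u0 y' ^ 2 := by rw [e1] at f1; linarith [f1.2.2.1, f1'.2.2.1]
        rw [gcd_inj D0 ((pow_left_inj₀ f1.2.1.le f1'.2.1.le two_ne_zero).1 this) e1]
      rw [← card_image_of_injOn inj]
      have : (L.image fun w : (ℤ × ℤ) × (ℤ × ℤ) => gd D u0 w.2) ⊆ {gd D u0 e, -gd D u0 e} := by
        intro x hx
        obtain ⟨w, hw, rfl⟩ := mem_image.1 hx
        obtain ⟨m1, m2⟩ := hL _ hw
        have := (mem_filter.1 m1).2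
        rw [mem_insert, mem_singleton, ← m2]
        exact sq_eq_sq_iff_eq_or_eq_neg.1 this.symm
      exact_mod_cast (card_le_card this).trans card_le_two)
  have c2 := fib_gen (F.filter fun w => ¬ gd D u0 w.1 ^ 2 = gd D u0 w.2 ^ 2) (Icc (-(4 * ((D : ℤ) * T))) (4 * ((D : ℤ) * T)) ×ˢ Icc (-(4 * ((D : ℤ) * T))) (4 * ((D : ℤ) * T)))
    (fun w => (gd D u0 w.1, gd D u0 w.2)) τm (81 * D ^ 2 * T ^ 2) (fun w hw => by
      have := fact w (mem_filter.1 hw).1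
      exact mem_product.2 ⟨mem_Icc.2 (abs_le.1 this.2.2.2.1), mem_Icc.2 (abs_le.1 this.2.2.2.2)⟩)
    (by
      rw [card_product, Int.card_Icc, show (4 * ((D : ℤ) * T) + 1 - -(4 * ((D : ℤ) * T))) = ((8 * (D * T) + 1 : ℕ) : ℤ) by push_cast; ring, Int.toNat_natCast]
      push_cast; nlinarith) (by positivity) (fun p _ L hL => by
      rcases L.eq_empty_or_nonempty with rfl | ⟨w0, hw0⟩
      · rw [card_empty, Nat.cast_zero]; positivity
      obtain ⟨d, d2⟩ := p
      have base : ∀ w ∈ L, (0 < gc D u0 w.1 ∧ 0 < gc D u0 w.2) ∧ (gc D u0 w.1 - gc D u0 w.2) * (gc D u0 w.1 + gc D u0 w.2) = d2 ^ 2 - d ^ 2 ∧ d2 ^ 2 - d ^ 2 ≠ 0 ∧ |d| ≤ 4 * ((D : ℤ) * T) ∧ |d2| ≤ 4 * ((D : ℤ) * T) ∧ gd D u0 w.1 = d ∧ gd D u0 w.2 = d2 := by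
        intro w hw
        obtain ⟨m1, m2⟩ := hL _ hw
        obtain ⟨m1, m3⟩ := mem_filter.1 m1
        have f := fact w m1
        obtain ⟨rfl, rfl⟩ := Prod.mk.inj m2
        exact ⟨⟨f.1, f.2.1⟩, by linear_combination f.2.2.1, fun hc => m3 (by linarith), f.2.2.2.1, f.2.2.2.2, rfl, rfl⟩
      obtain ⟨-, -, hn, k1, k2, -⟩ := base w0 hw0
      refine le_trans ?_ (Nat.cast_le.2 (hτ (d2 ^ 2 - d ^ 2).natAbs (Int.natAbs_pos.2 hn) ?_))
      · refine Nat.cast_le.2 (card_le_card_of_injOn (fun w => (gc D u0 w.1 + gc D u0 w.2).natAbs) (fun w hw => ?_) ?_)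
        · obtain ⟨-, b2, -⟩ := base w hw
          exact Nat.mem_divisors.2 ⟨Int.natAbs_dvd_natAbs.2 (Dvd.intro_left _ b2), Int.natAbs_ne_zero.2 hn⟩
        · rintro ⟨x, y⟩ hx ⟨x', y'⟩ hx' e
          obtain ⟨b1, b2, -, -, -, b3, b4⟩ := base _ hx
          obtain ⟨b1', b2', -, -, -, b3', b4'⟩ := base _ hx'
          dsimp only at *
          have e' : gc D u0 x + gc D u0 y = gc D u0 x' + gc D u0 y' := by omega
          rw [e', ← b2'] at b2
          have := mul_right_cancel₀ (by linarith [b1'.1, b1'.2] : gc D u0 x' + gc D u0 y' ≠ 0) b2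
          rw [gcd_inj D0 (by linarith : gc D u0 x = gc D u0 x') (by rw [b3, b3']), gcd_inj D0 (by linarith : gc D u0 y = gc D u0 y') (by rw [b4, b4'])]
      · have l1 := sq_le_sq' (abs_le.1 k1).1 (abs_le.1 k1).2
        have l2 := sq_le_sq' (abs_le.1 k2).1 (abs_le.1 k2).2
        have : |d2 ^ 2 - d ^ 2| ≤ 16 * ((D : ℤ) ^ 2 * T ^ 2) := abs_le.2 ⟨by nlinarith [sq_nonneg d2], by nlinarith [sq_nonneg d]⟩
        rw [Int.abs_eq_natAbs] at this
        have : (d2 ^ 2 - d ^ 2).natAbs ≤ 16 * (D ^ 2 * T ^ 2) := by exact_mod_cast this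
        have h0 : 0 ≤ D ^ 2 * T ^ 2 := by positivity
        nlinarith)
  push_cast
  have k : (T : ℝ) ^ 2 * 2 ≤ 2 * D ^ 2 * T ^ 2 * τm := by
    have : 1 ≤ (D : ℝ) ^ 2 * τm := by nlinarith
    nlinarith [sq_nonneg (T : ℝ)]
  linarith

lemma trip_large {D T j τm : ℕ} {u0 ε : ℤ} (h : Par D u0) (T0 : 0 < T) (hε : ε ^ 2 = 1) (hτ : ∀ k : ℕ, 1 ≤ k → k ≤ 14000 * D ^ 2 * T ^ 2 → k.divisors.card ≤ τm)
    (F : Finset ((ℤ × ℤ) × (ℤ × ℤ) × (ℤ × ℤ))) (hF : ∀ w ∈ F, TripP D T u0 ε j w ∧ Squarefree (gN D u0 w.1)) :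
    (F.card : ℝ) ≤ 83 * D ^ 2 * T ^ 2 * τm * (τm * (25 * 4 ^ j / (10000 * D ^ 2 * T ^ 2) + 11 * 2 ^ j)) := by
  classical
  have D0 := h.1
  have hq : (0 : ℝ) < 10000 * D ^ 2 * T ^ 2 := by positivity
  refine fib_gen F (F.image fun w => (w.1, w.2.1)) (fun w => (w.1, w.2.1)) _ _ (fun w hw => mem_image_of_mem _ hw) (pairs_count h T0 hτ _ fun w hw => ?_) (by positivity) ?_
  · obtain ⟨w, hw', rfl⟩ := mem_image.1 hw
    have := (hF w hw').1
    exact ⟨this.1, this.2.1, this.2.2.2.1⟩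
  · rintro ⟨e, e2⟩ hk L hL
    obtain ⟨w0, hw0, e0⟩ := mem_image.1 hk
    obtain ⟨rfl, rfl⟩ := Prod.mk.inj e0
    obtain ⟨⟨b1, b2, -, b4, -⟩, sq⟩ := hF w0 hw0
    obtain ⟨-, -, -, -, f5, f6⟩ := good_facts h T0 b1
    obtain ⟨-, -, -, -, -, g6⟩ := good_facts h T0 b2
    obtain ⟨-, n1, n2, n3⟩ := gN_cast h T0 b1
    have := sig_count (c2 := gc D u0 w0.2.1) (d2 := ε * gd D u0 w0.2.1) sq f5 (f6.mul_left (by rw [mul_pow, hε, one_mul, b4]; exact g6)) j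
    have n3' : (10000 * D ^ 2 * T ^ 2 : ℝ) ≤ gN D u0 w0.1 := by exact_mod_cast n3
    have t' : ((gN D u0 w0.1).divisors.card : ℝ) ≤ τm := by exact_mod_cast hτ _ n1 n2
    refine le_trans (Nat.cast_le.2 (card_le_card_of_injOn (fun w => w.2.2) (fun w hw => ?_) ?_)) (this.trans ?_)
    · obtain ⟨m1, m2⟩ := hL w hw
      obtain ⟨m3, m4⟩ := Prod.mk.inj m2
      obtain ⟨⟨-, -, k1, -, k2⟩, -⟩ := hF w m1
      rw [m3, m4] at k2
      exact mem_filter.2 ⟨k1, k2⟩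
    · intro w hw w' hw' e
      have m2 := ((hL w hw).2).trans ((hL w' hw').2).symm
      obtain ⟨m3, m4⟩ := Prod.mk.inj m2
      exact Prod.ext m3 (Prod.ext m4 e)
    · gcongr

lemma diag_pair {a : ℕ} {c d c2 d2 N : ℤ} (ha0 : 0 < a) (ha : IsCoprime 4 (a : ℤ)) (hA : IsCoprime (c ^ 2 + d ^ 2) (a : ℤ)) (r J : ℕ) (hr : N < (r : ℤ) ^ 2) (hJ : 2 * r ≤ 4 ^ J)
    (F : Finset ((ℤ × ℤ) × (ℤ × ℤ)))
    (hF : ∀ w ∈ F, 0 < w.1.1 ∧ 0 < w.2.1 ∧ w.1.1 ^ 2 + w.1.2 ^ 2 = w.2.1 ^ 2 + w.2.2 ^ 2 ∧ w.1.1 ^ 2 + w.1.2 ^ 2 ≤ N ∧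
      IsCoprime (w.1.1 ^ 2 + w.1.2 ^ 2) (a : ℤ) ∧ (a : ℤ) ∣ c * w.1.2 - d * w.1.1 ∧ (a : ℤ) ∣ c2 * w.2.2 - d2 * w.2.1) :
    (F.card : ℝ) ≤ ∑ j ∈ range J, (((Sg a c d c2 (1 * d2) j).card : ℝ) + (Sg a c d c2 (-1 * d2) j).card) * (36 * r ^ 2 / (4 ^ j * a) + 14 * r / 2 ^ j) := by
  classical
  set B : Finset ((ℤ × ℤ) × (ℤ × ℤ)) := (Icc (-(2 * r : ℤ)) (2 * r) ×ˢ Icc (-(2 * r : ℤ)) (2 * r)) ×ˢ (Icc (-(2 * r : ℤ)) (2 * r) ×ˢ Icc (-(2 * r : ℤ)) (2 * r)) with hB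
  have mem : ∀ d2 w, QP a c d c2 d2 N w → w ∈ B := by
    rintro d2 ⟨⟨x, y⟩, ⟨u, v⟩⟩ ⟨h1, h2, h3, -⟩
    dsimp only at *
    have p : 1 ≤ x ^ 2 + y ^ 2 := by
      by_contra hc
      have hx : x = 0 := by nlinarith [sq_nonneg x, sq_nonneg y]
      have hy : y = 0 := by nlinarith [sq_nonneg x, sq_nonneg y]
      subst hx hy
      exact absurd h1 (by rw [isCoprime_zero_left]; norm_num)
    have n1 : x ^ 2 + y ^ 2 ≤ 4 * N := by nlinarith
    have n2 : u ^ 2 + v ^ 2 ≤ 4 * N := by nlinarith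
    have s : ∀ t : ℤ, t ^ 2 ≤ 4 * N → t ∈ Icc (-(2 * r : ℤ)) (2 * r) := fun t ht =>
      mem_Icc.2 (abs_le.1 (abs_le_of_sq_le_sq (by nlinarith) (by positivity)))
    rw [hB]
    exact mem_product.2 ⟨mem_product.2 ⟨s _ (by nlinarith [sq_nonneg y]), s _ (by nlinarith [sq_nonneg x])⟩,
      mem_product.2 ⟨s _ (by nlinarith [sq_nonneg v]), s _ (by nlinarith [sq_nonneg u])⟩⟩
  have := split_pairs ha F hF (B.filter (QP a c d c2 (1 * d2) N)) (B.filter (QP a c d c2 (-1 * d2) N)) (fun w hw => mem_filter.2 ⟨mem _ w hw, by rwa [one_mul]⟩)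
    (fun w hw => mem_filter.2 ⟨mem _ w hw, by rwa [neg_one_mul]⟩)
  have q1 := q_total ha0 hA r J hr hJ _ (fun w hw => (mem_filter.1 hw).2 : ∀ w ∈ B.filter (QP a c d c2 (1 * d2) N), _)
  have q2 := q_total ha0 hA r J hr hJ _ (fun w hw => (mem_filter.1 hw).2 : ∀ w ∈ B.filter (QP a c d c2 (-1 * d2) N), _)
  simp only [add_mul, sum_add_distrib]
  have t : (F.card : ℝ) ≤ (B.filter (QP a c d c2 (1 * d2) N)).card + (B.filter (QP a c d c2 (-1 * d2) N)).card := by exact_mod_cast this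
  linarith

def RP (D T : ℕ) (u0 N : ℤ) (w : (ℤ × ℤ) × (ℤ × ℤ)) : Prop := w.1 ∈ gBox T ∧ Squarefree (gN D u0 w.1) ∧ 0 < w.2.1 ∧ nrm w.2 ≤ N ∧ IsCoprime (nrm w.2) (gN D u0 w.1 : ℤ) ∧
  (gN D u0 w.1 : ℤ) ∣ gc D u0 w.1 * w.2.2 - gd D u0 w.1 * w.2.1

lemma diag_sum {D T : ℕ} {u0 N : ℤ} (h : Par D u0) (T0 : 0 < T) (r J : ℕ) (hr : N < (r : ℤ) ^ 2) (hJ : 2 * r ≤ 4 ^ J) (b : ℕ → ℝ)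
    (hb : ∀ j, ∀ ε : ℤ, ε ^ 2 = 1 → ∀ F : Finset ((ℤ × ℤ) × (ℤ × ℤ) × (ℤ × ℤ)), (∀ w ∈ F, TripP D T u0 ε j w ∧ Squarefree (gN D u0 w.1)) → (F.card : ℝ) ≤ b j)
    (P : Finset (((ℤ × ℤ) × (ℤ × ℤ)) × ((ℤ × ℤ) × (ℤ × ℤ))))
    (hP : ∀ p ∈ P, RP D T u0 N p.1 ∧ RP D T u0 N p.2 ∧ gN D u0 p.1.1 = gN D u0 p.2.1 ∧ nrm p.1.2 = nrm p.2.2) :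
    (P.card : ℝ) ≤ ∑ j ∈ range J, (2 * b j) * (36 * r ^ 2 / (4 ^ j * (10000 * D ^ 2 * T ^ 2)) + 14 * r / 2 ^ j) := by
  classical
  have D0 := h.1
  set f : ((ℤ × ℤ) × (ℤ × ℤ)) × ((ℤ × ℤ) × (ℤ × ℤ)) → (ℤ × ℤ) × (ℤ × ℤ) := fun p => (p.1.1, p.2.1) with hf
  set Pe := P.image f with hPe
  have hpe : ∀ e ∈ Pe, e.1 ∈ gBox T ∧ e.2 ∈ gBox T ∧ Squarefree (gN D u0 e.1) ∧ gN D u0 e.1 = gN D u0 e.2 := by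
    intro e he
    obtain ⟨p, hp, rfl⟩ := mem_image.1 he
    obtain ⟨h1, h2, h3, -⟩ := hP p hp
    exact ⟨h1.1, h2.1, h1.2.1, h3⟩
  have fib : ∀ e ∈ Pe, ((P.filter fun p => f p = e).card : ℝ) ≤ ∑ j ∈ range J, (((Sg (gN D u0 e.1) (gc D u0 e.1) (gd D u0 e.1) (gc D u0 e.2) (1 * gd D u0 e.2) j).card : ℝ) +
      (Sg (gN D u0 e.1) (gc D u0 e.1) (gd D u0 e.1) (gc D u0 e.2) (-1 * gd D u0 e.2) j).card) * (36 * r ^ 2 / (4 ^ j * (10000 * D ^ 2 * T ^ 2)) + 14 * r / 2 ^ j) := by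
    intro e he
    obtain ⟨k1, k2, k3, k4⟩ := hpe e he
    obtain ⟨-, -, -, -, f5, f6⟩ := good_facts h T0 k1
    obtain ⟨-, n1, -, n3⟩ := gN_cast h T0 k1
    have n3' : (10000 * D ^ 2 * T ^ 2 : ℝ) ≤ gN D u0 e.1 := by exact_mod_cast n3
    have inj : Set.InjOn (fun p : ((ℤ × ℤ) × (ℤ × ℤ)) × ((ℤ × ℤ) × (ℤ × ℤ)) => (p.1.2, p.2.2)) ((P.filter fun p => f p = e : Finset _) : Set (((ℤ × ℤ) × (ℤ × ℤ)) × ((ℤ × ℤ) × (ℤ × ℤ)))) := by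
      intro p hp p' hp' e1
      have m := ((mem_filter.1 hp).2).trans ((mem_filter.1 hp').2).symm
      obtain ⟨m1, m2⟩ := Prod.mk.inj m
      obtain ⟨m3, m4⟩ := Prod.mk.inj e1
      exact Prod.ext (Prod.ext m1 m3) (Prod.ext m2 m4)
    rw [← card_image_of_injOn inj]
    refine (diag_pair (c2 := gc D u0 e.2) (d2 := gd D u0 e.2) n1 f5 f6 r J hr hJ _ fun w hw => ?_).trans ?_
    · obtain ⟨p, hp, rfl⟩ := mem_image.1 hw
      obtain ⟨hp', rfl⟩ := mem_filter.1 hp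
      obtain ⟨⟨-, -, a3, a4, a5, a6⟩, ⟨-, -, b3, -, -, b6⟩, h3, h4⟩ := hP p hp'
      exact ⟨a3, b3, h4, a4, a5, a6, by dsimp only [hf]; rw [h3]; exact b6⟩
    · gcongr
  rw [card_eq_sum_card_fiberwise (f := f) (t := Pe) (fun p hp => mem_image_of_mem f hp)]
  push_cast
  refine (sum_le_sum fib).trans ?_
  rw [sum_comm]
  refine sum_le_sum fun j _ => ?_
  rw [← sum_mul]
  refine mul_le_mul_of_nonneg_right ?_ (by positivity)
  have tr : ∀ ε : ℤ, ε ^ 2 = 1 → ∑ e ∈ Pe, ((Sg (gN D u0 e.1) (gc D u0 e.1) (gd D u0 e.1) (gc D u0 e.2) (ε * gd D u0 e.2) j).card : ℝ) ≤ b j := by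
    intro ε hε
    have := hb j ε hε ((Pe.sigma fun e => Sg (gN D u0 e.1) (gc D u0 e.1) (gd D u0 e.1) (gc D u0 e.2) (ε * gd D u0 e.2) j).image fun x => (x.1.1, x.1.2, x.2)) (fun w hw => by
      obtain ⟨⟨e, s⟩, hx, rfl⟩ := mem_image.1 hw
      obtain ⟨h1, h2⟩ := mem_sigma.1 hx
      obtain ⟨k1, k2, k3, k4⟩ := hpe e h1
      obtain ⟨l1, l2⟩ := mem_filter.1 h2
      exact ⟨⟨k1, k2, l1, k4, l2⟩, k3⟩)
    rw [card_image_of_injOn, card_sigma] at this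
    · push_cast at this; exact this
    · rintro ⟨⟨e, e2⟩, s⟩ - ⟨⟨e', e2'⟩, s'⟩ - hh
      simp only [Prod.mk.injEq] at hh
      obtain ⟨rfl, rfl, rfl⟩ := hh
      rfl
  rw [sum_add_distrib]
  linarith [tr 1 (by norm_num), tr (-1) (by norm_num)]

lemma geo_two (c : ℝ) (hc : 0 ≤ c) (J0 J : ℕ) : ∑ j ∈ Ico J0 J, c / 2 ^ j ≤ 2 * c / 2 ^ J0 := by
  have : ∀ J, J0 ≤ J → ∑ j ∈ Ico J0 J, c / 2 ^ j ≤ 2 * c / 2 ^ J0 - 2 * c / 2 ^ J := by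
    intro J hJ
    induction J, hJ using Nat.le_induction with
    | base => simp
    | succ n hn ih =>
      rw [sum_Ico_succ_top hn]
      have : 2 * c / 2 ^ (n + 1) = c / 2 ^ n := by rw [pow_succ]; field_simp
      have : 2 * c / 2 ^ n = c / 2 ^ n + c / 2 ^ n := by ring
      linarith
  rcases le_or_gt J0 J with h | h
  · have h1 := this J h
    have : 0 ≤ 2 * c / 2 ^ J := by positivity
    linarith
  · rw [Ico_eq_empty (by omega), sum_empty]; positivity

lemma geo_pow (J0 J : ℕ) : ∑ j ∈ Ico J0 J, (2 : ℝ) ^ j ≤ 2 ^ J := by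
  have h1 : ∑ j ∈ Ico J0 J, (2 : ℝ) ^ j ≤ ∑ j ∈ range J, (2 : ℝ) ^ j :=
    sum_le_sum_of_subset_of_nonneg (fun x hx => mem_range.2 (mem_Ico.1 hx).2) fun _ _ _ => by positivity
  rw [geom_sum_eq (by norm_num)] at h1
  linarith

lemma diag_bound {D T : ℕ} {u0 N : ℤ} (h : Par D u0) (T0 : 0 < T) (r J J0 τm : ℕ) (hr : N < (r : ℤ) ^ 2) (hJ : 2 * r ≤ 4 ^ J) (hJJ : J0 ≤ J)
    (hτ : ∀ k : ℕ, 1 ≤ k → k ≤ 14000 * D ^ 2 * T ^ 2 → k.divisors.card ≤ τm) (hT : 4096 ^ J0 ≤ T) (c1 : τm ^ 2 ≤ 2 ^ J0) (c2 : J * τm ^ 2 ≤ T ^ 2) (c3 : τm ^ 2 * 2 ^ J ≤ r)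
    (c4 : D ^ 2 * T ^ 2 * τm ^ 2 * J ≤ r) (c5 : D * T ^ 2 ≤ r)
    (P : Finset (((ℤ × ℤ) × (ℤ × ℤ)) × ((ℤ × ℤ) × (ℤ × ℤ))))
    (hP : ∀ p ∈ P, RP D T u0 N p.1 ∧ RP D T u0 N p.2 ∧ gN D u0 p.1.1 = gN D u0 p.2.1 ∧ nrm p.1.2 = nrm p.2.2) :
    (P.card : ℝ) ≤ 10 ^ 11 * r ^ 2 := by
  have D0 := h.1
  have Dr : 1 ≤ (D : ℝ) := by exact_mod_cast D0
  have Tr : 1 ≤ (T : ℝ) := by exact_mod_cast T0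
  set b : ℕ → ℝ := fun j => if j < J0 then 2 * 10 ^ 8 * (D * T ^ 2) else 83 * D ^ 2 * T ^ 2 * τm * (τm * (25 * 4 ^ j / (10000 * D ^ 2 * T ^ 2) + 11 * 2 ^ j)) with hbd
  have S := diag_sum h T0 r J hr hJ b (fun j ε hε F hF => by
    simp only [hbd]
    split_ifs with hj
    · have p1 : (4 ^ (j + 1)) ^ 6 ≤ T := by
        refine le_trans ?_ hT
        rw [← pow_mul, mul_comm, pow_mul]; exact Nat.pow_le_pow_right (by norm_num) hj
      have p2 : 4 ^ (j + 1) ≤ T := le_trans (Nat.le_self_pow (by norm_num) _) p1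
      refine (trip_small h hε p2 F fun w hw => (hF w hw).1).trans ?_
      have p3 : ((4 : ℝ) ^ j) ^ 6 ≤ T := by
        refine le_trans ?_ ((Nat.cast_le (α := ℝ)).2 p1)
        push_cast
        gcongr <;> norm_num
      have : (T : ℝ) * (4 ^ j) ^ 6 ≤ D * T ^ 2 := by
        calc (T : ℝ) * (4 ^ j) ^ 6 ≤ T * T := by gcongr
          _ ≤ D * T ^ 2 := by nlinarith
      linarith
    · exact trip_large h T0 hε hτ F hF) P hP
  refine S.trans ?_
  obtain ⟨R, hR⟩ : ∃ R : ℝ, R = r := ⟨_, rfl⟩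
  obtain ⟨t, ht⟩ : ∃ t : ℝ, t = τm := ⟨_, rfl⟩
  obtain ⟨q, hq⟩ : ∃ q : ℝ, q = D ^ 2 * T ^ 2 := ⟨_, rfl⟩
  have q1 : 1 ≤ q := by rw [hq]; exact one_le_mul_of_one_le_of_one_le (one_le_pow₀ Dr) (one_le_pow₀ Tr)
  have R0 : 0 ≤ R := by rw [hR]; positivity
  have t0 : 0 ≤ t := by rw [ht]; positivity
  have k1 : t ^ 2 ≤ 2 ^ J0 := by rw [ht]; exact_mod_cast c1
  have k2 : J * t ^ 2 ≤ q := by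
    have : J * t ^ 2 ≤ (T : ℝ) ^ 2 := by rw [ht]; exact_mod_cast c2
    rw [hq]; exact this.trans (le_mul_of_one_le_left (by positivity) (one_le_pow₀ Dr))
  have k3 : t ^ 2 * 2 ^ J ≤ R := by rw [ht, hR]; exact_mod_cast c3
  have k4 : q * t ^ 2 * J ≤ R := by rw [ht, hR, hq]; exact_mod_cast c4
  have k5 : (D * T ^ 2 : ℝ) ≤ R := by rw [hR]; exact_mod_cast c5
  have k6 : (D * T ^ 2 : ℝ) ≤ q := by rw [hq]; nlinarith [sq_nonneg (T : ℝ)]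
  rw [range_eq_Ico, ← sum_Ico_consecutive _ (Nat.zero_le J0) hJJ, ← hR]
  have A : ∑ j ∈ Ico 0 J0, 2 * b j * (36 * R ^ 2 / (4 ^ j * (10000 * D ^ 2 * T ^ 2)) + 14 * R / 2 ^ j) ≤ 2 * (6 * 10 ^ 9 * R ^ 2) / 2 ^ 0 := by
    refine le_trans (sum_le_sum fun j hj => ?_) (geo_two _ (by positivity) 0 J0)
    simp only [hbd, if_pos (mem_Ico.1 hj).2]
    have e2 : (1 : ℝ) ≤ 2 ^ j := one_le_pow₀ (by norm_num)
    have e4 : (4 : ℝ) ^ j = 2 ^ j * 2 ^ j := by rw [← mul_pow]; norm_num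
    have w1 : 36 * R ^ 2 / (4 ^ j * (10000 * D ^ 2 * T ^ 2)) ≤ 36 * R ^ 2 / (10000 * q) / 2 ^ j := by
      rw [div_div, e4, hq]
      refine div_le_div_of_nonneg_left (by positivity) (by positivity) ?_
      rw [show 10000 * ((D : ℝ) ^ 2 * T ^ 2) * 2 ^ j = 2 ^ j * 1 * (10000 * D ^ 2 * T ^ 2) by ring]
      gcongr
    calc _ ≤ 2 * (2 * 10 ^ 8 * (D * T ^ 2)) * (36 * R ^ 2 / (10000 * q) / 2 ^ j + 14 * R / 2 ^ j) := by gcongr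
      _ = (4 * 10 ^ 8) * ((D * T ^ 2) * (36 * R ^ 2 / (10000 * q)) + (D * T ^ 2) * (14 * R)) / 2 ^ j := by ring
      _ ≤ (4 * 10 ^ 8) * (q * (36 * R ^ 2 / (10000 * q)) + R * (14 * R)) / 2 ^ j := by gcongr
      _ = (4 * 10 ^ 8) * (36 * R ^ 2 / 10000 + R * (14 * R)) / 2 ^ j := by rw [show q * (36 * R ^ 2 / (10000 * q)) = 36 * R ^ 2 / 10000 by field_simp]
      _ ≤ _ := div_le_div_of_nonneg_right (by nlinarith [sq_nonneg R]) (by positivity)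
  have B : ∑ j ∈ Ico J0 J, 2 * b j * (36 * R ^ 2 / (4 ^ j * (10000 * D ^ 2 * T ^ 2)) + 14 * R / 2 ^ j) ≤
      ∑ j ∈ Ico J0 J, (t ^ 2 * R ^ 2 / q + 6 * R * (t ^ 2 * 2 ^ j) + 10 * t ^ 2 * R ^ 2 / 2 ^ j + 30000 * R * (q * t ^ 2)) := by
    refine sum_le_sum fun j hj => ?_
    simp only [hbd, if_neg (not_lt.2 (mem_Ico.1 hj).1)]
    have e4 : (4 : ℝ) ^ j = 2 ^ j * 2 ^ j := by rw [← mul_pow]; norm_num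
    rw [e4, ← ht, show (10000 * (D : ℝ) ^ 2 * T ^ 2) = 10000 * q by rw [hq]; ring, show (83 * (D : ℝ) ^ 2 * T ^ 2) = 83 * q by rw [hq]; ring]
    obtain ⟨p, hp⟩ : ∃ p : ℝ, p = 2 ^ j := ⟨_, rfl⟩
    have p0 : 0 < p := by rw [hp]; positivity
    rw [← hp]
    clear_value b
    clear hR ht hq
    have : 2 * (83 * q * t * (t * (25 * (p * p) / (10000 * q) + 11 * p))) * (36 * R ^ 2 / (p * p * (10000 * q)) + 14 * R / p) =
        (166 * 25 * 36 / 10 ^ 8) * (t ^ 2 * R ^ 2 / q) + (166 * 25 * 14 / 10000) * (R * (t ^ 2 * p)) + (166 * 11 * 36 / 10000) * (t ^ 2 * R ^ 2 / p) + (166 * 11 * 14) * (R * (q * t ^ 2)) := by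
      have q0 : q ≠ 0 := by linarith
      field_simp
      ring
    rw [this]
    have u1 : 0 ≤ t ^ 2 * R ^ 2 / q := by positivity
    have u2 : 0 ≤ R * (t ^ 2 * p) := by positivity
    have u3 : 0 ≤ t ^ 2 * R ^ 2 / p := by positivity
    have u4 : 0 ≤ R * (q * t ^ 2) := by positivity
    have : 10 * t ^ 2 * R ^ 2 / p = 10 * (t ^ 2 * R ^ 2 / p) := by ring
    rw [this]
    linarith
  have Cc : (((J - J0 : ℕ)) : ℝ) ≤ J := by exact_mod_cast Nat.sub_le J J0
  simp only [sum_add_distrib, sum_const, Nat.card_Ico, nsmul_eq_mul, ← mul_sum] at B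
  have B1 : ((J - J0 : ℕ) : ℝ) * (t ^ 2 * R ^ 2 / q) ≤ R ^ 2 := by
    calc _ ≤ (J : ℝ) * (t ^ 2 * R ^ 2 / q) := by gcongr
      _ = (J * t ^ 2) * R ^ 2 / q := by ring
      _ ≤ q * R ^ 2 / q := by gcongr
      _ = R ^ 2 := by field_simp
  have B2 : 6 * R * (t ^ 2 * ∑ j ∈ Ico J0 J, (2 : ℝ) ^ j) ≤ 6 * R ^ 2 := by
    calc _ ≤ 6 * R * (t ^ 2 * 2 ^ J) := by gcongr; exact geo_pow J0 J
      _ ≤ 6 * R * R := by gcongr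
      _ = _ := by ring
  have B3 := geo_two (10 * t ^ 2 * R ^ 2) (by positivity) J0 J
  have B4 : 2 * (10 * t ^ 2 * R ^ 2) / 2 ^ J0 ≤ 20 * R ^ 2 := by
    rw [div_le_iff₀ (by positivity)]
    nlinarith [sq_nonneg R]
  have B5 : ((J - J0 : ℕ) : ℝ) * (30000 * R * (q * t ^ 2)) ≤ 30000 * R ^ 2 := by
    calc _ ≤ (J : ℝ) * (30000 * R * (q * t ^ 2)) := by gcongr
      _ = 30000 * R * (q * t ^ 2 * J) := by ring
      _ ≤ 30000 * R * R := by gcongr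
      _ = _ := by ring
  have R2 := sq_nonneg R
  rw [pow_zero, div_one] at A
  linarith

lemma zfacts {A a c d X Y z1 z2 m q : ℤ} (ha : a = A + 10) (hA : 1000 ≤ A) (hcd : c ^ 2 + d ^ 2 = A) (hc : 100 * q ≤ c) (hd : |d| ≤ 4 * q) (hq : 1 ≤ q) (hm : 1 ≤ m)
    (X1 : 20 * m * A ≤ X) (X2 : X ≤ 22 * m * A) (Y1 : 0 ≤ Y) (Y2 : Y ≤ a * m) (e1 : c * z1 + d * z2 = X) (e2 : c * z2 - d * z1 = Y) :
    0 < z1 ∧ |z2| < z1 ∧ z1 ^ 2 + z2 ^ 2 ≤ 500 * a * m ^ 2 ∧ a < z1 ^ 2 + z2 ^ 2 := by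
  have A0 : 0 < A := by linarith
  obtain ⟨P, hP⟩ : ∃ P, P = m * A := ⟨_, rfl⟩
  have P0 : 0 < P := by rw [hP]; positivity
  rw [mul_assoc, ← hP] at X1 X2
  have mA : 1000 * m ≤ P := by rw [hP]; nlinarith
  have am : a * m = P + 10 * m := by rw [ha, hP]; ring
  have Y3 : 100 * Y ≤ 101 * P := by linarith
  have n1 : A * (z1 ^ 2 + z2 ^ 2) = X ^ 2 + Y ^ 2 := by rw [← hcd, ← e1, ← e2]; ring
  have f1 : A * z1 = c * X - d * Y := by rw [← hcd, ← e1, ← e2]; ring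
  have f2 : A * z2 = d * X + c * Y := by rw [← hcd, ← e1, ← e2]; ring
  have c0 : 0 < c := by linarith
  have X0 : 0 ≤ X := by linarith
  obtain ⟨d1, d2⟩ := abs_le.1 hd
  have g1 : c * (20 * P) ≤ c * X := by gcongr
  have g2 : d * Y ≤ 4 * q * Y := by gcongr
  have g2' : -(4 * q * Y) ≤ d * Y := by have := mul_le_mul_of_nonneg_right d1 Y1; linarith
  have g3 : d * X ≤ 4 * q * X := by gcongr
  have g3' : -(4 * q * X) ≤ d * X := by have := mul_le_mul_of_nonneg_right d1 X0; linarith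
  have g4 : q * (100 * Y) ≤ q * (101 * P) := by gcongr
  have g5 : c * (100 * Y) ≤ c * (101 * P) := by gcongr
  have g6 : q * X ≤ q * (22 * P) := by gcongr
  have g7 : 100 * q * P ≤ c * P := by gcongr
  have g8 : 0 < q * P := by positivity
  have g9 : 0 ≤ c * Y := by positivity
  have l1 : A * |z2| < A * z1 := by
    rw [← abs_of_pos A0, ← abs_mul, abs_of_pos A0, abs_lt]
    rw [f1, f2]
    constructor <;> linarith
  have l2 := lt_of_mul_lt_mul_left l1 A0.le
  have x1 : (20 * P) ^ 2 ≤ X ^ 2 := by gcongr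
  have x2 : X ^ 2 ≤ (22 * P) ^ 2 := by gcongr
  have y2 : (100 * Y) ^ 2 ≤ (101 * P) ^ 2 := by gcongr
  have PP : 0 < P ^ 2 := by positivity
  refine ⟨lt_of_le_of_lt (abs_nonneg _) l2, l2, ?_, ?_⟩
  · refine le_of_mul_le_mul_left (a := A) ?_ A0
    have : A * (500 * a * m ^ 2) = 500 * P ^ 2 + 5000 * (m * P) := by rw [ha, hP]; ring
    have : 0 ≤ m * P := by positivity
    rw [n1]; linarith
  · refine lt_of_mul_lt_mul_left (a := A) ?_ A0.le
    have k : A * A ≤ P ^ 2 := by rw [hP, mul_pow, ← pow_two]; exact le_mul_of_one_le_left (sq_nonneg A) (one_le_pow₀ hm)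
    have : 1000 * A ≤ A * A := by gcongr
    rw [n1, ha]
    linarith [sq_nonneg Y]

def RQ (D T : ℕ) (u0 N : ℤ) (w : (ℤ × ℤ) × (ℤ × ℤ)) : Prop := RP D T u0 N w ∧ |w.2.2| < w.2.1 ∧ (gN D u0 w.1 : ℤ) < nrm w.2 ∧ nrm w.2 - gN D u0 w.1 ∈ curvatures

lemma mass_e {D T : ℕ} {u0 N : ℤ} (h : Par D u0) (T0 : 0 < T) {C0 : ℝ} {e : ℤ × ℤ} (he : e ∈ gBox T) (hg : GoodE D u0 C0 e) (M : ℕ)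
    (hM : 10 + 2 * Real.log M + gN D u0 e ≤ M / 20) (hN : 500 * (gN D u0 e : ℤ) * M ^ 2 ≤ N) :
    ∃ F : Finset (ℤ × ℤ), (M : ℝ) ^ 2 / 10 ≤ F.card ∧ ∀ z ∈ F, RQ D T u0 N (e, z) := by
  classical
  obtain ⟨g1, g2, g3, g4, g5, g6⟩ := good_facts h T0 he
  obtain ⟨n1, n2, n3, n4⟩ := gN_cast h T0 he
  obtain ⟨q1, q2, q3, q4, q5⟩ := hg
  obtain ⟨A, hA⟩ : ∃ A, A = gc D u0 e ^ 2 + gd D u0 e ^ 2 := ⟨_, rfl⟩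
  rw [← hA] at g6 g3
  have M0 : 1 ≤ M := by
    by_contra hc
    have : M = 0 := by omega
    subst this
    norm_num at hM
    have : (0 : ℝ) ≤ gN D u0 e := by positivity
    linarith
  have q0 : 1 ≤ D * T := Nat.mul_pos h.1 T0
  have A1 : 1000 ≤ A := by
    have : 10000 * 1 ≤ gN D u0 e := le_trans (by rw [mul_assoc, ← mul_pow]; gcongr; exact Nat.one_le_pow _ _ q0) n4
    omega
  obtain ⟨B, B0, B1, HB⟩ := packing (gU D u0 e) (gV D e) q1 A (by rw [hA]; simp only [gc, gd]; ring) (by linarith)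
  choose! f g hfg using HB
  have key := xy_mass A B (gN D u0 e) M n2.ne' g6 q5 hM
  set Q := (Ioc (20 * M : ℤ) (20 * M + M) ×ˢ Ioc (0 : ℤ) (0 + M)).filter fun w : ℤ × ℤ =>
      IsCoprime w.1 w.2 ∧ IsCoprime (A * w.1 + B * w.2) (gN D u0 e : ℤ) with hQ
  have ha : (gN D u0 e : ℤ) = A + 10 := by linarith
  have hm : ∀ w ∈ Q, (20 * M < w.1 ∧ w.1 ≤ 20 * M + M) ∧ (0 < w.2 ∧ w.2 ≤ M) ∧ IsCoprime w.1 w.2 ∧ IsCoprime (A * w.1 + B * w.2) (gN D u0 e : ℤ) ∧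
      nrm (f w.1 w.2, g w.1 w.2) - gN D u0 e ∈ curvatures ∧ gc D u0 e * f w.1 w.2 + gd D u0 e * g w.1 w.2 = A * w.1 + B * w.2 ∧
      gc D u0 e * g w.1 w.2 - gd D u0 e * f w.1 w.2 = gN D u0 e * w.2 := by
    intro w hw
    rw [hQ, mem_filter, mem_product, mem_Ioc, mem_Ioc, zero_add] at hw
    obtain ⟨⟨w1, w2⟩, w3, w4⟩ := hw
    rw [ha]
    exact ⟨w1, w2, w3, by rw [← ha]; exact w4, hfg _ _ w3⟩
  refine ⟨Q.image fun w => (f w.1 w.2, g w.1 w.2), ?_, ?_⟩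
  · rw [card_image_of_injOn]
    · exact key
    intro w hw w' hw' hh
    obtain ⟨-, -, -, -, -, a1, a2⟩ := hm w hw
    obtain ⟨-, -, -, -, -, b1, b2⟩ := hm w' hw'
    simp only [Prod.mk.injEq] at hh
    rw [hh.1, hh.2] at a1 a2
    have y : w.2 = w'.2 := mul_left_cancel₀ (a := (gN D u0 e : ℤ)) (by linarith) (a2.symm.trans b2)
    have x : w.1 = w'.1 := mul_left_cancel₀ (a := A) (by linarith) (by rw [y] at a1; linarith)
    exact Prod.ext x y
  · intro z hz
    obtain ⟨w, hw, rfl⟩ := mem_image.1 hz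
    obtain ⟨⟨x1, x2⟩, ⟨y1, y2⟩, -, k1, k2, k3, k4⟩ := hm w hw
    have m1 : (1 : ℤ) ≤ M := by exact_mod_cast M0
    have A0 : 0 < A := by linarith
    have By : 0 ≤ B * w.2 := by positivity
    have By2 : B * w.2 ≤ A * M := by gcongr
    have Z := zfacts ha A1 hA.symm g1 g2 (by exact_mod_cast q0) m1 (X := A * w.1 + B * w.2) (Y := gN D u0 e * w.2) (by nlinarith) (by nlinarith) (by positivity)
      (by gcongr) k3 k4
    obtain ⟨z1, z2, z3, z4⟩ := Z
    refine ⟨⟨he, q2, z1, z3.trans hN, ?_, ?_⟩, z2, z4, k2⟩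
    · have n1 : A * nrm (f w.1 w.2, g w.1 w.2) = (A * w.1 + B * w.2) ^ 2 + gN D u0 e * (gN D u0 e * w.2 ^ 2) := by
        rw [show (gN D u0 e : ℤ) * (gN D u0 e * w.2 ^ 2) = (gN D u0 e * w.2) ^ 2 by ring, ← k3, ← k4, hA]; simp only [nrm]; ring
      have : IsCoprime (A * nrm (f w.1 w.2, g w.1 w.2)) (gN D u0 e : ℤ) := by
        rw [n1]; exact IsCoprime.add_mul_left_left (k1.pow_left) _
      exact this.of_mul_left_right
    · exact ⟨w.2, k4⟩

lemma Jf_G9 (n : ℕ) : Jf n ≤ G9s n := by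
  refine sum_le_sum fun d hd => div_le_div_of_nonneg_right ?_ (by positivity)
  have : 1 ≤ d.divisors.card := card_pos.2 (Nat.nonempty_divisors.2 (Nat.pos_of_mem_divisors hd).ne')
  exact_mod_cast Nat.le_self_pow (by norm_num) _

lemma adm_of {D T : ℕ} {u0 : ℤ} (h : Par D u0) (T0 : 0 < T) {C0 : ℝ} {e : ℤ × ℤ} (he : e ∈ gBox T) (hg : GoodE D u0 C0 e) :
    Adm (gN D u0 e) (gc D u0 e) (gd D u0 e) := by
  obtain ⟨-, -, g3, g4, -⟩ := good_facts h T0 he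
  exact ⟨hg.2.1, by linarith, hg.2.2.1, g4⟩

open Classical in
lemma off_pair {D T : ℕ} {u0 N : ℤ} (h : Par D u0) (T0 : 0 < T) {C0 : ℝ} {e e2 : ℤ × ℤ} (he : e ∈ gBox T) (hg : GoodE D u0 C0 e)
    (he2 : e2 ∈ gBox T) (hg2 : GoodE D u0 C0 e2) (hne : gN D u0 e ≠ gN D u0 e2) (r W : ℕ) (hr : N < (r : ℤ) ^ 2)
    (hX : (14000 * D ^ 2 * T ^ 2) ^ 4 ≤ 2 * r) (hW : 3 * (14000 * D ^ 2 * T ^ 2) ^ 16 ≤ W) (E : ℝ) (hE : (((Ioc 0 (2 * r)).filter fun q => Exc W q).card : ℝ) ≤ E)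
    (G : Finset ((ℤ × ℤ) × (ℤ × ℤ)))
    (hG : ∀ p ∈ G, RQ D T u0 N (e, p.1) ∧ RQ D T u0 N (e2, p.2) ∧ nrm p.1 - gN D u0 e = nrm p.2 - gN D u0 e2) :
    (G.card : ℝ) ≤ 296 * (2 * r) ^ 2 / (10000 * D ^ 2 * T ^ 2) ^ 2 * C0 ^ 2 * (((gN D u0 e).gcd (gN D u0 e2)).divisors.card ^ 4 * Yf ((gN D u0 e : ℤ) - gN D u0 e2).natAbs) +
      8 * r * (14000 * D ^ 2 * T ^ 2) * E := by
  obtain ⟨-, n2, n3, n4⟩ := gN_cast h T0 he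
  obtain ⟨-, m2, m3, m4⟩ := gN_cast h T0 he2
  have D0 := h.1
  obtain ⟨f, hf⟩ : ∃ f : (ℤ × ℤ) × (ℤ × ℤ) → ℕ × (ℤ × ℤ), f = fun p => ((p.1.1 + p.2.1).toNat, (p.1.2 - p.2.2, p.1.2 + p.2.2)) := ⟨_, rfl⟩
  have fac : ∀ p ∈ G, 0 < p.1.1 ∧ 0 < p.2.1 ∧ |p.1.2| < p.1.1 ∧ |p.2.2| < p.2.1 ∧ p.1.1 < r ∧ p.2.1 < r ∧ (p.1.1 - p.2.1) * (p.1.1 + p.2.1) + (p.1.2 - p.2.2) * (p.1.2 + p.2.2) = gN D u0 e - gN D u0 e2 ∧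
     (gN D u0 e : ℤ) ∣ gc D u0 e * p.1.2 - gd D u0 e * p.1.1 ∧ (gN D u0 e2 : ℤ) ∣ gc D u0 e2 * p.2.2 - gd D u0 e2 * p.2.1 := by
    rintro ⟨⟨x, y⟩, ⟨x2, y2⟩⟩ hp
    obtain ⟨⟨⟨-, -, a1, a2, -, a3⟩, a4, -⟩, ⟨⟨-, -, b1, b2, -, b3⟩, b4, -⟩, ab⟩ := hG _ hp
    simp only [nrm] at *
    refine ⟨a1, b1, a4, b4, ?_, ?_, by linarith, a3, b3⟩
    · exact lt_of_pow_lt_pow_left₀ 2 (by positivity) (by nlinarith [sq_nonneg y])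
    · exact lt_of_pow_lt_pow_left₀ 2 (by positivity) (by nlinarith [sq_nonneg y2])
  have inj : Set.InjOn f G := by
    intro p hp p' hp' hh
    obtain ⟨a1, a2, -, -, -, -, a3, -⟩ := fac p hp
    obtain ⟨b1, b2, -, -, -, -, b3, -⟩ := fac p' hp'
    simp only [hf, Prod.mk.injEq] at hh
    obtain ⟨h1, h2, h3⟩ := hh
    have h4 : p.1.1 + p.2.1 = p'.1.1 + p'.2.1 := by omega
    rw [h2, h3, h4] at a3
    have h5 : p.1.1 - p.2.1 = p'.1.1 - p'.2.1 := mul_right_cancel₀ (b := p'.1.1 + p'.2.1) (by linarith) (by linarith)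
    exact Prod.ext (Prod.ext (by linarith) (by linarith)) (Prod.ext (by linarith) (by linarith))
  have aa : gN D u0 e * gN D u0 e2 ≤ (14000 * D ^ 2 * T ^ 2) ^ 2 := by rw [pow_two]; exact Nat.mul_le_mul n3 m3
  have key := off_sum (adm_of h T0 he hg) (adm_of h T0 he2 hg2) (le_trans (by
      rw [mul_assoc]; exact le_trans (by norm_num) (Nat.mul_le_mul_left 10000 (Nat.mul_pos (pow_pos D0 2) (pow_pos T0 2)))) n4) hne (2 * r) W
    (le_trans (le_trans (Nat.pow_le_pow_left aa 2) (by rw [← pow_mul])) hX) (le_trans (Nat.mul_le_mul_left 3 (le_trans (Nat.pow_le_pow_left aa 8) (by rw [← pow_mul]))) hW) (G.image f) (by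
    intro w hw
    obtain ⟨p, hp, rfl⟩ := mem_image.1 hw
    obtain ⟨a1, a2, a3, a4, a5, a6, a7, a8, a9⟩ := fac p hp
    rw [abs_lt] at a3 a4
    simp only [hf]
    have tn : ((p.1.1 + p.2.1).toNat : ℤ) = p.1.1 + p.2.1 := Int.toNat_of_nonneg (by linarith)
    refine ⟨by omega, by omega, by rw [tn]; constructor <;> linarith, by rw [tn]; constructor <;> linarith, p.1.1 - p.2.1, by rw [tn]; exact a7, ?_, ?_⟩
    · rw [tn]
      refine (Dvd.dvd.mul_left a8 2).trans (dvd_of_eq (by ring))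
    · rw [tn]
      refine (Dvd.dvd.mul_left a9 2).trans (dvd_of_eq (by ring)))
  rw [card_image_of_injOn inj] at key
  refine key.trans (add_le_add ?_ ?_)
  · have Y0 : 0 ≤ (((gN D u0 e).gcd (gN D u0 e2)).divisors.card : ℝ) ^ 4 * Yf ((gN D u0 e : ℤ) - gN D u0 e2).natAbs := mul_nonneg (by positivity) (Yf_nonneg _)
    have J1 := (Jf_G9 _).trans hg.2.2.2.1
    have J2 := (Jf_G9 _).trans hg2.2.2.2.1
    have J3 : Jf (gN D u0 e) * Jf (gN D u0 e2) ≤ C0 ^ 2 := by rw [pow_two]; exact mul_le_mul J1 J2 (Jf_nonneg _) ((Jf_nonneg _).trans J1)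
    have n4' : (10000 * D ^ 2 * T ^ 2 : ℝ) ≤ gN D u0 e := by exact_mod_cast n4
    have m4' : (10000 * D ^ 2 * T ^ 2 : ℝ) ≤ gN D u0 e2 := by exact_mod_cast m4
    have t0 : (0 : ℝ) < 10000 * D ^ 2 * T ^ 2 := by positivity
    have Q : 296 * ((2 * r : ℕ) : ℝ) ^ 2 / (gN D u0 e * gN D u0 e2) ≤ 296 * (2 * r) ^ 2 / (10000 * D ^ 2 * T ^ 2) ^ 2 := by
      push_cast
      refine div_le_div_of_nonneg_left (by positivity) (by positivity) ?_
      rw [pow_two]; exact mul_le_mul n4' m4' t0.le (t0.le.trans n4')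
    calc _ ≤ 296 * (2 * r) ^ 2 / (10000 * D ^ 2 * T ^ 2) ^ 2 * (((gN D u0 e).gcd (gN D u0 e2)).divisors.card ^ 4 * Yf ((gN D u0 e : ℤ) - gN D u0 e2).natAbs) * (C0 ^ 2) :=
          mul_le_mul (mul_le_mul_of_nonneg_right Q Y0) J3 (mul_nonneg (Jf_nonneg _) (Jf_nonneg _)) (by positivity)
      _ = _ := by ring
  · have : (((gN D u0 e : ℤ) - gN D u0 e2).natAbs : ℝ) ≤ 14000 * D ^ 2 * T ^ 2 := by
      have : ((gN D u0 e : ℤ) - gN D u0 e2).natAbs ≤ 14000 * D ^ 2 * T ^ 2 := by omega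
      exact_mod_cast this
    push_cast
    rw [show (4 : ℝ) * (2 * r) = 8 * r by ring]
    exact mul_le_mul (mul_le_mul_of_nonneg_left this (by positivity)) hE (by positivity) (by positivity)

lemma row_sum {D : ℕ} {u0 : ℤ} (h : Par D u0) (C0 : ℝ) (hC0 : 0 ≤ C0) : ∃ C : ℝ, 0 ≤ C ∧ ∀ S : ℕ, 1 ≤ S → ∀ e ∈ gBox (S ^ 2), GoodE D u0 C0 e →
    ∑ e2 ∈ gBox (S ^ 2), (if gN D u0 e = gN D u0 e2 then 0 else (((gN D u0 e).gcd (gN D u0 e2)).divisors.card : ℝ) ^ 4 * Yf ((gN D u0 e : ℤ) - gN D u0 e2).natAbs) ≤ C * S ^ 4 := by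
  have D0 := h.1
  obtain ⟨C, hC, H⟩ := pair_row (13 * D ^ 2) (14000 * D ^ 2) (Nat.mul_pos (by norm_num) (pow_pos D0 2)) (Nat.mul_pos (by norm_num) (pow_pos D0 2)) C0 hC0
  refine ⟨C, hC, fun S hS e he hg => ?_⟩
  have S0 : 0 < S ^ 2 := by positivity
  rw [gBox, sum_product]
  have row : ∀ k ∈ Ico (20 * (S ^ 2 : ℕ) : ℤ) (20 * (S ^ 2 : ℕ) + (S ^ 2 : ℕ)), ∑ l ∈ Ico (20 * (S ^ 2 : ℕ) : ℤ) (20 * (S ^ 2 : ℕ) + (S ^ 2 : ℕ)),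
     (if gN D u0 e = gN D u0 (k, l) then 0 else (((gN D u0 e).gcd (gN D u0 (k, l))).divisors.card : ℝ) ^ 4 * Yf ((gN D u0 e : ℤ) - gN D u0 (k, l)).natAbs) ≤ C * S ^ 2 := by
    intro k hk
    simp only [← ite_not (p := gN D u0 e = _)]
    rw [← sum_filter]
    obtain ⟨-, -, n3, -⟩ := gN_cast h S0 he
    refine H S hS (13 * D ^ 2) (26 * D + 4 * (u0 + D * k) * D) (8 * (u0 + D * k) ^ 2 + 4 * (u0 + D * k) + 23) (20 * (S ^ 2 : ℕ)) (by
      rw [show (13 * (D : ℤ) ^ 2) = ((13 * D ^ 2 : ℕ) : ℤ) by push_cast; ring, Int.natAbs_natCast]) _ hg.2.1 (by rw [← pow_mul] at n3; exact n3) hg.2.2.2.1 _ (fun l => gN D u0 (k, l)) ?_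
    intro l hl
    rw [mem_filter, mem_Ico] at hl
    obtain ⟨c1, -, c3, -⟩ := gN_cast h S0 (e := (k, l)) (by rw [gBox]; exact mem_product.2 ⟨hk, mem_Ico.2 hl.1⟩)
    rw [← pow_mul] at c3
    exact ⟨hl.1.1, hl.1.2, by rw [c1]; simp only [gA, gU, gV]; ring, c3, Ne.symm hl.2⟩
  refine (sum_le_sum row).trans ?_
  rw [sum_const, Int.card_Ico, nsmul_eq_mul]
  have : ((20 * (S ^ 2 : ℕ) + (S ^ 2 : ℕ) - 20 * (S ^ 2 : ℕ) : ℤ).toNat : ℝ) = S ^ 2 := by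
    rw [show (20 * (S ^ 2 : ℕ) + (S ^ 2 : ℕ) - 20 * (S ^ 2 : ℕ) : ℤ) = (S ^ 2 : ℕ) by ring, Int.toNat_natCast]; push_cast; ring
  rw [this]
  exact le_of_eq (by ring)

open Classical in
lemma off_total {D : ℕ} {u0 : ℤ} (h : Par D u0) (C0 : ℝ) (hC0 : 0 ≤ C0) : ∃ C : ℝ, 0 ≤ C ∧ ∀ S : ℕ, 1 ≤ S → ∀ (N : ℤ) (r W : ℕ) (E : ℝ), N < (r : ℤ) ^ 2 →
    (14000 * D ^ 2 * (S ^ 2) ^ 2) ^ 4 ≤ 2 * r → 3 * (14000 * D ^ 2 * (S ^ 2) ^ 2) ^ 16 ≤ W → (((Ioc 0 (2 * r)).filter fun q => Exc W q).card : ℝ) ≤ E →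
    112000 * D ^ 2 * S ^ 12 * E ≤ r → ∀ P : Finset (((ℤ × ℤ) × (ℤ × ℤ)) × ((ℤ × ℤ) × (ℤ × ℤ))),
    (∀ p ∈ P, RQ D (S ^ 2) u0 N p.1 ∧ RQ D (S ^ 2) u0 N p.2 ∧ GoodE D u0 C0 p.1.1 ∧ GoodE D u0 C0 p.2.1 ∧ gN D u0 p.1.1 ≠ gN D u0 p.2.1 ∧
      nrm p.1.2 - gN D u0 p.1.1 = nrm p.2.2 - gN D u0 p.2.1) → (P.card : ℝ) ≤ C * r ^ 2 := by
  obtain ⟨C, hC, H⟩ := row_sum h C0 hC0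
  have D0 := h.1
  refine ⟨C * C0 ^ 2 + 1, by positivity, fun S hS N r W E hr hX hW hE hE2 P hP => ?_⟩
  have S0 : 0 < S ^ 2 := by positivity
  have D1 : (1 : ℝ) ≤ D := by exact_mod_cast D0
  have S1 : (1 : ℝ) ≤ S := by exact_mod_cast hS
  set Q := (gBox (S ^ 2)).filter (GoodE D u0 C0) with hQ
  have Qc : (Q.card : ℝ) ≤ S ^ 4 := by
    have : (gBox (S ^ 2)).card = S ^ 4 := by
      rw [gBox, card_product, Int.card_Ico, show (20 * (S ^ 2 : ℕ) + (S ^ 2 : ℕ) - 20 * (S ^ 2 : ℕ) : ℤ) = (S ^ 2 : ℕ) by ring, Int.toNat_natCast]; ring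
    exact_mod_cast (card_filter_le _ _).trans this.le
  have E0 : 0 ≤ E := le_trans (by positivity) hE
  obtain ⟨k1, hk1⟩ : ∃ k1 : ℝ, k1 = 296 * (2 * r) ^ 2 / (10000 * D ^ 2 * (S ^ 2 : ℕ) ^ 2) ^ 2 * C0 ^ 2 := ⟨_, rfl⟩
  obtain ⟨k2, hk2⟩ : ∃ k2 : ℝ, k2 = 8 * r * (14000 * D ^ 2 * (S ^ 2 : ℕ) ^ 2) * E := ⟨_, rfl⟩
  have k10 : 0 ≤ k1 := by rw [hk1]; positivity
  have k20 : 0 ≤ k2 := by rw [hk2]; positivity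
  obtain ⟨V, hV⟩ : ∃ V : (ℤ × ℤ) → (ℤ × ℤ) → ℝ, V = fun e e2 => if gN D u0 e = gN D u0 e2 then 0 else (((gN D u0 e).gcd (gN D u0 e2)).divisors.card : ℝ) ^ 4 * Yf ((gN D u0 e : ℤ) - gN D u0 e2).natAbs := ⟨_, rfl⟩
  have V0 : ∀ e e2, 0 ≤ V e e2 := by
    intro e e2; rw [hV]; dsimp only; split_ifs
    · exact le_rfl
    · exact mul_nonneg (by positivity) (Yf_nonneg _)
  have fib : (P.card : ℝ) = ∑ b ∈ Q ×ˢ Q, ((P.filter fun p => (p.1.1, p.2.1) = b).card : ℝ) := by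
    rw [card_eq_sum_card_fiberwise (s := P) (t := Q ×ˢ Q) (f := fun p => (p.1.1, p.2.1))]
    · push_cast; rfl
    · intro p hp
      obtain ⟨a1, a2, a3, a4, -⟩ := hP p hp
      exact mem_coe.2 (mem_product.2 ⟨mem_filter.2 ⟨a1.1.1, a3⟩, mem_filter.2 ⟨a2.1.1, a4⟩⟩)
  have bd : ∀ b ∈ Q ×ˢ Q, ((P.filter fun p => (p.1.1, p.2.1) = b).card : ℝ) ≤ k1 * V b.1 b.2 + k2 := by
    rintro ⟨e, e2⟩ hb
    obtain ⟨b1, b2⟩ := mem_product.1 hb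
    obtain ⟨e1, g1⟩ := mem_filter.1 b1
    obtain ⟨e2', g2⟩ := mem_filter.1 b2
    by_cases hne : gN D u0 e = gN D u0 e2
    · have : (P.filter fun p => (p.1.1, p.2.1) = (e, e2)) = ∅ := by
        refine filter_eq_empty_iff.2 fun p hp hh => ?_
        simp only [Prod.mk.injEq] at hh
        exact (hP p hp).2.2.2.2.1 (by rw [hh.1, hh.2]; exact hne)
      rw [this, card_empty]
      have := V0 e e2
      simp only [Nat.cast_zero]
      positivity
    · have key := off_pair h S0 e1 g1 e2' g2 hne r W hr hX hW E hE ((P.filter fun p => (p.1.1, p.2.1) = (e, e2)).image fun p => (p.1.2, p.2.2)) (by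
        intro w hw
        obtain ⟨p, hp, rfl⟩ := mem_image.1 hw
        obtain ⟨hp1, hp2⟩ := mem_filter.1 hp
        simp only [Prod.mk.injEq] at hp2
        obtain ⟨a1, a2, -, -, -, a3⟩ := hP p hp1
        rw [hp2.1, hp2.2] at a3
        exact ⟨by rw [← hp2.1]; exact a1, by rw [← hp2.2]; exact a2, a3⟩)
      rw [card_image_of_injOn] at key
      · refine key.trans (le_of_eq ?_)
        rw [hk1, hk2, hV]; dsimp only; rw [if_neg hne]
      · intro p hp p' hp' hh
        have q1 := (mem_filter.1 hp).2
        have q2 := (mem_filter.1 hp').2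
        simp only [Prod.mk.injEq] at q1 q2 hh
        exact Prod.ext (Prod.ext (q1.1.trans q2.1.symm) hh.1) (Prod.ext (q1.2.trans q2.2.symm) hh.2)
  rw [fib]
  refine (sum_le_sum bd).trans ?_
  rw [sum_add_distrib, ← mul_sum, sum_product, sum_const, card_product, nsmul_eq_mul]
  have VV : ∑ e ∈ Q, ∑ e2 ∈ Q, V e e2 ≤ S ^ 4 * (C * S ^ 4) := by
    calc _ ≤ ∑ e ∈ Q, C * (S : ℝ) ^ 4 := by
          refine sum_le_sum fun e he => ?_
          have he' := mem_filter.1 he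
          refine le_trans (sum_le_sum_of_subset_of_nonneg (filter_subset _ _) fun e2 _ _ => V0 e e2) ?_
          have := H S hS e he'.1 he'.2
          rw [hV]; exact this
      _ = Q.card * (C * S ^ 4) := by rw [sum_const, nsmul_eq_mul]
      _ ≤ _ := by gcongr
  have r1 : k1 * ∑ e ∈ Q, ∑ e2 ∈ Q, V e e2 ≤ C * C0 ^ 2 * r ^ 2 := by
    refine (mul_le_mul_of_nonneg_left VV k10).trans ?_
    rw [hk1]
    have D4 : (1 : ℝ) ≤ D ^ 4 := one_le_pow₀ D1
    have : 296 * (2 * (r : ℝ)) ^ 2 / (10000 * D ^ 2 * (S ^ 2 : ℕ) ^ 2) ^ 2 * C0 ^ 2 * (S ^ 4 * (C * S ^ 4)) = (C * C0 ^ 2 * r ^ 2) * (1184 / (10 ^ 8 * D ^ 4)) := by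
      push_cast; field_simp; ring
    rw [this]
    refine mul_le_of_le_one_right (by positivity) ((div_le_one (by positivity)).2 (by linarith))
  have r2 : ((Q.card * Q.card : ℕ) : ℝ) * k2 ≤ r ^ 2 := by
    push_cast
    calc (Q.card : ℝ) * Q.card * k2 ≤ S ^ 4 * S ^ 4 * k2 := by gcongr
      _ = r * (112000 * D ^ 2 * S ^ 12 * E) := by rw [hk2]; push_cast; ring
      _ ≤ r * r := by gcongr
      _ = _ := by ring
  linarith

lemma cs_count {α : Type*} [DecidableEq α] (R : Finset α) (f : α → ℤ) : R.card ^ 2 ≤ (R.image f).card * ((R ×ˢ R).filter fun p => f p.1 = f p.2).card := by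
  have h1 : R.card = ∑ v ∈ R.image f, (R.filter fun w => f w = v).card := card_eq_sum_card_fiberwise fun w hw => mem_coe.2 (mem_image_of_mem f hw)
  have h2 : ((R ×ˢ R).filter fun p => f p.1 = f p.2).card = ∑ v ∈ R.image f, (R.filter fun w => f w = v).card ^ 2 := by
    rw [card_eq_sum_card_fiberwise (t := R.image f) (f := fun p => f p.1)]
    · refine sum_congr rfl fun v _ => ?_
      rw [pow_two, ← card_product]
      congr 1
      ext p
      simp only [mem_filter, mem_product]
      constructor
      · rintro ⟨⟨⟨a, b⟩, c⟩, d⟩; exact ⟨⟨a, d⟩, b, c ▸ d⟩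
      · rintro ⟨⟨a, d⟩, b, c⟩; exact ⟨⟨⟨a, b⟩, d.trans c.symm⟩, d⟩
    · intro p hp
      exact mem_coe.2 (mem_image_of_mem f (mem_product.1 (mem_filter.1 (mem_coe.1 hp)).1).1)
  rw [h2]; nth_rw 1 [h1]
  exact sq_sum_le_card_mul_sum_sq

lemma growth (K : ℕ) : ∃ J1, ∀ J, J1 ≤ J → 2 * (402 * J * (402 * J + 3)) ≤ 2 ^ J ∧ K ≤ 2 ^ J := by
  refine ⟨K + 40, fun J hJ => ⟨?_, (Nat.lt_two_pow_self.le).trans (Nat.pow_le_pow_right (by norm_num) (by omega : K ≤ J))⟩⟩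
  have : 40 ≤ J := by omega
  clear hJ
  induction J, this using Nat.le_induction with
  | base => norm_num
  | succ n hn ih => rw [pow_succ]; nlinarith

lemma params (K : ℕ) : ∃ N0 : ℕ, ∀ N : ℕ, N0 ≤ N → ∃ x J0 r J W Z : ℕ, x = 2 ^ J0 ∧ K ≤ x ∧ 1000 ≤ x ∧ N < r ^ 2 ∧ r ^ 2 ≤ 4 * N ∧ 2 * r ≤ 4 ^ J ∧ 4 ^ J ≤ 8 * r ∧ J ≤ 2 * x ∧
    J0 ≤ J ∧ Real.log ((2 * r : ℕ) : ℝ) ≤ 4 * x ∧ W = x ^ 402 ∧ Z = W ^ (402 * J0 + 2) ∧ W * Z ≤ r ∧ x ^ 402 ≤ r ∧ W = 2 ^ (402 * J0) := by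
  obtain ⟨J1, H⟩ := growth (K + 1000)
  refine ⟨2 ^ 2 ^ J1, fun N hN => ?_⟩
  have N1 : N ≠ 0 := by have : 0 < 2 ^ 2 ^ J1 := by positivity
                        omega
  obtain ⟨L, hL⟩ : ∃ L, L = Nat.log 2 N := ⟨_, rfl⟩
  have L1 : 2 ^ L ≤ N := hL ▸ Nat.pow_log_le_self 2 N1
  have L2 : N < 2 ^ (L + 1) := hL ▸ Nat.lt_pow_succ_log_self (by norm_num) N
  have L3 : 2 ^ J1 ≤ L := hL ▸ (Nat.le_log_iff_pow_le (by norm_num) N1).2 hN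
  have L0 : L ≠ 0 := by have : 0 < 2 ^ J1 := by positivity
                        omega
  obtain ⟨J0, hJ0⟩ : ∃ J0, J0 = Nat.log 2 L := ⟨_, rfl⟩
  have x1 : 2 ^ J0 ≤ L := hJ0 ▸ Nat.pow_log_le_self 2 L0
  have x2 : L < 2 ^ (J0 + 1) := hJ0 ▸ Nat.lt_pow_succ_log_self (by norm_num) L
  obtain ⟨g1, g2⟩ := H J0 (hJ0 ▸ (Nat.le_log_iff_pow_le (by norm_num) L0).2 L3)
  obtain ⟨x, hx⟩ : ∃ x, x = 2 ^ J0 := ⟨_, rfl⟩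
  rw [pow_succ] at x2
  rw [← hx] at g1 g2 x1 x2
  obtain ⟨r, hr⟩ : ∃ r, r = N.sqrt + 1 := ⟨_, rfl⟩
  have r1 : N < r ^ 2 := by rw [hr]; exact Nat.lt_succ_sqrt' N
  have r2 : N.sqrt ^ 2 ≤ N := Nat.sqrt_le' N
  have s1 : 1 ≤ N.sqrt := Nat.sqrt_pos.2 (by omega)
  have r3 : r ^ 2 ≤ 4 * N := by rw [hr]; nlinarith
  obtain ⟨J, hJ⟩ : ∃ J, J = Nat.clog 4 (2 * r) := ⟨_, rfl⟩
  have j1 : 2 * r ≤ 4 ^ J := hJ ▸ Nat.le_pow_clog (by norm_num) _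
  have j2 : 4 ^ J ≤ 8 * r := by
    have hlt : 4 ^ (J - 1) < 2 * r := hJ ▸ Nat.pow_pred_clog_lt_self (by norm_num) (by omega)
    have : 4 ^ J ≤ 4 ^ (J - 1) * 4 := by rw [← pow_succ]; exact Nat.pow_le_pow_right (by norm_num) (by omega)
    omega
  have V : (2 ^ (402 * J0)) ^ (402 * J0 + 3) ≤ r := by
    refine (lt_of_pow_lt_pow_left₀ 2 (by positivity) (lt_of_le_of_lt ?_ r1)).le
    refine le_trans ?_ L1
    rw [← pow_mul, ← pow_mul]
    exact Nat.pow_le_pow_right (by norm_num) (le_trans (le_of_eq (by ring)) (g1.trans x1))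
  have W1 : x ^ 402 = 2 ^ (402 * J0) := by rw [hx, ← pow_mul, mul_comm]
  have xr : x ^ 402 ≤ r := by rw [W1]; exact (Nat.le_self_pow (by omega) _).trans V
  have xr2 : x ^ 2 ≤ r := (Nat.pow_le_pow_right (by omega) (by norm_num)).trans xr
  have rN : r ≤ N := by
    have : 1000 ≤ r := le_trans (le_trans (by omega) (Nat.le_self_pow (n := 2) (by norm_num) x)) xr2
    nlinarith
  have jx : J ≤ x + 1 := by
    have : 2 ^ (2 * J) < 2 ^ (L + 4) := by
      rw [pow_mul, show 2 ^ (L + 4) = 2 ^ (L + 1) * 8 by rw [pow_add, pow_add]; norm_num; ring]; norm_num; omega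
    have := (Nat.pow_lt_pow_iff_right (by norm_num : 1 < 2)).1 this
    omega
  refine ⟨x, J0, r, J, 2 ^ (402 * J0), _, hx, by omega, by omega, r1, r3, j1, j2, by omega, ?_, ?_, W1.symm, rfl, ?_, xr, rfl⟩
  · have : 4 ^ J0 ≤ 4 ^ J := by
      rw [show 4 ^ J0 = x ^ 2 by rw [hx, ← pow_mul, mul_comm, pow_mul]; norm_num]; omega
    exact (Nat.pow_le_pow_iff_right (by norm_num)).1 this
  · have h1 : Real.log ((2 * r : ℕ) : ℝ) ≤ Real.log ((4 : ℝ) ^ J) := Real.log_le_log (by rw [hr]; positivity) (by exact_mod_cast j1)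
    rw [Real.log_pow, show (4 : ℝ) = 2 ^ 2 by norm_num, Real.log_pow] at h1
    have := Real.log_two_lt_d9
    have h2 : (J : ℝ) ≤ x + 1 := by exact_mod_cast jx
    have h3 : (1000 : ℝ) ≤ x := by exact_mod_cast (by omega : 1000 ≤ x)
    have h0 : (0 : ℝ) ≤ J := by positivity
    push_cast at h1 ⊢
    nlinarith
  · rw [← pow_succ']; exact V

open Classical in
lemma exc_total {x r J0 W Z D : ℕ} (x1 : 1000 ≤ x) (hD : 14000 * D ^ 2 ≤ x) (hl : Real.log ((2 * r : ℕ) : ℝ) ≤ 4 * x) (hW : W = x ^ 402) (hZ : Z = W ^ (402 * J0 + 2))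
    (hZr : W * Z ≤ r) (hW2 : W = 2 ^ (402 * J0)) :
    ∃ E : ℝ, (((Ioc 0 (2 * r)).filter fun q => Exc W q).card : ℝ) ≤ E ∧ 112000 * D ^ 2 * ((x ^ 6 : ℕ) : ℝ) ^ 12 * E ≤ r := by
  have W2 : 2 ≤ W := by rw [hW]; exact le_trans (by omega : 2 ≤ x) (Nat.le_self_pow (by norm_num) x)
  have key := exc_count W (402 * J0) (2 * r) Z W2 hW2.le hZ.symm.le
  refine ⟨((2 * r : ℕ) : ℝ) * (3 + Real.log ((2 * r : ℕ) : ℝ)) / W + Z, ?_, ?_⟩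
  · have : ((Ioc 0 (2 * r)).filter fun q => Exc W q) ⊆ ((Ioc 0 (2 * r)).filter fun q => Z < q ∧ Exc W q) ∪ Ioc 0 Z := by
      intro q hq
      obtain ⟨q1, q2⟩ := mem_filter.1 hq
      by_cases hz : Z < q
      · exact mem_union_left _ (mem_filter.2 ⟨q1, hz, q2⟩)
      · exact mem_union_right _ (mem_Ioc.2 ⟨(mem_Ioc.1 q1).1, by omega⟩)
    have := (card_le_card this).trans (card_union_le _ _)
    rw [Nat.card_Ioc, Nat.sub_zero] at this
    have t : ((((Ioc 0 (2 * r)).filter fun q => Exc W q).card : ℕ) : ℝ) ≤ (((Ioc 0 (2 * r)).filter fun q => Z < q ∧ Exc W q).card : ℝ) + Z := by exact_mod_cast this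
    linarith
  · have hD' : 14000 * (D : ℝ) ^ 2 ≤ x := by exact_mod_cast hD
    have X1 : (1000 : ℝ) ≤ x := by exact_mod_cast x1
    have WW : (16 : ℝ) * x ^ 73 * (10 * x) ≤ W := by
      rw [hW]; push_cast
      calc (16 : ℝ) * x ^ 73 * (10 * x) = 160 * (x : ℝ) ^ 74 := by ring
        _ ≤ (x : ℝ) * (x : ℝ) ^ 74 := by gcongr; linarith
        _ = (x : ℝ) ^ 75 := by ring
        _ ≤ (x : ℝ) ^ 402 := pow_le_pow_right₀ (by linarith) (by norm_num)
    have W0 : (0 : ℝ) < W := by positivity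
    have zr : (W : ℝ) * Z ≤ r := by exact_mod_cast hZr
    have w2 : 16 * (x : ℝ) ^ 73 ≤ W := le_trans (le_mul_of_one_le_right (by positivity) (by linarith)) WW
    have e1 : ((2 * r : ℕ) : ℝ) * (3 + Real.log ((2 * r : ℕ) : ℝ)) / W ≤ (r : ℝ) * (10 * x) / W := by
      refine div_le_div_of_nonneg_right ?_ W0.le
      have : (3 + Real.log ((2 * r : ℕ) : ℝ)) ≤ 5 * x := by linarith
      calc ((2 * r : ℕ) : ℝ) * (3 + Real.log ((2 * r : ℕ) : ℝ)) ≤ ((2 * r : ℕ) : ℝ) * (5 * x) := by gcongr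
        _ = _ := by push_cast; ring
    calc 112000 * (D : ℝ) ^ 2 * ((x ^ 6 : ℕ) : ℝ) ^ 12 * (((2 * r : ℕ) : ℝ) * (3 + Real.log ((2 * r : ℕ) : ℝ)) / W + Z)
        ≤ 112000 * (D : ℝ) ^ 2 * ((x ^ 6 : ℕ) : ℝ) ^ 12 * ((r : ℝ) * (10 * (x : ℝ)) / (W : ℝ) + (Z : ℝ)) := by gcongr
      _ = 8 * (14000 * (D : ℝ) ^ 2) * (x : ℝ) ^ 72 * ((r : ℝ) * (10 * (x : ℝ)) / (W : ℝ) + (Z : ℝ)) := by push_cast; ring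
      _ ≤ 8 * (x : ℝ) * (x : ℝ) ^ 72 * ((r : ℝ) * (10 * (x : ℝ)) / (W : ℝ) + (Z : ℝ)) := by gcongr
      _ = (16 * (x : ℝ) ^ 73 * (10 * (x : ℝ))) * ((r : ℝ) / (W : ℝ)) / 2 + 16 * (x : ℝ) ^ 73 * (Z : ℝ) / 2 := by ring
      _ ≤ (W : ℝ) * ((r : ℝ) / (W : ℝ)) / 2 + (W : ℝ) * (Z : ℝ) / 2 := by gcongr
      _ ≤ r := by rw [mul_div_cancel₀ _ W0.ne']; linarith

lemma M_exists {x N r D : ℕ} (x1 : 1000 ≤ x) (hD : 14000 * D ^ 2 ≤ x) (D0 : 0 < D) (hr : N < r ^ 2) (hr4 : r ^ 2 ≤ 4 * N) (xr : x ^ 402 ≤ r) (hl : Real.log ((2 * r : ℕ) : ℝ) ≤ 4 * x) :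
    ∃ M : ℕ, 500 * (14000 * D ^ 2 * x ^ 24) * M ^ 2 ≤ N ∧ N ≤ 28000000 * D ^ 2 * x ^ 24 * M ^ 2 ∧ ∀ a : ℕ, a ≤ 14000 * D ^ 2 * x ^ 24 → 10 + 2 * Real.log M + a ≤ M / 20 := by
  obtain ⟨q, hq⟩ : ∃ q, q = 500 * (14000 * D ^ 2 * x ^ 24) := ⟨_, rfl⟩
  have q0 : 0 < q := by rw [hq]; positivity
  have p25 : 14000 * D ^ 2 * x ^ 24 ≤ x ^ 25 := by rw [pow_succ' x 24]; gcongr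
  have p26 : q ≤ x ^ 26 := by rw [hq, pow_succ' x 25]; gcongr; omega
  obtain ⟨M, hM⟩ : ∃ M, M = (N / q).sqrt := ⟨_, rfl⟩
  have m1 : M ^ 2 ≤ N / q := hM ▸ Nat.sqrt_le' _
  have m2 : N / q < (M + 1) ^ 2 := hM ▸ Nat.lt_succ_sqrt' _
  have m3 : q * M ^ 2 ≤ N := (Nat.mul_le_mul_left q m1).trans (Nat.mul_div_le N q)
  have m4 : N < (M + 1) ^ 2 * q := (Nat.div_lt_iff_lt_mul q0).1 m2
  have mb : x ^ 27 ≤ M := by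
    by_contra hc
    have h1 : (M + 1) ^ 2 * q ≤ (x ^ 27) ^ 2 * x ^ 26 := Nat.mul_le_mul (Nat.pow_le_pow_left (by omega) 2) p26
    have h2 : (x ^ 27) ^ 2 * x ^ 26 ≤ x ^ 81 := by rw [← pow_mul, ← pow_add]; exact Nat.pow_le_pow_right (by omega) (by norm_num)
    have h3 : (x ^ 402) ^ 2 ≤ r ^ 2 := Nat.pow_le_pow_left xr 2
    have h4 : 4 * x ^ 81 ≤ (x ^ 402) ^ 2 := by
      calc 4 * x ^ 81 ≤ x * x ^ 81 := by gcongr; omega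
        _ = x ^ 82 := by ring
        _ ≤ x ^ 804 := Nat.pow_le_pow_right (by omega) (by norm_num)
        _ = _ := by rw [← pow_mul]
    omega
  have xs : x ≤ x ^ 25 := Nat.le_self_pow (by norm_num) x
  have x27 : 1000000 * x ^ 25 ≤ x ^ 27 := by
    calc 1000000 * x ^ 25 = 1000 * (1000 * x ^ 25) := by ring
      _ ≤ x * (x * x ^ 25) := by gcongr
      _ = x ^ 27 := by ring
  refine ⟨M, hq ▸ m3, ?_, fun a ha => ?_⟩
  · have : (M + 1) ^ 2 ≤ 4 * M ^ 2 := by nlinarith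
    calc N ≤ (M + 1) ^ 2 * q := m4.le
      _ ≤ 4 * M ^ 2 * q := by gcongr
      _ = _ := by rw [hq]; ring
  · have Mr : M ≤ 2 * r := by
      have : M ^ 2 < r ^ 2 := lt_of_le_of_lt (m1.trans (Nat.div_le_self _ _)) hr
      have := lt_of_pow_lt_pow_left₀ 2 (by positivity) this
      omega
    have lM : Real.log M ≤ 4 * x := (Real.log_le_log (by norm_cast; omega) (by exact_mod_cast Mr)).trans hl
    have c : 20 * (10 + 8 * x + a) ≤ M := by omega
    have c' : (20 : ℝ) * (10 + 8 * x + a) ≤ M := by exact_mod_cast c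
    linarith

lemma fin_arith {N K R I P G : ℝ} (N1 : 1 ≤ N) (K0 : 0 < K) (I0 : 0 ≤ I) (G0 : 0 < G) (h1 : N ≤ K * R) (h2 : R ^ 2 ≤ I * P) (h3 : P ≤ G * (4 * N)) :
    1 / (K ^ 2 * (4 * G)) * N ≤ I := by
  rw [div_mul_eq_mul_div, one_mul, div_le_iff₀ (by positivity)]
  refine le_of_mul_le_mul_right (a := N) ?_ (by linarith)
  calc N * N ≤ (K * R) * (K * R) := mul_self_le_mul_self (by linarith) h1
    _ = K ^ 2 * R ^ 2 := by ring
    _ ≤ K ^ 2 * (I * (G * (4 * N))) := by gcongr; exact h2.trans (by gcongr)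
    _ = _ := by ring

set_option maxHeartbeats 1000000 in
theorem stmt17 :
    ∃ c : ℝ, 0 < c ∧ ∃ N₀ : ℕ, ∀ N : ℕ, N₀ ≤ N →
      c * (N : ℝ) ≤ (Nat.card {n : ℤ | 1 ≤ n ∧ n ≤ (N : ℤ) ∧ n ∈ curvatures} : ℝ) := by
  classical
  obtain ⟨D, u0, h⟩ := par_exists
  obtain ⟨C0, hC0, S0, hS0, HM⟩ := mass_family h
  obtain ⟨C, hC, HO⟩ := off_total h C0 (by linarith)
  have D0 := h.1
  obtain ⟨Ct, -, Ht⟩ := tau_small 24 (14000 * D ^ 2) (by norm_num) (Nat.mul_pos (by norm_num) (pow_pos D0 2))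
  obtain ⟨N0, HN⟩ := params (14000 * D ^ 2 + S0 + Ct)
  have Dr : (0 : ℝ) < D := by exact_mod_cast D0
  have K0 : (0 : ℝ) < 560000000 * D ^ 2 := by positivity
  refine ⟨1 / ((560000000 * D ^ 2) ^ 2 * (4 * (10 ^ 11 + C))), by positivity, max N0 1, fun N hN => ?_⟩
  obtain ⟨x, J0, r, J, W, Z, hx, xK, x1, r1, r4, j1, j2, j3, j4, lg, hW, hZ, hZr, xr, hW2⟩ := HN N (le_of_max_le_left hN)
  have N1 : 1 ≤ N := le_of_max_le_right hN
  have xD : 14000 * D ^ 2 ≤ x := by omega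
  have xp : ∀ n, n ≤ 402 → x ^ n ≤ r := fun n hn => (Nat.pow_le_pow_right (by omega) hn).trans xr
  have S1 : 1 ≤ x ^ 6 := Nat.one_le_pow _ _ (by omega)
  obtain ⟨T, hT⟩ : ∃ T, T = (x ^ 6) ^ 2 := ⟨_, rfl⟩
  have T12 : T = x ^ 12 := by rw [hT, ← pow_mul]
  have T24 : T ^ 2 = x ^ 24 := by rw [T12, ← pow_mul]
  have T0 : 0 < T := by rw [hT]; positivity
  have a25 : 14000 * D ^ 2 * T ^ 2 ≤ x ^ 25 := by rw [T24, pow_succ' x 24]; gcongr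
  obtain ⟨M, m1, m2, m3⟩ := M_exists x1 xD D0 r1 r4 xr lg
  obtain ⟨E, hE1, hE2⟩ := exc_total x1 xD lg hW hZ hZr hW2
  have mass := HM (x ^ 6) (le_trans (by omega) (Nat.le_self_pow (n := 6) (by norm_num) x))
  rw [← hT] at mass
  set Q := (gBox T).filter (GoodE D u0 C0) with hQ
  have per : ∀ e : ℤ × ℤ, ∃ F : Finset (ℤ × ℤ), e ∈ Q → (M : ℝ) ^ 2 / 10 ≤ F.card ∧ ∀ z ∈ F, RQ D T u0 N (e, z) := by
    intro e
    by_cases he : e ∈ Q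
    · obtain ⟨he1, he2⟩ := mem_filter.1 he
      obtain ⟨-, -, n3, -⟩ := gN_cast h T0 he1
      rw [T24] at n3
      obtain ⟨F, hF⟩ := mass_e h T0 he1 he2 M (N := N) (m3 _ n3) (by
        have : 500 * gN D u0 e * M ^ 2 ≤ N := le_trans (by gcongr) m1
        exact_mod_cast this)
      exact ⟨F, fun _ => hF⟩
    · exact ⟨∅, fun h => absurd h he⟩
  choose F hF using per
  obtain ⟨R, hR⟩ : ∃ R : Finset ((ℤ × ℤ) × (ℤ × ℤ)), R = Q.biUnion fun e => (F e).image fun z => (e, z) := ⟨_, rfl⟩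
  have Rm : ∀ w ∈ R, w.1 ∈ Q ∧ RQ D T u0 N w := by
    intro w hw
    rw [hR, mem_biUnion] at hw
    obtain ⟨e, he, hw⟩ := hw
    obtain ⟨z, hz, rfl⟩ := mem_image.1 hw
    exact ⟨he, (hF e he).2 z hz⟩
  have Rc : (N : ℝ) ≤ 560000000 * D ^ 2 * R.card := by
    have h1 : (R.card : ℝ) = ∑ e ∈ Q, ((F e).card : ℝ) := by
      rw [hR, card_biUnion]
      · push_cast
        refine sum_congr rfl fun e _ => ?_
        rw [card_image_of_injective _ fun z z' hh => (Prod.mk.inj hh).2]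
      · intro e _ e' _ hne
        refine disjoint_left.2 fun w hw hw' => hne ?_
        obtain ⟨z, -, rfl⟩ := mem_image.1 hw
        obtain ⟨z', -, h2⟩ := mem_image.1 hw'
        exact (Prod.mk.inj h2).1.symm
    have h2 : (Q.card : ℝ) * ((M : ℝ) ^ 2 / 10) ≤ R.card := by
      rw [h1, ← nsmul_eq_mul]; exact card_nsmul_le_sum _ _ _ fun e he => (hF e he).1
    have h3 : ((x ^ 6 : ℕ) : ℝ) ^ 4 / 2 * ((M : ℝ) ^ 2 / 10) ≤ R.card := (mul_le_mul_of_nonneg_right mass (by positivity)).trans h2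
    have h4 : (N : ℝ) ≤ 28000000 * D ^ 2 * x ^ 24 * M ^ 2 := by exact_mod_cast m2
    calc (N : ℝ) ≤ 28000000 * D ^ 2 * x ^ 24 * M ^ 2 := h4
      _ = 560000000 * D ^ 2 * (((x ^ 6 : ℕ) : ℝ) ^ 4 / 2 * ((M : ℝ) ^ 2 / 10)) := by push_cast; ring
      _ ≤ _ := by gcongr
  obtain ⟨f, hf⟩ : ∃ f : (ℤ × ℤ) × (ℤ × ℤ) → ℤ, f = fun w => nrm w.2 - gN D u0 w.1 := ⟨_, rfl⟩
  have cs := cs_count R f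
  obtain ⟨P, hP⟩ : ∃ P, P = (R ×ˢ R).filter fun p => f p.1 = f p.2 := ⟨_, rfl⟩
  have Pm : ∀ p ∈ P, p.1 ∈ R ∧ p.2 ∈ R ∧ nrm p.1.2 - gN D u0 p.1.1 = nrm p.2.2 - gN D u0 p.2.1 := by
    intro p hp
    rw [hP, mem_filter, mem_product, hf] at hp
    exact ⟨hp.1.1, hp.1.2, hp.2⟩
  rw [← hP] at cs
  have Rr : (N : ℤ) < (r : ℤ) ^ 2 := by exact_mod_cast r1
  obtain ⟨t, ht⟩ : ∃ t, t = Nat.sqrt x := ⟨_, rfl⟩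
  have t2 : t ^ 2 ≤ x := ht ▸ Nat.sqrt_le' x
  have dg : ((P.filter fun p => gN D u0 p.1.1 = gN D u0 p.2.1).card : ℝ) ≤ 10 ^ 11 * r ^ 2 := by
    refine diag_bound h T0 r J J0 t Rr j1 j4 ?_ ?_ (hx ▸ t2) ?_ ?_ ?_ ?_ _ ?_
    · intro k k1 k2
      rw [ht, Nat.le_sqrt']
      refine (pow_le_pow_iff_left₀ (by positivity) (by positivity) (by norm_num : 12 ≠ 0)).1 ?_
      rw [← pow_mul]
      refine (Ht (x ^ 6) S1 k k1 (by rw [hT, ← pow_mul] at k2; exact k2)).trans ?_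
      calc Ct * x ^ 6 ≤ x * x ^ 6 := by gcongr; omega
        _ = x ^ 7 := by ring
        _ ≤ x ^ 12 := Nat.pow_le_pow_right (by omega) (by norm_num)
    · rw [T12, hx, ← pow_mul, show 4096 = 2 ^ 12 by norm_num, ← pow_mul, mul_comm]
    · rw [T24]
      calc J * t ^ 2 ≤ 2 * x * x := by gcongr
        _ ≤ x * x * x := by gcongr; omega
        _ = x ^ 3 := by ring
        _ ≤ x ^ 24 := Nat.pow_le_pow_right (by omega) (by norm_num)
    · refine (pow_le_pow_iff_left₀ (by positivity) (by positivity) (by norm_num : 2 ≠ 0)).1 ?_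
      calc (t ^ 2 * 2 ^ J) ^ 2 ≤ (x * 2 ^ J) ^ 2 := by gcongr
        _ = x ^ 2 * 4 ^ J := by rw [mul_pow, ← pow_mul, mul_comm J, pow_mul]; norm_num
        _ ≤ x ^ 2 * (8 * r) := by gcongr
        _ = 8 * x ^ 2 * r := by ring
        _ ≤ x * x ^ 2 * r := by gcongr; omega
        _ = x ^ 3 * r := by ring
        _ ≤ r * r := by gcongr; exact xp 3 (by norm_num)
        _ = r ^ 2 := by ring
    · calc D ^ 2 * T ^ 2 * t ^ 2 * J ≤ x * x ^ 24 * x * (2 * x) := by rw [T24]; gcongr; omega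
        _ ≤ x * x ^ 24 * x * (x * x) := by gcongr; omega
        _ = x ^ 28 := by ring
        _ ≤ r := xp 28 (by norm_num)
    · calc D * T ^ 2 ≤ x * x ^ 24 := by rw [T24]; gcongr; nlinarith
        _ = x ^ 25 := by ring
        _ ≤ r := xp 25 (by norm_num)
    · intro p hp
      obtain ⟨hp1, hp2⟩ := mem_filter.1 hp
      obtain ⟨a1, a2, a3⟩ := Pm p hp1
      rw [hp2] at a3
      exact ⟨(Rm _ a1).2.1, (Rm _ a2).2.1, hp2, by linarith⟩
  have od : ((P.filter fun p => ¬ gN D u0 p.1.1 = gN D u0 p.2.1).card : ℝ) ≤ C * r ^ 2 := by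
    refine HO (x ^ 6) S1 N r W E Rr ?_ ?_ hE1 hE2 _ ?_
    · rw [← hT]
      calc _ ≤ (x ^ 25) ^ 4 := by gcongr
        _ = x ^ 100 := by rw [← pow_mul]
        _ ≤ r := xp 100 (by norm_num)
        _ ≤ 2 * r := by omega
    · rw [← hT]
      calc _ ≤ 3 * (x ^ 25) ^ 16 := by gcongr
        _ ≤ x * (x ^ 25) ^ 16 := by gcongr; omega
        _ = x ^ 401 := by ring
        _ ≤ W := by rw [hW]; exact Nat.pow_le_pow_right (by omega) (by norm_num)
    · intro p hp
      obtain ⟨hp1, hp2⟩ := mem_filter.1 hp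
      obtain ⟨a1, a2, a3⟩ := Pm p hp1
      rw [← hT]
      exact ⟨(Rm _ a1).2, (Rm _ a2).2, (mem_filter.1 (Rm _ a1).1).2, (mem_filter.1 (Rm _ a2).1).2, hp2, a3⟩
  have Pc : (P.card : ℝ) ≤ (10 ^ 11 + C) * (4 * N) := by
    have e1 : (P.card : ℝ) = ((P.filter fun p => gN D u0 p.1.1 = gN D u0 p.2.1).card : ℝ) + ((P.filter fun p => ¬ gN D u0 p.1.1 = gN D u0 p.2.1).card : ℝ) := by
      rw [← card_filter_add_card_filter_not (s := P) fun p => gN D u0 p.1.1 = gN D u0 p.2.1]; push_cast; rfl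
    have e2 : (r : ℝ) ^ 2 ≤ 4 * N := by exact_mod_cast r4
    calc (P.card : ℝ) ≤ (10 ^ 11 + C) * r ^ 2 := by rw [e1]; linarith
      _ ≤ _ := by gcongr
  have Ic : ((R.image f).card : ℝ) ≤ (Nat.card {n : ℤ | 1 ≤ n ∧ n ≤ (N : ℤ) ∧ n ∈ curvatures} : ℝ) := by
    have fin : ({n : ℤ | 1 ≤ n ∧ n ≤ (N : ℤ) ∧ n ∈ curvatures}).Finite := (Set.finite_Icc (1 : ℤ) N).subset fun n hn => ⟨hn.1, hn.2.1⟩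
    rw [Nat.cast_le, Nat.card_coe_set_eq, ← Set.ncard_coe_finset]
    refine Set.ncard_le_ncard ?_ fin
    intro n hn
    obtain ⟨w, hw, rfl⟩ := mem_image.1 (mem_coe.1 hn)
    obtain ⟨-, ⟨-, -, -, b1, -⟩, -, b2, b3⟩ := Rm w hw
    rw [hf]
    exact ⟨by dsimp only; linarith, by dsimp only; linarith [Int.natCast_nonneg (gN D u0 w.1)], b3⟩
  refine le_trans ?_ Ic
  have cs' : (R.card : ℝ) ^ 2 ≤ (R.image f).card * P.card := by exact_mod_cast cs
  have Nr : (1 : ℝ) ≤ N := by exact_mod_cast N1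
  exact fin_arith Nr K0 (by positivity) (by linarith) Rc cs' Pc
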